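/- Every knot projection on the sphere S² with n crossings can be obtained from the trivial projection by a sequence of exactly n half-twisted splices A. -/

import Mathlib

open Set Topology

noncomputable section

/-- Euclidean 3-space. -/
abbrev E3 := EuclideanSpace ℝ (Fin 3)

/-- The sphere `S²`, realized as the unit sphere in `ℝ³`. -/
def S2 : Set E3 := Metric.sphere 0 1

/-- Points of the sphere `S²`. -/
abbrev SPt := ↥S2

/-- A knot projection on the sphere `S²`: a closed curve (parameterized by `ℝ` with
period `1`) immersed in `S²` whose only self-intersections are finitely many
transverse double points (points with two preimages in a period and four local
branches). -/
structure KnotProjection where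
  f : ℝ → SPt
  periodic : Function.Periodic f 1
  continuous' : Continuous f
  loc_inj : ∀ t : ℝ, ∃ ε > 0, Set.InjOn f (Set.Ioo (t - ε) (t + ε))
  fiber_finite : ∀ p : SPt, {t | t ∈ Set.Ico (0:ℝ) 1 ∧ f t = p}.Finite
  fiber_le_two : ∀ p : SPt, ({t | t ∈ Set.Ico (0:ℝ) 1 ∧ f t = p}).ncard ≤ 2
  double_finite : {p : SPt | ({t | t ∈ Set.Ico (0:ℝ) 1 ∧ f t = p}).ncard = 2}.Finite
  transverse : ∀ p : SPt, ({t | t ∈ Set.Ico (0:ℝ) 1 ∧ f t = p}).ncard = 2 →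
    ∀ V ∈ nhds p, ∃ U ∈ nhds p, U ⊆ V ∧
      {C : Set SPt | ∃ x ∈ (U ∩ Set.range f) \ {p},
        C = connectedComponentIn ((U ∩ Set.range f) \ {p}) x}.ncard = 4

namespace KnotProjection

/-- The underlying subset of `S²` of a knot projection. -/
def image (P : KnotProjection) : Set SPt := Set.range P.f

/-- The crossings (double points) of a knot projection. -/
def crossings (P : KnotProjection) : Set SPt :=
  {p | ({t | t ∈ Set.Ico (0:ℝ) 1 ∧ P.f t = p}).ncard = 2}

/-- A knot projection is nontrivial if it has at least one crossing. -/
def Nontrivial (P : KnotProjection) : Prop := P.crossings.Nonempty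

/-- The regions of a knot projection: the connected components of the complement. -/
def regions (P : KnotProjection) : Set (Set SPt) :=
  {R | ∃ x ∈ P.imageᶜ, R = connectedComponentIn P.imageᶜ x}

/-- A crossing is reducible if only three distinct regions are adjacent to it. -/
def ReducibleCrossing (P : KnotProjection) (c : SPt) : Prop :=
  c ∈ P.crossings ∧ ({R ∈ P.regions | c ∈ closure R}).ncard = 3

/-- A knot projection is reduced if it has no reducible crossing. -/
def Reduced (P : KnotProjection) : Prop := ∀ c, ¬ P.ReducibleCrossing c

end KnotProjection

/-- The trivial projection: no crossings. -/
def IsTrivialProjection (P : KnotProjection) : Prop := P.crossings = ∅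

/-- The trefoil projection: the (unique up to homeomorphism of `S²`) reduced knot
projection with exactly three crossings. -/
def IsTrefoilProjection (P : KnotProjection) : Prop :=
  P.Reduced ∧ P.crossings.ncard = 3

/-- A subset of the sphere which is a (closed) arc. -/
def IsArc (a : Set SPt) : Prop := Nonempty (↥a ≃ₜ ↥(Set.Icc (0:ℝ) 1))

/-- A subset of the sphere which is a closed topological disk. -/
def IsClosedDisk (D : Set SPt) : Prop :=
  Nonempty (↥D ≃ₜ ↥(Metric.closedBall (0 : EuclideanSpace ℝ (Fin 2)) 1))

/-- Equivalence of (oriented) knot projections: an ambient self-homeomorphism of the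
sphere carrying one onto the other, in an orientation (of the curve) preserving way. -/
def ProjEquiv (P Q : KnotProjection) : Prop :=
  ∃ h : SPt ≃ₜ SPt, ∃ φ : ℝ → ℝ, StrictMono φ ∧ Continuous φ ∧
    (∀ t, φ (t + 1) = φ t + 1) ∧ ∀ t, h (P.f t) = Q.f (φ t)

/-- The half-twisted splice `A`: inside a disk `D` meeting `P` in two disjoint
arcs, replace the two arcs by two arcs crossing exactly once (joining the same four
boundary points, with the pairing swapped), leaving everything outside `D`
unchanged and creating exactly one new crossing `q`. -/
def HalfTwistedSplice (P Q : KnotProjection) : Prop :=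
  ∃ D : Set SPt, ∃ q : SPt, IsClosedDisk D ∧
    P.image \ D = Q.image \ D ∧
    P.image ∩ frontier D = Q.image ∩ frontier D ∧
    P.crossings ∩ D = ∅ ∧
    q ∈ D \ frontier D ∧
    q ∉ P.crossings ∧
    Q.crossings = insert q P.crossings ∧
    (∃ a₁ a₂ : Set SPt, IsArc a₁ ∧ IsArc a₂ ∧ Disjoint a₁ a₂ ∧
      P.image ∩ D = a₁ ∪ a₂ ∧
      (a₁ ∩ frontier D).ncard = 2 ∧ (a₂ ∩ frontier D).ncard = 2 ∧
      ∃ b₁ b₂ : Set SPt, IsArc b₁ ∧ IsArc b₂ ∧ b₁ ∩ b₂ = {q} ∧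
        Q.image ∩ D = b₁ ∪ b₂ ∧
        (b₁ ∩ frontier D).ncard = 2 ∧ (b₂ ∩ frontier D).ncard = 2 ∧
        (b₁ ∩ frontier D ∩ a₁).ncard = 1 ∧ (b₁ ∩ frontier D ∩ a₂).ncard = 1 ∧
        (b₂ ∩ frontier D ∩ a₁).ncard = 1 ∧ (b₂ ∩ frontier D ∩ a₂).ncard = 1)

/-- One application of the half-twisted splice `A`, up to equivalence of projections. -/
def SpliceStep (P Q : KnotProjection) : Prop :=
  ∃ P' Q', ProjEquiv P P' ∧ HalfTwistedSplice P' Q' ∧ ProjEquiv Q' Q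

/-- One application of `A` or of its inverse `A⁻¹`. -/
def AStep (P Q : KnotProjection) : Prop := SpliceStep P Q ∨ SpliceStep Q P

/-- One application of `A` or `A⁻¹` whose result is reduced. -/
def AStepReduced (P Q : KnotProjection) : Prop := AStep P Q ∧ Q.Reduced

/-- One application of `A` or `A⁻¹` creating no reducible crossing. -/
def AStepNoNewReducible (P Q : KnotProjection) : Prop :=
  AStep P Q ∧ {c | Q.ReducibleCrossing c}.ncard ≤ {c | P.ReducibleCrossing c}.ncard

/-- Local description of the move `B` at the crossing `c` inside a disk `D`:
the two arcs of `P` crossing once at `c` are replaced by two arcs (with the same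
endpoints and the same endpoint pairing) forming a braided tangle with three
crossings. -/
def BLocal (P Q : KnotProjection) (c : SPt) (D : Set SPt) : Prop :=
  IsClosedDisk D ∧ c ∈ D \ frontier D ∧
  P.image ∩ frontier D = Q.image ∩ frontier D ∧
  P.crossings ∩ D = {c} ∧ (Q.crossings ∩ D).ncard = 3 ∧
  ∃ a₁ a₂ : Set SPt, IsArc a₁ ∧ IsArc a₂ ∧ a₁ ∩ a₂ = {c} ∧
    P.image ∩ D = a₁ ∪ a₂ ∧
    (a₁ ∩ frontier D).ncard = 2 ∧ (a₂ ∩ frontier D).ncard = 2 ∧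
    ∃ b₁ b₂ : Set SPt, IsArc b₁ ∧ IsArc b₂ ∧ b₁ ∩ b₂ = Q.crossings ∩ D ∧
      Q.image ∩ D = b₁ ∪ b₂ ∧
      (b₁ ∩ frontier D).ncard = 2 ∧ (b₂ ∩ frontier D).ncard = 2 ∧
      (b₁ ∩ frontier D ∩ a₁).ncard = 1 ∧ (b₁ ∩ frontier D ∩ a₂).ncard = 1 ∧
      (b₂ ∩ frontier D ∩ a₁).ncard = 1 ∧ (b₂ ∩ frontier D ∩ a₂).ncard = 1

/-- The move `B` applied at the crossing `c` of `P`, adding exactly two crossings. -/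
def MoveB (P : KnotProjection) (c : SPt) (Q : KnotProjection) : Prop :=
  c ∈ P.crossings ∧ ∃ D : Set SPt, BLocal P Q c D ∧
    P.image \ D = Q.image \ D ∧ P.crossings \ D = Q.crossings \ D

/-- The knot projection `Q` is obtained from `P` by applying the move `B` at all
the crossings of `P` (simultaneously, in pairwise disjoint disks). -/
def MoveBAll (P Q : KnotProjection) : Prop :=
  ∃ D : SPt → Set SPt,
    P.crossings.PairwiseDisjoint D ∧
    (∀ c ∈ P.crossings, BLocal P Q c (D c)) ∧
    P.image \ (⋃ c ∈ P.crossings, D c) = Q.image \ (⋃ c ∈ P.crossings, D c) ∧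
    P.crossings \ (⋃ c ∈ P.crossings, D c) = Q.crossings \ (⋃ c ∈ P.crossings, D c)

/-- The closed complementary region of a disk on the sphere. -/
def SphCompl (D : Set SPt) : Set SPt := Dᶜ ∪ frontier D

/-- Witness of a connected sum decomposition: a disk `D` whose boundary circle meets
`R` in exactly two points, such that `R` inside `D`, closed up by a boundary arc, is a
copy of `Q` (via the ambient homeomorphism `h`), and `R` outside `D`, closed up by a
boundary arc, is a copy of `P`. -/
def ConnSumWitness (R P Q : KnotProjection) (D : Set SPt) (h : SPt ≃ₜ SPt) : Prop :=
  IsClosedDisk D ∧ IsClosedDisk (SphCompl D) ∧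
  (R.image ∩ frontier D).ncard = 2 ∧ R.crossings ∩ frontier D = ∅ ∧
  (∃ α : Set SPt, IsArc α ∧ α ⊆ frontier D ∧
    h '' Q.image = (R.image ∩ D) ∪ α ∧ h '' Q.crossings = R.crossings ∩ D) ∧
  (∃ β : Set SPt, ∃ g : SPt ≃ₜ SPt, IsArc β ∧ β ⊆ frontier D ∧
    g '' P.image = (R.image ∩ SphCompl D) ∪ β ∧ g '' P.crossings = R.crossings \ D)

/-- `R` is a connected sum of the knot projections `P` and `Q`. -/
def IsConnectedSum (R P Q : KnotProjection) : Prop := ∃ D h, ConnSumWitness R P Q D h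

/-- `R` is a connected sum of `P` and `Q` formed at the region `reg` of `Q`
(the copy of `P` is inserted into the region `reg`). -/
def IsConnectedSumInRegion (R P Q : KnotProjection) (reg : Set SPt) : Prop :=
  reg ∈ Q.regions ∧ ∃ D h, ConnSumWitness R P Q D h ∧ Dᶜ ⊆ h '' reg

/-- A triangle region: a region adjacent to exactly three crossings. -/
def IsTriangleRegion (Q : KnotProjection) (reg : Set SPt) : Prop :=
  reg ∈ Q.regions ∧ (closure reg ∩ Q.crossings).ncard = 3

/-- A bigon region: a region adjacent to exactly two crossings. -/
def IsBigonRegion (Q : KnotProjection) (reg : Set SPt) : Prop :=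
  reg ∈ Q.regions ∧ (closure reg ∩ Q.crossings).ncard = 2

/-- Connected sums of `n` copies of the trefoil projection. -/
inductive IsConnSumOfTrefoils : ℕ → KnotProjection → Prop
  | base (P : KnotProjection) : IsTrefoilProjection P → IsConnSumOfTrefoils 1 P
  | step (n : ℕ) (P Q R : KnotProjection) : IsConnSumOfTrefoils n P →
      IsTrefoilProjection Q → IsConnectedSum R P Q → IsConnSumOfTrefoils (n + 1) R

/-- An oriented piece of a knot projection running from `x` to `y` with underlying
set `a`. -/
def OrientedPiece (P : KnotProjection) (x y : SPt) (a : Set SPt) : Prop :=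
  ∃ s u : ℝ, s < u ∧ u < s + 1 ∧ P.f s = x ∧ P.f u = y ∧ P.f '' Set.Icc s u = a

/-- Common frame of a local move supported in a disk `D`. -/
def LocalFrame (P Q : KnotProjection) (D : Set SPt) : Prop :=
  IsClosedDisk D ∧ P.image \ D = Q.image \ D ∧
  P.image ∩ frontier D = Q.image ∩ frontier D ∧
  P.crossings \ D = Q.crossings \ D ∧
  P.crossings ∩ frontier D = ∅ ∧ Q.crossings ∩ frontier D = ∅

/-- On the circle `C`, the pair `{a, b}` separates `c` from `d`. -/
def SeparatesOn (C : Set SPt) (a b c d : SPt) : Prop :=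
  c ∈ C \ {a, b} ∧ d ∈ C \ {a, b} ∧
  connectedComponentIn (C \ {a, b}) c ≠ connectedComponentIn (C \ {a, b}) d

/-- The oriented projection Reidemeister move `Ω1+` (adding a kink);
`Ω1−` is its inverse. -/
def OmegaOne (P Q : KnotProjection) : Prop :=
  ∃ D : Set SPt, ∃ x y q : SPt, LocalFrame P Q D ∧ x ≠ y ∧
    P.image ∩ frontier D = {x, y} ∧
    P.crossings ∩ D = ∅ ∧ Q.crossings ∩ D = {q} ∧
    (∃ a, IsArc a ∧ P.image ∩ D = a ∧ OrientedPiece P x y a) ∧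
    (∃ b, Q.image ∩ D = b ∧ OrientedPiece Q x y b ∧ q ∈ b)

/-- Core of the projection Reidemeister moves `Ω2` : two disjoint oriented strands
become two strands crossing twice. -/
def OmegaTwoCore (P Q : KnotProjection) (D : Set SPt) (x₁ y₁ x₂ y₂ : SPt) : Prop :=
  LocalFrame P Q D ∧
  P.image ∩ frontier D = {x₁, y₁, x₂, y₂} ∧
  ({x₁, y₁, x₂, y₂} : Set SPt).ncard = 4 ∧
  P.crossings ∩ D = ∅ ∧ (Q.crossings ∩ D).ncard = 2 ∧
  (∃ a₁ a₂ : Set SPt, IsArc a₁ ∧ IsArc a₂ ∧ Disjoint a₁ a₂ ∧ P.image ∩ D = a₁ ∪ a₂ ∧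
    OrientedPiece P x₁ y₁ a₁ ∧ OrientedPiece P x₂ y₂ a₂) ∧
  (∃ b₁ b₂ : Set SPt, IsArc b₁ ∧ IsArc b₂ ∧ b₁ ∩ b₂ = Q.crossings ∩ D ∧
    Q.image ∩ D = b₁ ∪ b₂ ∧ OrientedPiece Q x₁ y₁ b₁ ∧ OrientedPiece Q x₂ y₂ b₂)

/-- The oriented projection Reidemeister move `Ω2+` (parallel strands);
`Ω2−` is its inverse. -/
def OmegaTwoPar (P Q : KnotProjection) : Prop :=
  ∃ D x₁ y₁ x₂ y₂, OmegaTwoCore P Q D x₁ y₁ x₂ y₂ ∧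
    SeparatesOn (frontier D) x₁ y₂ x₂ y₁

/-- The oriented projection Reidemeister move `Ω2'+` (antiparallel strands);
`Ω2'−` is its inverse. -/
def OmegaTwoAnti (P Q : KnotProjection) : Prop :=
  ∃ D x₁ y₁ x₂ y₂, OmegaTwoCore P Q D x₁ y₁ x₂ y₂ ∧
    SeparatesOn (frontier D) x₁ x₂ y₂ y₁

/-- The oriented projection Reidemeister move `Ω3+`: a triangle move sliding a strand
across a crossing; `Ω3−` is its inverse. -/
def OmegaThree (P Q : KnotProjection) : Prop :=
  ∃ D : Set SPt, ∃ x₁ y₁ x₂ y₂ x₃ y₃ : SPt, LocalFrame P Q D ∧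
    P.image ∩ frontier D = {x₁, y₁, x₂, y₂, x₃, y₃} ∧
    ({x₁, y₁, x₂, y₂, x₃, y₃} : Set SPt).ncard = 6 ∧
    (P.crossings ∩ D).ncard = 3 ∧ (Q.crossings ∩ D).ncard = 3 ∧
    P.crossings ∩ D ≠ Q.crossings ∩ D ∧
    (∃ a₁ a₂ a₃ : Set SPt, IsArc a₁ ∧ IsArc a₂ ∧ IsArc a₃ ∧
      P.image ∩ D = a₁ ∪ a₂ ∪ a₃ ∧
      OrientedPiece P x₁ y₁ a₁ ∧ OrientedPiece P x₂ y₂ a₂ ∧ OrientedPiece P x₃ y₃ a₃ ∧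
      (a₁ ∩ a₂) ∪ (a₁ ∩ a₃) ∪ (a₂ ∩ a₃) = P.crossings ∩ D ∧
      (a₁ ∩ a₂).ncard = 1 ∧ (a₁ ∩ a₃).ncard = 1 ∧ (a₂ ∩ a₃).ncard = 1) ∧
    (∃ b₁ b₂ b₃ : Set SPt, IsArc b₁ ∧ IsArc b₂ ∧ IsArc b₃ ∧
      Q.image ∩ D = b₁ ∪ b₂ ∪ b₃ ∧
      OrientedPiece Q x₁ y₁ b₁ ∧ OrientedPiece Q x₂ y₂ b₂ ∧ OrientedPiece Q x₃ y₃ b₃ ∧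
      (b₁ ∩ b₂) ∪ (b₁ ∩ b₃) ∪ (b₂ ∩ b₃) = Q.crossings ∩ D ∧
      (b₁ ∩ b₂).ncard = 1 ∧ (b₁ ∩ b₃).ncard = 1 ∧ (b₂ ∩ b₃).ncard = 1)

/-- One of the oriented projection Reidemeister moves
`Ω1+`, `Ω1−`, `Ω2+`, `Ω2−`, `Ω2'+`, `Ω2'−`, `Ω3+`, `Ω3−`. -/
def RMoveStepRaw (P Q : KnotProjection) : Prop :=
  OmegaOne P Q ∨ OmegaOne Q P ∨ OmegaTwoPar P Q ∨ OmegaTwoPar Q P ∨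
  OmegaTwoAnti P Q ∨ OmegaTwoAnti Q P ∨ OmegaThree P Q ∨ OmegaThree Q P

/-- One oriented projection Reidemeister move, up to equivalence of projections. -/
def RMoveStep (P Q : KnotProjection) : Prop :=
  ∃ P' Q', ProjEquiv P P' ∧ RMoveStepRaw P' Q' ∧ ProjEquiv Q' Q

/-- The standard round circle in `ℝ³`. -/
def stdCircle (t : ℝ) : E3 :=
  (EuclideanSpace.equiv (Fin 3) ℝ).symm
    ![Real.cos (2 * Real.pi * t), Real.sin (2 * Real.pi * t), 0]

/-- A closed curve in `ℝ³` is unknotted if some ambient isotopy carries it to the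
standard round circle. -/
def IsUnknotted (k : ℝ → E3) : Prop :=
  ∃ H : ℝ → (E3 ≃ₜ E3), Continuous (fun p : ℝ × E3 => H p.1 p.2) ∧
    H 0 = Homeomorph.refl E3 ∧ ∀ t, H 1 (k t) = stdCircle t

end

section

/-- The function `g` has a continuous logarithm on `A`. -/
def HasLogOn {X : Type*} [TopologicalSpace X] (g : X → ℂ) (A : Set X) : Prop :=
  ∃ u : X → ℂ, ContinuousOn u A ∧ ∀ z ∈ A, Complex.exp (u z) = g z

theorem exp_eq_one_of_norm_lt {w : ℂ} (h : Complex.exp w = 1) (hw : ‖w‖ < 1) : w = 0 := by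
  obtain ⟨n, hn⟩ := Complex.exp_eq_one_iff.1 h
  rcases eq_or_ne n 0 with h0 | h0
  · simp [hn, h0]
  · exfalso
    have h1 : (1 : ℝ) ≤ |(n : ℝ)| := by exact_mod_cast Int.one_le_abs h0
    have h2 : ‖w‖ = |(n : ℝ)| * (2 * Real.pi) := by
      rw [hn]; simp [abs_of_pos Real.pi_pos]
    have h3 := Real.pi_gt_three
    nlinarith

theorem IsPreconnected.exp_eq_one_const {X : Type*} [TopologicalSpace X] {S : Set X}
    (hS : IsPreconnected S) {u : X → ℂ} (hu : ContinuousOn u S)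
    (h : ∀ z ∈ S, Complex.exp (u z) = 1) : ∃ c, Complex.exp c = 1 ∧ ∀ z ∈ S, u z = c := by
  rcases S.eq_empty_or_nonempty with rfl | ⟨x, hx⟩
  · exact ⟨0, by simp, by simp⟩
  refine ⟨u x, h x hx, fun z hz => ?_⟩
  refine IsPreconnected.induction₂ hS (fun a b => u b = u a) (fun a ha => ?_)
    (fun _ _ _ _ _ _ h1 h2 => h2.trans h1) (fun _ _ _ _ h => h.symm) hx hz
  have := (hu a ha).eventually (Metric.ball_mem_nhds (u a) one_pos)
  filter_upwards [this, self_mem_nhdsWithin] with y hy hyS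
  have h1 : Complex.exp (u y - u a) = 1 := by rw [Complex.exp_sub, h _ hyS, h _ ha]; simp
  exact sub_eq_zero.1 (exp_eq_one_of_norm_lt h1 (by simpa [dist_eq_norm] using hy))

theorem exists_log_of_continuous {F : ℂ → ℂ} (hF : Continuous F) (h0 : ∀ z, F z ≠ 0) :
    ∃ L : ℂ → ℂ, Continuous L ∧ ∀ z, Complex.exp (L z) = F z := by
  obtain ⟨f, hf, h⟩ := Complex.exists_continuousOn_eqOn_exp_comp (U := (univ : Set ℂ)) (X := ℂ)
    (g := F) 
    (show SimplyConnectedSpace (univ : Set ℂ) from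
      (Homeomorph.Set.univ ℂ).toHomotopyEquiv.simplyConnectedSpace) isOpen_univ hF.continuousOn (by simpa using h0)
  exact ⟨f, continuousOn_univ.1 hf, fun z => h (mem_univ z)⟩

theorem eq_sub_outside_ball_has_zero {F : ℂ → ℂ} (hF : Continuous F) {p : ℂ} {R : ℝ}
    (hR : ∀ z, R < ‖z‖ → F z = z - p) : ∃ z, F z = 0 := by
  by_contra! h0
  obtain ⟨L, hL, hLF⟩ := exists_log_of_continuous hF h0
  set ρ : ℝ := |R| + ‖p‖ + 1
  have hρ : 0 < ρ := by positivity
  let w : ℝ → ℂ := fun θ => p + Complex.exp (Real.log ρ + θ * Complex.I)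
  have hw : ∀ θ, ‖w θ - p‖ = ρ := fun θ => by simp [w, Complex.norm_exp, Real.exp_log hρ]
  have hw1 : ∀ θ, F (w θ) = w θ - p := fun θ => hR _ (by
    have := norm_le_norm_add_norm_sub' (w θ - p) (-p)
    have h2 : ‖w θ - p‖ ≤ ‖w θ‖ + ‖p‖ := norm_sub_le _ _
    rw [hw] at h2
    have := le_abs_self R
    simp only [ρ] at h2; linarith)
  obtain ⟨c, -, hc⟩ := (isPreconnected_univ (α := ℝ)).exp_eq_one_const
    (u := fun θ => L (w θ) - (Real.log ρ + θ * Complex.I)) (by fun_prop) (fun θ _ => by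
      rw [Complex.exp_sub, hLF, hw1]; simp [w])
  have h1 := hc 0 trivial
  have h2 := hc (2 * Real.pi) trivial
  have hww : w (2 * Real.pi) = w 0 := by
    simp only [w]; push_cast; rw [Complex.exp_add, Complex.exp_two_pi_mul_I]; simp
  rw [← h2] at h1
  simp only [hww] at h1
  have h3 := congrArg Complex.im h1
  simp at h3
  have := Real.pi_pos
  linarith

theorem hasLogOn_div_of_mem_component {A : Set ℂ} (hA : IsClosed A) {p q : ℂ}
    (hq : q ∈ connectedComponentIn Aᶜ p) : HasLogOn (fun z => (z - p) / (z - q)) A := by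
  have hp : p ∈ Aᶜ := by
    by_contra h; simp [connectedComponentIn_eq_empty h] at hq
  have hsub := connectedComponentIn_subset Aᶜ p
  refine IsPreconnected.induction₂ (isPreconnected_connectedComponentIn (x := p) (F := Aᶜ))
    (fun a b => HasLogOn (fun z => (z - a) / (z - b)) A) (fun a ha => ?_) ?_ ?_
    (mem_connectedComponentIn hp) hq
  · obtain ⟨r, hr, hra⟩ := Metric.isOpen_iff.1 hA.isOpen_compl a (hsub ha)
    filter_upwards [mem_nhdsWithin_of_mem_nhds (Metric.ball_mem_nhds a (half_pos hr))] with b hb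
    have key : ∀ z ∈ A, ‖a - b‖ < ‖z - b‖ := fun z hz => by
      have h1 : r ≤ ‖z - a‖ := by
        by_contra! h
        exact hra (by simpa [dist_eq_norm] using h) hz
      have h2 : ‖b - a‖ < r / 2 := by simpa [dist_eq_norm] using hb
      have h3 : ‖z - a‖ ≤ ‖z - b‖ + ‖b - a‖ := by
        simpa using norm_add_le (z - b) (b - a)
      rw [norm_sub_rev] ; linarith
    have hne : ∀ z ∈ A, z - b ≠ 0 := fun z hz h => by
      have := key z hz; rw [h, norm_zero] at this; exact absurd this (not_lt.2 (norm_nonneg _))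
    have hsl : ∀ z ∈ A, (z - a) / (z - b) ∈ Complex.slitPlane := fun z hz => by
      have : (z - a) / (z - b) = 1 + (b - a) / (z - b) := by
        field_simp [hne z hz]; ring
      rw [this]
      apply Complex.mem_slitPlane_of_norm_lt_one
      rw [norm_div, norm_sub_rev, div_lt_one (norm_pos_iff.2 (hne z hz))]
      exact key z hz
    refine ⟨fun z => Complex.log ((z - a) / (z - b)), ContinuousOn.clog (ContinuousOn.div (by fun_prop) (by fun_prop) hne) hsl, fun z hz => ?_⟩
    exact Complex.exp_log (Complex.slitPlane_ne_zero (hsl z hz))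
  · rintro a b c ha hb hc ⟨u, hu, hu'⟩ ⟨v, hv, hv'⟩
    refine ⟨fun z => u z + v z, hu.add hv, fun z hz => ?_⟩
    have : z - b ≠ 0 := sub_ne_zero.2 fun h => hsub hb (h ▸ hz)
    rw [Complex.exp_add, hu' z hz, hv' z hz, div_mul_div_cancel₀ this]
  · rintro a b ha hb ⟨u, hu, hu'⟩
    refine ⟨fun z => - u z, hu.neg, fun z hz => ?_⟩
    rw [Complex.exp_neg, hu' z hz, inv_div]

theorem isPreconnected_norm_gt (R : ℝ) : IsPreconnected {z : ℂ | R < ‖z‖} := by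
  rcases lt_or_ge R 0 with h | h
  · have : {z : ℂ | R < ‖z‖} = univ := eq_univ_of_forall fun z => h.trans_le (norm_nonneg z)
    rw [this]; exact isPreconnected_univ
  have : {z : ℂ | R < ‖z‖} = (fun x : ℝ × ℝ => (x.1 : ℂ) * Complex.exp (x.2 * Complex.I)) ''
      (Ioi R ×ˢ univ) := by
    ext z
    constructor
    · intro hz
      exact ⟨(‖z‖, z.arg), ⟨hz, trivial⟩, Complex.norm_mul_exp_arg_mul_I z⟩
    · rintro ⟨⟨r, θ⟩, ⟨hr, -⟩, rfl⟩
      have hr : R < r := hr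
      simp [Complex.norm_exp, abs_of_pos (h.trans_lt hr), hr]
  rw [this]
  exact (isPreconnected_Ioi.prod isPreconnected_univ).image _ (by fun_prop)

theorem mem_component_of_norm_gt {A : Set ℂ} {R : ℝ} (hA : A ⊆ Metric.closedBall 0 R) {z w : ℂ}
    (hz : R < ‖z‖) (hw : R < ‖w‖) : w ∈ connectedComponentIn Aᶜ z :=
by
  have h : {z : ℂ | R < ‖z‖} ⊆ Aᶜ := fun y (hy : R < ‖y‖) hyA => absurd (hA hyA) (by simpa using hy)
  exact (isPreconnected_norm_gt R).subset_connectedComponentIn (x := z) hz h hw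

theorem frontier_component_subset {X : Type*} [TopologicalSpace X] [LocallyConnectedSpace X]
    {U : Set X} (hU : IsOpen U) (p : X) :
    frontier (connectedComponentIn U p) ⊆ Uᶜ := by
  intro z hz hzU
  have ho := hU.connectedComponentIn (x := p)
  have hz2 := (hU.connectedComponentIn (x := z)).mem_nhds (mem_connectedComponentIn hzU)
  obtain ⟨y, hy1, hy2⟩ := mem_closure_iff_nhds.1 hz.1 _ hz2
  have h1 : connectedComponentIn U z = connectedComponentIn U p :=
    (connectedComponentIn_eq hy1).trans (connectedComponentIn_eq hy2).symm
  rw [ho.frontier_eq] at hz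
  exact hz.2 (h1 ▸ mem_connectedComponentIn hzU)

theorem not_hasLogOn_of_bounded {A : Set ℂ} (hA : IsCompact A) {p q : ℂ} (hp : p ∈ Aᶜ)
    {R : ℝ} (hb : connectedComponentIn Aᶜ p ⊆ Metric.closedBall 0 R)
    (hq : q ∉ connectedComponentIn Aᶜ p) :
    ¬ HasLogOn (fun z => (z - p) / (z - q)) A := by
  rintro ⟨u, hu, hu'⟩
  by_cases hqA : q ∈ A
  · have := hu' q hqA
    simp at this
  obtain ⟨g, hg⟩ := ContinuousMap.exists_restrict_eq hA.isClosed ⟨A.domRestrict u, hu.domRestrict⟩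
  have hgu : ∀ z ∈ A, g z = u z := fun z hz => by
    exact congrArg (fun k => k ⟨z, hz⟩) hg
  classical
  set C := connectedComponentIn Aᶜ p
  have hfr : frontier C ⊆ A := by
    simpa using frontier_component_subset hA.isClosed.isOpen_compl p
  let F : ℂ → ℂ := fun z => if z ∈ C then (z - q) * Complex.exp (g z) else z - p
  have hF : Continuous F := by
    refine Continuous.if (fun z hz => ?_) (by fun_prop) (by fun_prop)
    have hzA := hfr hz
    rw [hgu z hzA, hu' z hzA, mul_div_cancel₀]
    exact sub_ne_zero.2 fun h => hqA (h ▸ hzA)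
  obtain ⟨z, hz⟩ := eq_sub_outside_ball_has_zero (p := p) (R := R) hF (fun z hz => by
    have : z ∉ C := fun h => absurd (hb h) (by simpa using hz)
    simp [F, this])
  by_cases hzC : z ∈ C
  · simp [F, hzC, sub_eq_zero] at hz
    exact hq (hz ▸ hzC)
  · simp [F, hzC, sub_eq_zero] at hz
    exact hzC (hz ▸ mem_connectedComponentIn hp)

theorem HasLogOn.symm_div {A : Set ℂ} {p q : ℂ} (h : HasLogOn (fun z => (z - p) / (z - q)) A) :
    HasLogOn (fun z => (z - q) / (z - p)) A := by
  obtain ⟨u, hu, hu'⟩ := h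
  exact ⟨fun z => - u z, hu.neg, fun z hz => by rw [Complex.exp_neg, hu' z hz, inv_div]⟩

theorem mem_component_of_hasLogOn {A : Set ℂ} (hA : IsCompact A) {p q : ℂ} (hp : p ∈ Aᶜ)
    (hq : q ∈ Aᶜ) (h : HasLogOn (fun z => (z - p) / (z - q)) A) :
    q ∈ connectedComponentIn Aᶜ p := by
  by_contra hn
  have hn' : p ∉ connectedComponentIn Aᶜ q := fun h' =>
    hn (connectedComponentIn_eq h' ▸ mem_connectedComponentIn hq)
  obtain ⟨R, hR⟩ := hA.isBounded.subset_closedBall 0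
  have key : ∀ x, x ∈ Aᶜ → ¬ (connectedComponentIn Aᶜ x ⊆ Metric.closedBall 0 R) →
      ∀ w : ℂ, R < ‖w‖ → connectedComponentIn Aᶜ x = connectedComponentIn Aᶜ w := by
    intro x hx hxn w hw
    obtain ⟨y, hy, hyR⟩ := not_subset.1 hxn
    rw [connectedComponentIn_eq hy]
    exact connectedComponentIn_eq (mem_component_of_norm_gt hR (by simpa using hyR) hw)
  by_cases h1 : connectedComponentIn Aᶜ p ⊆ Metric.closedBall 0 R
  · exact not_hasLogOn_of_bounded hA hp h1 hn h
  by_cases h2 : connectedComponentIn Aᶜ q ⊆ Metric.closedBall 0 R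
  · exact not_hasLogOn_of_bounded hA hq h2 hn' h.symm_div
  have hw : R < ‖((|R| + 1 : ℝ) : ℂ)‖ := by
    rw [Complex.norm_real, Real.norm_eq_abs, abs_of_pos (by positivity)]
    have := le_abs_self R; linarith
  have := (key p hp h1 _ hw).trans (key q hq h2 _ hw).symm
  exact hn (this ▸ mem_connectedComponentIn hq)

theorem HasLogOn.union {X : Type*} [TopologicalSpace X] {g : X → ℂ} {A B : Set X}
    (hA : IsClosed A) (hB : IsClosed B)
    (hAB : IsPreconnected (A ∩ B)) (h1 : HasLogOn g A) (h2 : HasLogOn g B) :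
    HasLogOn g (A ∪ B) := by
  obtain ⟨u, hu, hu'⟩ := h1
  obtain ⟨v, hv, hv'⟩ := h2
  have hg : ∀ z ∈ A, g z ≠ 0 := fun z hz => hu' z hz ▸ Complex.exp_ne_zero _
  obtain ⟨c, hc, hcc⟩ := hAB.exp_eq_one_const (u := fun z => u z - v z)
    ((hu.mono inter_subset_left).sub (hv.mono inter_subset_right)) (fun z hz => by
      rw [Complex.exp_sub, hu' z hz.1, hv' z hz.2, div_self (hg z hz.1)])
  classical
  let w : X → ℂ := fun z => if z ∈ A then u z else v z + c
  have hwB : EqOn w (fun z => v z + c) B := fun z hz => by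
    by_cases h : z ∈ A
    · simp only [w, h, if_true]; rw [← hcc z ⟨h, hz⟩]; ring
    · simp [w, h]
  have hwA : EqOn w u A := fun z hz => by simp [w, hz]
  refine ⟨w, (hu.congr hwA).union_of_isClosed ((hv.add continuousOn_const).congr hwB) hA hB, ?_⟩
  rintro z (hz | hz)
  · rw [hwA hz, hu' z hz]
  · rw [hwB hz, Complex.exp_add, hc, mul_one, hv' z hz]

/-- Janiszewski's theorem. -/
theorem janiszewski {A B : Set ℂ} (hA : IsCompact A) (hB : IsCompact B)
    (hAB : IsPreconnected (A ∩ B)) {p q : ℂ}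
    (h1 : q ∈ connectedComponentIn Aᶜ p) (h2 : q ∈ connectedComponentIn Bᶜ p) :
    q ∈ connectedComponentIn (A ∪ B)ᶜ p := by
  have hp : ∀ {A : Set ℂ}, q ∈ connectedComponentIn Aᶜ p → p ∈ Aᶜ := fun {A} h => by
    by_contra h'; simp [connectedComponentIn_eq_empty h'] at h
  have hq : ∀ {A : Set ℂ}, q ∈ connectedComponentIn Aᶜ p → q ∈ Aᶜ := fun {A} h =>
    connectedComponentIn_subset _ _ h
  apply mem_component_of_hasLogOn (hA.union hB)
  · rw [compl_union]; exact ⟨hp h1, hp h2⟩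
  · rw [compl_union]; exact ⟨hq h1, hq h2⟩
  · exact HasLogOn.union hA.isClosed hB.isClosed hAB
      (hasLogOn_div_of_mem_component hA.isClosed h1) (hasLogOn_div_of_mem_component hB.isClosed h2)

/-- The point `p` lies in an unbounded component of the complement of `A`. -/
def Escapes (A : Set ℂ) (p : ℂ) : Prop :=
  ∀ R : ℝ, ∃ q ∈ connectedComponentIn Aᶜ p, R < ‖q‖

theorem Escapes.mem_component {A : Set ℂ} {p : ℂ} (h : Escapes A p) {R : ℝ}
    (hA : A ⊆ Metric.closedBall 0 R) {q : ℂ} (hq : R < ‖q‖) : q ∈ connectedComponentIn Aᶜ p := by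
  obtain ⟨y, hy, hyR⟩ := h R
  rw [connectedComponentIn_eq hy]
  exact mem_component_of_norm_gt hA hyR hq

theorem exists_norm_gt (R : ℝ) : ∃ q : ℂ, R < ‖q‖ := by
  refine ⟨((|R| + 1 : ℝ) : ℂ), ?_⟩
  rw [Complex.norm_real, Real.norm_eq_abs, abs_of_pos (by positivity)]
  have := le_abs_self R; linarith

theorem janiszewski_escapes {A B : Set ℂ} (hA : IsCompact A) (hB : IsCompact B)
    (hAB : IsPreconnected (A ∩ B)) {p : ℂ} (h1 : Escapes A p) (h2 : Escapes B p) :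
    Escapes (A ∪ B) p := by
  intro R
  obtain ⟨R', hR'⟩ := (hA.union hB).isBounded.subset_closedBall 0
  obtain ⟨q, hq⟩ := exists_norm_gt (max R R')
  refine ⟨q, janiszewski hA hB hAB ?_ ?_, (le_max_left _ _).trans_lt hq⟩
  · exact h1.mem_component (subset_union_left.trans hR') ((le_max_right _ _).trans_lt hq)
  · exact h2.mem_component (subset_union_right.trans hR') ((le_max_right _ _).trans_lt hq)

end

section

/-- Four arcs, parametrized by `[0, 1]`, that share their initial point `q` and nothing else. -/
structure IsStar {Y : Type*} [TopologicalSpace Y] (g : Fin 4 → ℝ → Y) (q : Y) : Prop where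
  cont : ∀ i, ContinuousOn (g i) (Icc 0 1)
  zero : ∀ i, g i 0 = q
  inj : ∀ i j s t, s ∈ Icc (0 : ℝ) 1 → t ∈ Icc (0 : ℝ) 1 → g i s = g j t → s = t ∧ (i = j ∨ s = 0)

/-- The union of the arms of a star. -/
def starSet {Y : Type*} (g : Fin 4 → ℝ → Y) : Set Y := ⋃ i, g i '' Icc 0 1

namespace IsStar

variable {Y : Type*} [TopologicalSpace Y] {g : Fin 4 → ℝ → Y} {q : Y}

theorem injOn (h : IsStar g q) (i : Fin 4) : InjOn (g i) (Icc 0 1) :=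
  fun _ hs _ ht e => (h.inj i i _ _ hs ht e).1

theorem isCompact_arm (h : IsStar g q) (i : Fin 4) : IsCompact (g i '' Icc 0 1) :=
  isCompact_Icc.image_of_continuousOn (h.cont i)

theorem isCompact (h : IsStar g q) : IsCompact (starSet g) :=
  isCompact_iUnion h.isCompact_arm

theorem center_mem (h : IsStar g q) (i : Fin 4) : q ∈ g i '' Icc 0 1 := ⟨0, by simp, h.zero i⟩

theorem isPreconnected (h : IsStar g q) : IsPreconnected (starSet g) :=
  isPreconnected_iUnion ⟨q, mem_iInter.2 h.center_mem⟩
    fun i => isPreconnected_Icc.image _ (h.cont i)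

theorem locallyConnectedSpace [T2Space Y] (h : IsStar g q) : LocallyConnectedSpace (starSet g) := by
  have : LocallyPathConnectedSpace (Icc (0 : ℝ) 1) := (convex_Icc (0 : ℝ) 1).locallyPathConnectedSpace
  let Φ : (Σ _ : Fin 4, Icc (0 : ℝ) 1) → starSet g :=
    fun x => ⟨g x.1 x.2, mem_iUnion.2 ⟨x.1, x.2, x.2.2, rfl⟩⟩
  have hΦ : Continuous Φ := by
    refine Continuous.subtype_mk (continuous_sigma fun i => ?_) _
    exact (h.cont i).domRestrict
  have hs : Function.Surjective Φ := by
    rintro ⟨x, hx⟩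
    obtain ⟨i, s, hs, rfl⟩ := mem_iUnion.1 hx
    exact ⟨⟨i, s, hs⟩, rfl⟩
  exact (hΦ.isClosedMap.isQuotientMap hΦ hs).isCoinducing.locallyConnectedSpace

end IsStar

theorem hasLogOn_arc {X : Type*} [TopologicalSpace X] [T2Space X] {γ : ℝ → X}
    (hγ : ContinuousOn γ (Icc 0 1)) (hinj : InjOn γ (Icc 0 1)) {F : X → ℂ}
    (hF : ContinuousOn F (γ '' Icc 0 1)) (h0 : ∀ z ∈ γ '' Icc 0 1, F z ≠ 0) :
    HasLogOn F (γ '' Icc 0 1) := by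
  let k : ℂ → ℝ := fun z => projIcc (0 : ℝ) 1 zero_le_one z.re
  have hk : Continuous k := continuous_subtype_val.comp (continuous_projIcc.comp Complex.continuous_re)
  have hkm : ∀ z, k z ∈ Icc (0 : ℝ) 1 := fun z => (projIcc (0 : ℝ) 1 zero_le_one z.re).2
  obtain ⟨L, hL, hLF⟩ := exists_log_of_continuous (F := fun z => F (γ (k z)))
    ((hF.comp hγ (mapsTo_image _ _)).comp_continuous hk hkm)
    (fun z => h0 _ (mem_image_of_mem _ (hkm z)))
  let σ : X → ℝ := Function.invFunOn γ (Icc 0 1)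
  have hσ : ∀ s ∈ Icc (0 : ℝ) 1, σ (γ s) = s := fun s hs => hinj.leftInvOn_invFunOn hs
  have hσc : ContinuousOn σ (γ '' Icc 0 1) := by
    intro x hx
    have hcl : ∀ K : Set ℝ, IsClosed K → IsClosed ((γ '' Icc 0 1) ∩ σ ⁻¹' K) := by
      intro K hK
      have : (γ '' Icc 0 1) ∩ σ ⁻¹' K = γ '' (Icc 0 1 ∩ K) := by
        ext y
        constructor
        · rintro ⟨⟨s, hs, rfl⟩, h2⟩
          exact ⟨s, ⟨hs, by simpa [hσ s hs] using h2⟩, rfl⟩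
        · rintro ⟨s, ⟨hs, h2⟩, rfl⟩
          exact ⟨⟨s, hs, rfl⟩, by simpa [hσ s hs] using h2⟩
      rw [this]
      exact ((isCompact_Icc.inter_right hK).image_of_continuousOn (hγ.mono inter_subset_left)).isClosed
    have : ContinuousOn σ (γ '' Icc 0 1) := continuousOn_iff_isClosed.2 fun K hK =>
      ⟨_, hcl K hK, by ext y; simp; tauto⟩
    exact this x hx
  refine ⟨fun x => L (σ x), hL.comp_continuousOn' (Complex.continuous_ofReal.comp_continuousOn' hσc), ?_⟩
  rintro _ ⟨s, hs, rfl⟩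
  rw [hLF, hσ s hs]
  simp only [k, Complex.ofReal_re]
  rw [projIcc_of_mem zero_le_one hs]

theorem IsStar.hasLogOn {Y : Type*} [TopologicalSpace Y] [T2Space Y] {g : Fin 4 → ℝ → Y} {q : Y}
    (h : IsStar g q) {F : Y → ℂ} (hF : ContinuousOn F (starSet g)) (h0 : ∀ z ∈ starSet g, F z ≠ 0) :
    HasLogOn F (starSet g) := by
  have key : ∀ n : ℕ, ∀ hn : n ≤ 3, HasLogOn F (⋃ i ∈ {i : Fin 4 | i.1 ≤ n}, g i '' Icc 0 1) ∧
      IsClosed (⋃ i ∈ {i : Fin 4 | i.1 ≤ n}, g i '' Icc 0 1) := by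
    intro n
    have hcl : IsClosed (⋃ i ∈ {i : Fin 4 | i.1 ≤ n}, g i '' Icc 0 1) :=
      (Set.toFinite _).isClosed_biUnion fun i _ => (h.isCompact_arm i).isClosed
    have harm : ∀ i, HasLogOn F (g i '' Icc 0 1) := fun i =>
      hasLogOn_arc (h.cont i) (h.injOn i) (hF.mono (subset_iUnion (fun i => g i '' Icc 0 1) i))
        fun z hz => h0 z (mem_iUnion.2 ⟨i, hz⟩)
    induction n with
    | zero =>
      intro _
      have : (⋃ i ∈ {i : Fin 4 | i.1 ≤ 0}, g i '' Icc 0 1) = g 0 '' Icc 0 1 := by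
        have : {i : Fin 4 | i.1 ≤ 0} = {0} := by
          ext i; rw [mem_ofPred_eq, mem_singleton_iff, Fin.ext_iff, Nat.le_zero]; rfl
        rw [this]; simp
      exact ⟨this ▸ harm 0, hcl⟩
    | succ n ih =>
      intro hn
      have hcl' : IsClosed (⋃ i ∈ {i : Fin 4 | i.1 ≤ n}, g i '' Icc 0 1) :=
        (Set.toFinite _).isClosed_biUnion fun i _ => (h.isCompact_arm i).isClosed
      obtain ⟨h1, h2⟩ := ih hcl' (by omega)
      let j : Fin 4 := ⟨n + 1, by omega⟩
      have hset : {i : Fin 4 | i.1 ≤ n + 1} = insert j {i : Fin 4 | i.1 ≤ n} := by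
        ext i; simp [j, Fin.ext_iff]; omega
      refine ⟨?_, hcl⟩
      rw [hset, biUnion_insert, union_comm]
      refine HasLogOn.union h2 (h.isCompact_arm j).isClosed ?_ h1 (harm j)
      have : (⋃ i ∈ {i : Fin 4 | i.1 ≤ n}, g i '' Icc 0 1) ∩ g j '' Icc 0 1 = {q} := by
        ext y
        simp only [mem_inter_iff, mem_iUnion, mem_singleton_iff]
        constructor
        · rintro ⟨⟨i, hi, s, hs, rfl⟩, t, ht, e⟩
          obtain ⟨-, h4 | h4⟩ := h.inj j i _ _ ht hs e
          · simp [← h4, j] at hi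
          · rw [← e, h4, h.zero]
        · rintro rfl
          exact ⟨⟨0, by simp, h.center_mem 0⟩, h.center_mem j⟩
      rw [this]; exact isPreconnected_singleton
  have := (key 3 le_rfl).1
  have hset : {i : Fin 4 | i.1 ≤ 3} = univ := by ext i; simp; omega
  rw [hset, biUnion_univ] at this
  exact this

theorem IsStar.compl_mem_component {g : Fin 4 → ℝ → ℂ} {x : ℂ} (h : IsStar g x) {p q : ℂ}
    (hp : p ∉ starSet g) (hq : q ∉ starSet g) : q ∈ connectedComponentIn (starSet g)ᶜ p := by
  refine mem_component_of_hasLogOn h.isCompact hp hq (h.hasLogOn ?_ ?_)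
  · exact ContinuousOn.div (by fun_prop) (by fun_prop) fun z hz => sub_ne_zero.2 fun e => hq (e ▸ hz)
  · intro z hz
    exact div_ne_zero (sub_ne_zero.2 fun e => hp (e ▸ hz)) (sub_ne_zero.2 fun e => hq (e ▸ hz))

/-- Close points of a compact locally connected set lie in a small subcontinuum. -/
theorem exists_small_continuum {X : Set ℂ} (hX : IsCompact X) [LocallyConnectedSpace X] {ε : ℝ}
    (hε : 0 < ε) : ∃ δ > 0, ∀ a ∈ X, ∀ b ∈ X, dist a b < δ →
      ∃ T ⊆ X, IsCompact T ∧ IsPreconnected T ∧ a ∈ T ∧ b ∈ T ∧ T ⊆ Metric.closedBall a ε := by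
  have : CompactSpace X := isCompact_iff_compactSpace.1 hX
  let c : X → Set X := fun x => connectedComponentIn (Metric.ball x (ε / 2)) x
  obtain ⟨δ, hδ, H⟩ := lebesgue_number_lemma_of_metric (s := (univ : Set X)) (c := c) isCompact_univ
    (fun x => Metric.isOpen_ball.connectedComponentIn) (fun x _ => mem_iUnion.2
      ⟨x, mem_connectedComponentIn (Metric.mem_ball_self (half_pos hε))⟩)
  refine ⟨δ, hδ, fun a ha b hb hab => ?_⟩
  obtain ⟨x, hx⟩ := H ⟨a, ha⟩ trivial
  refine ⟨Subtype.val '' closure (c x), by rintro _ ⟨y, -, rfl⟩; exact y.2,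
    isClosed_closure.isCompact.image continuous_subtype_val,
    isPreconnected_connectedComponentIn.closure.image _ continuous_subtype_val.continuousOn,
    ⟨_, subset_closure (hx (Metric.mem_ball_self hδ)), rfl⟩,
    ⟨⟨b, hb⟩, subset_closure (hx (by rw [Metric.mem_ball, dist_comm]; exact hab)), rfl⟩, ?_⟩
  have h1 : closure (c x) ⊆ Metric.closedBall x (ε / 2) :=
    closure_minimal ((connectedComponentIn_subset _ _).trans Metric.ball_subset_closedBall)
      Metric.isClosed_closedBall
  rintro _ ⟨y, hy, rfl⟩
  have h2 : dist y x ≤ ε / 2 := h1 hy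
  have h3 : dist (⟨a, ha⟩ : X) x ≤ ε / 2 := h1 (subset_closure (hx (Metric.mem_ball_self hδ)))
  rw [Metric.mem_closedBall]
  have h4 := dist_triangle_right y (⟨a, ha⟩ : X) x
  have h5 : dist y (⟨a, ha⟩ : X) = dist (y : ℂ) a := rfl
  linarith

end

section

open Filter

theorem differentiableOn_of_exp_eq {V : Set ℂ} (hV : IsOpen V) {G u : ℂ → ℂ}
    (hG : DifferentiableOn ℂ G V) (hu : ContinuousOn u V) (h : ∀ z ∈ V, Complex.exp (u z) = G z) :
    DifferentiableOn ℂ u V := by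
  intro z₀ hz₀
  have hG0 : G z₀ ≠ 0 := h z₀ hz₀ ▸ Complex.exp_ne_zero _
  have hGd := hG.differentiableAt (hV.mem_nhds hz₀)
  have hd : DifferentiableAt ℂ (fun y => u z₀ + Complex.log (G y / G z₀)) z₀ := by
    refine (differentiableAt_const _).add (DifferentiableAt.clog (hGd.div_const _) ?_)
    simp [div_self hG0]
  refine (hd.congr_of_eventuallyEq ?_).differentiableWithinAt
  have hc : ContinuousAt (fun y => u y - (u z₀ + Complex.log (G y / G z₀))) z₀ :=
    (hu.continuousAt (hV.mem_nhds hz₀)).sub hd.continuousAt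
  have h0 : u z₀ - (u z₀ + Complex.log (G z₀ / G z₀)) = 0 := by simp [div_self hG0]
  have hev := hc.eventually (Metric.ball_mem_nhds _ one_pos)
  filter_upwards [hev, hV.mem_nhds hz₀, hGd.continuousAt.eventually_ne hG0] with y hy hyV hyG
  rw [h0] at hy
  refine sub_eq_zero.1 (exp_eq_one_of_norm_lt ?_ (by simpa using hy))
  rw [Complex.exp_sub, Complex.exp_add, Complex.exp_log (div_ne_zero hyG hG0), h y hyV, h z₀ hz₀,
    mul_div_cancel₀ _ hG0, div_self hyG]

theorem exists_sqrt_of_hasLogOn {V : Set ℂ} (hV : IsOpen V) {G : ℂ → ℂ}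
    (hG : DifferentiableOn ℂ G V) (hL : HasLogOn G V) :
    ∃ s : ℂ → ℂ, DifferentiableOn ℂ s V ∧ ∀ z ∈ V, s z ^ 2 = G z := by
  obtain ⟨u, hu, h⟩ := hL
  refine ⟨fun z => Complex.exp (u z / 2),
    ((differentiableOn_of_exp_eq hV hG hu h).div_const 2).cexp, fun z hz => ?_⟩
  rw [← Complex.exp_nat_mul, ← h z hz]; congr 1; push_cast; ring

/-- The automorphism of the unit disc that takes `w` to `0`. -/
noncomputable def discMap (w z : ℂ) : ℂ := (z - w) / (1 - star w * z)

theorem discMap_den_ne {w z : ℂ} (hw : ‖w‖ < 1) (hz : ‖z‖ < 1) : 1 - star w * z ≠ 0 := by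
  intro h
  have h1 : ‖star w * z‖ = 1 := by rw [← sub_eq_zero.1 h]; simp
  rw [norm_mul, norm_star] at h1
  nlinarith [norm_nonneg w, norm_nonneg z]

theorem norm_discMap_lt {w z : ℂ} (hw : ‖w‖ < 1) (hz : ‖z‖ < 1) : ‖discMap w z‖ < 1 := by
  have hd := discMap_den_ne hw hz
  rw [discMap, norm_div, div_lt_one (norm_pos_iff.2 hd)]
  apply lt_of_pow_lt_pow_left₀ 2 (norm_nonneg _)
  rw [← Complex.normSq_eq_norm_sq, ← Complex.normSq_eq_norm_sq]
  have h1 : Complex.normSq w < 1 := by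
    rw [Complex.normSq_eq_norm_sq]; nlinarith [norm_nonneg w]
  have h2 : Complex.normSq z < 1 := by
    rw [Complex.normSq_eq_norm_sq]; nlinarith [norm_nonneg z]
  have h3 : Complex.normSq (1 - star w * z) - Complex.normSq (z - w) =
      (1 - Complex.normSq w) * (1 - Complex.normSq z) := by
    simp only [Complex.normSq_apply, Complex.sub_re, Complex.sub_im, Complex.mul_re,
      Complex.mul_im, Complex.one_re, Complex.one_im, Complex.star_def, Complex.conj_re, Complex.conj_im]
    ring
  nlinarith [mul_pos (sub_pos.2 h1) (sub_pos.2 h2)]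

theorem one_sub_star_mul_self_ne {w : ℂ} (hw : ‖w‖ < 1) : 1 - star w * w ≠ 0 :=
  discMap_den_ne hw hw

theorem discMap_injOn {w : ℂ} (hw : ‖w‖ < 1) : InjOn (discMap w) (Metric.ball 0 1) := by
  intro a ha b hb h
  have ha := discMap_den_ne hw (by simpa using ha : ‖a‖ < 1)
  have hb := discMap_den_ne hw (by simpa using hb : ‖b‖ < 1)
  rw [discMap, discMap, div_eq_div_iff ha hb] at h
  have h1 : (a - b) * (1 - star w * w) = 0 := by linear_combination h
  exact sub_eq_zero.1 ((mul_eq_zero.1 h1).resolve_right (one_sub_star_mul_self_ne hw))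

theorem discMap_hasDerivAt {w z : ℂ} (hw : ‖w‖ < 1) (hz : ‖z‖ < 1) :
    HasDerivAt (discMap w) ((1 - star w * w) / (1 - star w * z) ^ 2) z := by
  have hd := discMap_den_ne hw hz
  have h1 : HasDerivAt (fun z => z - w) 1 z := (hasDerivAt_id z).sub_const w
  have h2 : HasDerivAt (fun z => 1 - star w * z) (-(star w * 1)) z :=
    ((hasDerivAt_id z).const_mul (star w)).const_sub 1
  exact (h1.div h2 hd).congr_deriv (by ring)

theorem discMap_eq_zero {w z : ℂ} (hw : ‖w‖ < 1) (hz : ‖z‖ < 1) : discMap w z = 0 ↔ z = w := by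
  rw [discMap, div_eq_zero_iff, or_iff_left (discMap_den_ne hw hz), sub_eq_zero]

/-- Hurwitz: a nonconstant limit of injective functions is injective. -/
theorem injOn_of_tendstoLocallyUniformlyOn {V : Set ℂ} (hV : IsOpen V) (hVc : IsPreconnected V)
    {ι : Type*} {l : Filter ι} [l.NeBot] {F : ι → ℂ → ℂ} {f : ℂ → ℂ}
    (hF : ∀ n, DifferentiableOn ℂ (F n) V) (hinj : ∀ n, InjOn (F n) V)
    (hlim : TendstoLocallyUniformlyOn F f l V) (hnc : ¬ ∃ c, ∀ z ∈ V, f z = c) : InjOn f V := by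
  have hf : DifferentiableOn ℂ f V := hlim.differentiableOn (Eventually.of_forall hF) hV
  intro a ha b hb hab
  by_contra hne
  have hfa : AnalyticOnNhd ℂ f V := hf.analyticOnNhd hV
  have hev : ∀ᶠ z in 𝓝[≠] a, f z ≠ f b := by
    rcases (hfa a ha).eventually_eq_or_eventually_ne (analyticAt_const (v := f b)) with h | h
    · exact absurd ⟨f b, fun z hz =>
        hfa.eqOn_of_preconnected_of_eventuallyEq analyticOnNhd_const hVc ha h hz⟩ hnc
    · exact h
  obtain ⟨r, hr, hrV⟩ : ∃ r > 0, Metric.closedBall a r ⊆ V ∩ {b}ᶜ ∩ {z | z ≠ a → f z ≠ f b} := by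
    refine Metric.nhds_basis_closedBall.mem_iff.1 (inter_mem (inter_mem (hV.mem_nhds ha)
      (isOpen_compl_singleton.mem_nhds hne)) ?_)
    exact eventually_nhdsWithin_iff.1 hev
  have hsV : Metric.sphere a r ⊆ V := fun z hz => (hrV (Metric.sphere_subset_closedBall hz)).1.1
  obtain ⟨z₁, hz₁, hmin⟩ := (isCompact_sphere a r).exists_isMinOn (NormedSpace.sphere_nonempty.2 hr.le)
    (f := fun z => ‖f z - f b‖) ((hf.continuousOn.mono hsV).sub continuousOn_const).norm
  set m := ‖f z₁ - f b‖
  have hm : 0 < m := norm_pos_iff.2 (sub_ne_zero.2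
    ((hrV (Metric.sphere_subset_closedBall hz₁)).2 (by
      rintro rfl; simp at hz₁; linarith)))
  have hK : TendstoUniformlyOn F f l (Metric.closedBall a r ∪ {b}) := by
    refine (tendstoLocallyUniformlyOn_iff_forall_isCompact hV).1 hlim _ ?_
      ((isCompact_closedBall a r).union isCompact_singleton)
    rintro z (hz | rfl)
    · exact (hrV hz).1.1
    · exact hb
  obtain ⟨n, hn⟩ := (Metric.tendstoUniformlyOn_iff.1 hK (m / 4) (by positivity)).exists
  have hb' : dist (f b) (F n b) < m / 4 := hn b (Or.inr rfl)
  let k : ℂ → ℂ := fun z => (F n z - F n b)⁻¹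
  have hk0 : ∀ z ∈ Metric.closedBall a r, F n z - F n b ≠ 0 := fun z hz h =>
    (hrV hz).1.2 (hinj n (hrV hz).1.1 hb (sub_eq_zero.1 h))
  have hkd : DiffContOnCl ℂ k (Metric.ball a r) := by
    apply DifferentiableOn.diffContOnCl
    rw [closure_ball a hr.ne']
    exact (((hF n).mono fun z hz => (hrV hz).1.1).sub_const _).inv hk0
  have hbd := Complex.norm_le_of_forall_mem_frontier_norm_le Metric.isBounded_ball hkd
    (C := 2 / m) (fun z hz => by
      rw [frontier_ball a hr.ne'] at hz
      have h1 := hn z (Or.inl (Metric.sphere_subset_closedBall hz))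
      have h2 : m ≤ ‖f z - f b‖ := hmin hz
      rw [dist_eq_norm] at h1 hb'
      have h3 : ‖f z - f b‖ ≤ ‖f z - F n z‖ + ‖F n z - F n b‖ + ‖F n b - f b‖ := by
        have := norm_add₃_le (a := f z - F n z) (b := F n z - F n b) (c := F n b - f b)
        simpa using this
      rw [norm_sub_rev (F n b)] at h3
      simp only [k, norm_inv]
      rw [inv_le_comm₀ (by linarith) (by positivity), inv_div]
      linarith) (subset_closure (Metric.mem_ball_self hr))
  have h1 := hn a (Or.inl (Metric.mem_closedBall_self hr.le))
  rw [dist_eq_norm, norm_sub_rev, hab] at h1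
  rw [dist_eq_norm] at hb'
  have h3 : ‖F n a - F n b‖ ≤ ‖F n a - f b‖ + ‖f b - F n b‖ := by
    simpa using norm_add_le (F n a - f b) (f b - F n b)
  simp only [k, norm_inv] at hbd
  have h4 : 0 < ‖F n a - F n b‖ := norm_pos_iff.2 (hk0 a (Metric.mem_closedBall_self hr.le))
  rw [inv_le_comm₀ h4 (by positivity), inv_div] at hbd
  linarith

/-- Montel's theorem along an ultrafilter. -/
theorem tendstoLocallyUniformlyOn_of_ultrafilter {V : Set ℂ} (hV : IsOpen V) {F : ℕ → ℂ → ℂ}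
    (hF : ∀ n, DifferentiableOn ℂ (F n) V) (hb : ∀ n, ∀ z ∈ V, ‖F n z‖ ≤ 1) (l : Ultrafilter ℕ) :
    ∃ f : ℂ → ℂ, TendstoLocallyUniformlyOn F f l V := by
  have hex : ∀ z, ∃ y, z ∈ V → Tendsto (fun n : ℕ => F n z) l (𝓝 y) := by
    intro z
    by_cases hz : z ∈ V
    · have : ((l.map fun n : ℕ => F n z : Ultrafilter ℂ) : Filter ℂ) ≤ 𝓟 (Metric.closedBall 0 1) := by
        rw [le_principal_iff]
        exact (Eventually.of_forall (fun n => by simpa using hb n z hz) :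
        ∀ᶠ n : ℕ in (l : Filter ℕ), F n z ∈ Metric.closedBall (0 : ℂ) 1)
      obtain ⟨y, -, hy⟩ := (isCompact_closedBall (0 : ℂ) 1).ultrafilter_le_nhds _ this
      exact ⟨y, fun _ => hy⟩
    · exact ⟨0, fun h => absurd h hz⟩
  choose f hf using hex
  refine ⟨f, Metric.tendstoLocallyUniformlyOn_iff.2 fun ε hε z hz => ?_⟩
  obtain ⟨r, hr, hrV⟩ := Metric.isOpen_iff.1 hV z hz
  have hlip : ∀ n, ∀ y ∈ Metric.ball z r, dist (F n y) (F n z) ≤ 2 / r * dist y z := fun n y hy =>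
    Complex.dist_le_div_mul_dist_of_mapsTo_ball ((hF n).mono hrV) (fun x hx => by
      rw [Metric.mem_closedBall]
      have h1 := hb n x (hrV hx)
      have h2 := hb n z hz
      have := norm_sub_le (F n x) (F n z)
      rw [dist_eq_norm]; linarith) hy
  have hlipf : ∀ y ∈ Metric.ball z r, dist (f y) (f z) ≤ 2 / r * dist y z := fun y hy =>
    le_of_tendsto ((hf y (hrV hy)).dist (hf z hz)) (Eventually.of_forall fun n => hlip n y hy)
  refine ⟨Metric.ball z (min r (ε * r / 8)), mem_nhdsWithin_of_mem_nhds
    (Metric.ball_mem_nhds _ (by positivity)), ?_⟩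
  filter_upwards [(hf z hz).eventually (Metric.ball_mem_nhds _ (half_pos hε))] with n hn y hy
  have hyr : y ∈ Metric.ball z r := Metric.ball_subset_ball (min_le_left _ _) hy
  have hyd : dist y z < ε * r / 8 := (Metric.mem_ball.1 hy).trans_le (min_le_right _ _)
  have h0 : 2 / r * dist y z < ε / 4 := by
    calc 2 / r * dist y z < 2 / r * (ε * r / 8) := by gcongr
      _ = ε / 4 := by field_simp; norm_num
  have h1 := hlip n y hyr
  have h2 := hlipf y hyr
  have h3 : dist (F n z) (f z) < ε / 2 := hn
  have h4 := dist_triangle4 (f y) (f z) (F n z) (F n y)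
  rw [dist_comm (f z), dist_comm (F n z) (F n y)] at h4
  linarith

end

section

open Filter

theorem isOpen_image_of_injOn {V : Set ℂ} (hV : IsOpen V) (hVc : IsPreconnected V) {f : ℂ → ℂ}
    (hf : DifferentiableOn ℂ f V) (hinj : InjOn f V) {s : Set ℂ} (hs : s ⊆ V) (hso : IsOpen s) :
    IsOpen (f '' s) := by
  rcases (hf.analyticOnNhd hV).is_constant_or_isOpen hVc with ⟨w, hw⟩ | h
  · rcases s.eq_empty_or_nonempty with rfl | ⟨z, hz⟩
    · simp
    · exfalso
      obtain ⟨r, hr, hrs⟩ := Metric.isOpen_iff.1 hso z hz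
      have h2 : z + (r / 2 : ℝ) ∈ s := hrs (by
        simp [abs_of_pos hr, hr])
      have := hinj (hs hz) (hs h2) (by rw [hw _ (hs hz), hw _ (hs h2)])
      simp at this
      linarith
  · exact h s hs hso

/-- Normalized injective holomorphic maps from `V` to the unit disc. -/
def discMaps (V : Set ℂ) : Set (ℂ → ℂ) :=
  {f | DifferentiableOn ℂ f V ∧ InjOn f V ∧ MapsTo f V (Metric.ball 0 1) ∧ f 0 = 0}

/-- Injective nonvanishing holomorphic functions on `V` have continuous logarithms. -/
def LogDomain (V : Set ℂ) : Prop :=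
  ∀ G : ℂ → ℂ, DifferentiableOn ℂ G V → InjOn G V → (∀ z ∈ V, G z ≠ 0) → HasLogOn G V

theorem discMap_comp_mem {V : Set ℂ} (h0 : (0 : ℂ) ∈ V) {f : ℂ → ℂ}
    (hf : DifferentiableOn ℂ f V) (hinj : InjOn f V) (hm : MapsTo f V (Metric.ball 0 1)) :
    (fun z => discMap (f 0) (f z)) ∈ discMaps V := by
  have hlt : ∀ z ∈ V, ‖f z‖ < 1 := fun z hz => by simpa using hm hz
  refine ⟨fun z hz => ?_, ?_, fun z hz => ?_, ?_⟩
  · exact (discMap_hasDerivAt (hlt 0 h0) (hlt z hz)).differentiableAt.comp_differentiableWithinAt z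
      (hf z hz)
  · exact (discMap_injOn (hlt 0 h0)).comp hinj hm
  · simpa using norm_discMap_lt (hlt 0 h0) (hlt z hz)
  · exact (discMap_eq_zero (hlt 0 h0) (hlt 0 h0)).2 rfl

theorem deriv_discMap_comp {V : Set ℂ} (hV : IsOpen V) (h0 : (0 : ℂ) ∈ V) {f : ℂ → ℂ} {w : ℂ}
    (hw : ‖w‖ < 1) (hf : DifferentiableOn ℂ f V) (hm : MapsTo f V (Metric.ball 0 1)) :
    deriv (fun z => discMap w (f z)) 0 = (1 - star w * w) / (1 - star w * f 0) ^ 2 * deriv f 0 :=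
  ((discMap_hasDerivAt hw (by simpa using hm h0)).comp (0 : ℂ)
    (hf.differentiableAt (hV.mem_nhds h0)).hasDerivAt).deriv

theorem two_mul_mul_deriv_of_sq {V : Set ℂ} (hV : IsOpen V) {s G : ℂ → ℂ} {z : ℂ} (hz : z ∈ V)
    (hs : DifferentiableOn ℂ s V) (h : ∀ z ∈ V, s z ^ 2 = G z) : 2 * s z * deriv s z = deriv G z := by
  have h1 : HasDerivAt (fun z => s z ^ 2) (2 * s z * deriv s z) z := by
    simpa using (hs.differentiableAt (hV.mem_nhds hz)).hasDerivAt.fun_pow 2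
  have h2 : G =ᶠ[𝓝 z] fun z => s z ^ 2 := by
    filter_upwards [hV.mem_nhds hz] with y hy using (h y hy).symm
  exact ((h1.congr_of_eventuallyEq h2).deriv).symm

theorem exists_discMaps_deriv_ne_zero {V : Set ℂ} (hV : IsOpen V) (hVc : IsPreconnected V)
    (h0 : (0 : ℂ) ∈ V) {a : ℂ} (ha : a ∉ V) (hL : LogDomain V) : ∃ f ∈ discMaps V, deriv f 0 ≠ 0 := by
  have hne : ∀ z ∈ V, z - a ≠ 0 := fun z hz => sub_ne_zero.2 fun h => ha (h ▸ hz)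
  have hd : DifferentiableOn ℂ (fun z => z - a) V := by fun_prop
  obtain ⟨s, hs, hs2⟩ := exists_sqrt_of_hasLogOn hV hd
    (hL _ hd (fun x _ y _ h => by simpa using h) hne)
  have hsinj : InjOn s V := fun x hx y hy h => by
    have := hs2 x hx; rw [h, hs2 y hy] at this; simpa using this.symm
  have hs0 : ∀ z ∈ V, s z ≠ 0 := fun z hz h => hne z hz (by rw [← hs2 z hz, h]; simp)
  have hopen := isOpen_image_of_injOn hV hVc hs hsinj subset_rfl hV
  obtain ⟨ε, hε, hball⟩ := Metric.isOpen_iff.1 hopen (s 0) ⟨0, h0, rfl⟩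
  have hfar : ∀ z ∈ V, ε ≤ ‖s z + s 0‖ := fun z hz => by
    by_contra! h
    have : -s z ∈ s '' V := hball (by
      rwa [Metric.mem_ball, dist_eq_norm, ← norm_neg, show -(-s z - s 0) = s z + s 0 by ring])
    obtain ⟨y, hy, hyz⟩ := this
    have h1 : y = z := by
      have h2 := hs2 y hy
      rw [hyz, neg_sq, hs2 z hz] at h2
      simpa using h2.symm
    subst h1
    have : (2 : ℂ) * s y = 0 := by linear_combination hyz
    exact hs0 y hy (by simpa using this)
  have hfar0 : ∀ z ∈ V, s z + s 0 ≠ 0 := fun z hz h => by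
    have := hfar z hz; rw [h, norm_zero] at this; linarith
  let k : ℂ → ℂ := fun z => (ε / 2 : ℝ) / (s z + s 0)
  have hk : DifferentiableOn ℂ k V :=
    (differentiableOn_const _).div (hs.add_const _) hfar0
  have hkm : MapsTo k V (Metric.ball 0 1) := fun z hz => by
    have := hfar z hz
    simp only [k, mem_ball_zero_iff, norm_div, Complex.norm_real, Real.norm_eq_abs]
    rw [div_lt_one (by linarith), abs_of_pos (by positivity)]
    linarith
  have hε' : ((ε / 2 : ℝ) : ℂ) ≠ 0 := by exact_mod_cast (half_pos hε).ne'
  have hkinj : InjOn k V := fun x hx y hy h => by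
    simp only [k] at h
    rw [div_eq_div_iff (hfar0 x hx) (hfar0 y hy)] at h
    exact hsinj hx hy (by simpa using (mul_left_cancel₀ hε' h).symm)
  refine ⟨_, discMap_comp_mem h0 hk hkinj hkm, ?_⟩
  have hk0 : ‖k 0‖ < 1 := by simpa using hkm h0
  rw [deriv_discMap_comp hV h0 hk0 hk hkm]
  have hs' := two_mul_mul_deriv_of_sq hV h0 hs hs2
  have hkd : deriv k 0 = -(((ε / 2 : ℝ) : ℂ) * deriv s 0) / (s 0 + s 0) ^ 2 := by
    have h1 : HasDerivAt (fun z => s z + s 0) (deriv s 0) 0 :=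
      (hs.differentiableAt (hV.mem_nhds h0)).hasDerivAt.add_const _
    have h2 := (hasDerivAt_const (0 : ℂ) ((ε / 2 : ℝ) : ℂ)).div h1 (hfar0 0 h0)
    rw [show k = (fun _ => ((ε / 2 : ℝ) : ℂ)) / fun z => s z + s 0 from rfl, h2.deriv]
    ring
  have hs'0 : deriv s 0 ≠ 0 := by
    intro h; rw [h] at hs'; simp at hs'
  rw [hkd]
  refine mul_ne_zero (div_ne_zero (one_sub_star_mul_self_ne hk0)
    (pow_ne_zero _ (one_sub_star_mul_self_ne hk0))) (div_ne_zero (neg_ne_zero.2 (mul_ne_zero hε' hs'0))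
    (pow_ne_zero _ (hfar0 0 h0)))

theorem exists_discMaps_isMax {V : Set ℂ} (hV : IsOpen V) (hVc : IsPreconnected V)
    (h0 : (0 : ℂ) ∈ V) (hne : ∃ f ∈ discMaps V, deriv f 0 ≠ 0) :
    ∃ f ∈ discMaps V, deriv f 0 ≠ 0 ∧ ∀ k ∈ discMaps V, ‖deriv k 0‖ ≤ ‖deriv f 0‖ := by
  obtain ⟨r, hr, hrV⟩ := Metric.isOpen_iff.1 hV 0 h0
  set S : Set ℝ := (fun f => ‖deriv f 0‖) '' discMaps V
  have hbdd : BddAbove S := by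
    refine ⟨1 / r, ?_⟩
    rintro _ ⟨f, ⟨hf, -, hm, hf0⟩, rfl⟩
    refine Complex.norm_deriv_le_div_of_mapsTo_ball (hf.mono hrV) (fun z hz => ?_) hr
    rw [hf0]; exact Metric.ball_subset_closedBall (hm (hrV hz))
  obtain ⟨f₀, hf₀, hf₀d⟩ := hne
  have hSne : S.Nonempty := ⟨_, f₀, hf₀, rfl⟩
  obtain ⟨u, -, hu, huS⟩ := exists_seq_tendsto_sSup hSne hbdd
  choose F hF hFu using huS
  obtain ⟨f, hf⟩ := tendstoLocallyUniformlyOn_of_ultrafilter hV (fun n => (hF n).1)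
    (fun n z hz => (mem_ball_zero_iff.1 ((hF n).2.2.1 hz)).le) (hyperfilter ℕ)
  have hfd : DifferentiableOn ℂ f V := hf.differentiableOn (Eventually.of_forall fun n => (hF n).1) hV
  have hderiv : ‖deriv f 0‖ = sSup S := by
    have h1 := ((hf.deriv (Eventually.of_forall fun n => (hF n).1) hV).tendsto_at h0).norm
    have h2 : Tendsto u (hyperfilter ℕ) (𝓝 (sSup S)) :=
      hu.mono_left (by rw [← Nat.cofinite_eq_atTop]; exact hyperfilter_le_cofinite)
    refine tendsto_nhds_unique h1 (h2.congr fun n => (hFu n).symm)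
  have hpos : 0 < ‖deriv f 0‖ := by
    rw [hderiv]
    exact (norm_pos_iff.2 hf₀d).trans_le (le_csSup hbdd ⟨_, hf₀, rfl⟩)
  have hnc : ¬ ∃ c, ∀ z ∈ V, f z = c := by
    rintro ⟨c, hc⟩
    have : f =ᶠ[𝓝 0] fun _ => c := by filter_upwards [hV.mem_nhds h0] with y hy using hc y hy
    rw [this.deriv_eq] at hpos
    simp at hpos
  have hinj := injOn_of_tendstoLocallyUniformlyOn hV hVc (fun n => (hF n).1) (fun n => (hF n).2.1) hf hnc
  refine ⟨f, ⟨hfd, hinj, ?_, ?_⟩, norm_pos_iff.1 hpos, fun k hk => ?_⟩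
  · have hcl : f '' V ⊆ Metric.closedBall 0 1 := by
      rintro _ ⟨z, hz, rfl⟩
      rw [mem_closedBall_zero_iff]
      exact le_of_tendsto (hf.tendsto_at hz).norm
        (Eventually.of_forall fun n => (mem_ball_zero_iff.1 ((hF n).2.2.1 hz)).le)
    have ho := isOpen_image_of_injOn hV hVc hfd hinj subset_rfl hV
    rw [mapsTo_iff_image_subset, ← interior_closedBall (0 : ℂ) one_ne_zero]
    exact interior_maximal hcl ho
  · refine tendsto_nhds_unique (hf.tendsto_at h0) ?_
    simp only [(hF _).2.2.2, tendsto_const_nhds]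
  · rw [hderiv]; exact le_csSup hbdd ⟨_, hk, rfl⟩

/-- The Riemann mapping theorem. -/
theorem exists_riemann_map {V : Set ℂ} (hV : IsOpen V) (hVc : IsPreconnected V)
    (h0 : (0 : ℂ) ∈ V) {a : ℂ} (ha : a ∉ V) (hL : LogDomain V) :
    ∃ f : ℂ → ℂ, DifferentiableOn ℂ f V ∧ InjOn f V ∧ f '' V = Metric.ball 0 1 ∧ f 0 = 0 := by
  obtain ⟨f, ⟨hf, hinj, hm, hf0⟩, hd, hmax⟩ := exists_discMaps_isMax hV hVc h0
    (exists_discMaps_deriv_ne_zero hV hVc h0 ha hL)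
  refine ⟨f, hf, hinj, Subset.antisymm (mapsTo_iff_image_subset.1 hm) ?_, hf0⟩
  intro w hw
  by_contra hwn
  have hw1 : ‖w‖ < 1 := by simpa using hw
  have hw0 : w ≠ 0 := fun h => hwn ⟨0, h0, by rw [hf0, h]⟩
  have hlt : ∀ z ∈ V, ‖f z‖ < 1 := fun z hz => by simpa using hm hz
  let G : ℂ → ℂ := fun z => discMap w (f z)
  have hG : DifferentiableOn ℂ G V := fun z hz =>
    (discMap_hasDerivAt hw1 (hlt z hz)).differentiableAt.comp_differentiableWithinAt z (hf z hz)
  have hGinj : InjOn G V := (discMap_injOn hw1).comp hinj hm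
  have hG0 : ∀ z ∈ V, G z ≠ 0 := fun z hz h =>
    hwn ⟨z, hz, (discMap_eq_zero hw1 (hlt z hz)).1 h⟩
  obtain ⟨s, hs, hs2⟩ := exists_sqrt_of_hasLogOn hV hG (hL G hG hGinj hG0)
  have hsm : MapsTo s V (Metric.ball 0 1) := fun z hz => by
    have h1 : ‖s z‖ ^ 2 < 1 := by
      rw [← norm_pow, hs2 z hz]; exact norm_discMap_lt hw1 (hlt z hz)
    rw [mem_ball_zero_iff]
    nlinarith [norm_nonneg (s z)]
  have hsinj : InjOn s V := fun x hx y hy h => by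
    have := hs2 x hx; rw [h, hs2 y hy] at this; exact hGinj hx hy this.symm
  have hle := hmax _ (discMap_comp_mem h0 hs hsinj hsm)
  have hs01 : ‖s 0‖ < 1 := by simpa using hsm h0
  rw [deriv_discMap_comp hV h0 hs01 hs hsm] at hle
  have hG0' : G 0 = -w := by simp [G, discMap, hf0]
  have hsn : ‖s 0‖ ^ 2 = ‖w‖ := by rw [← norm_pow, hs2 0 h0, hG0', norm_neg]
  have hds := two_mul_mul_deriv_of_sq hV h0 hs hs2
  rw [show G = fun z => discMap w (f z) from rfl, deriv_discMap_comp hV h0 hw1 hf hm, hf0] at hds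
  have hstar : ∀ x : ℂ, ‖x‖ < 1 → ‖1 - star x * x‖ = 1 - ‖x‖ ^ 2 := fun x hx => by
    have : (1 : ℂ) - star x * x = ((1 - ‖x‖ ^ 2 : ℝ) : ℂ) := by
      rw [Complex.star_def, mul_comm, Complex.mul_conj, Complex.normSq_eq_norm_sq]; push_cast; ring
    rw [this, Complex.norm_real, Real.norm_eq_abs, abs_of_nonneg]
    nlinarith [norm_nonneg x]
  have hds' := congrArg norm hds
  simp only [norm_mul, hstar w hw1, mul_zero, sub_zero, one_pow,
    div_one, Complex.norm_ofNat] at hds'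
  simp only [norm_mul, norm_div, norm_pow, hstar _ hs01] at hle
  have hσ : 0 < ‖s 0‖ := by
    rw [norm_pos_iff]; intro h
    rw [h] at hsn; simp at hsn; exact hw0 (by simpa using hsn.symm)
  rw [← hsn] at hds'
  have hd' : 0 < ‖deriv f 0‖ := norm_pos_iff.2 hd
  have hpos : 0 < 1 - ‖s 0‖ ^ 2 := by nlinarith
  rw [pow_two (1 - ‖s 0‖ ^ 2), ← div_div, div_self hpos.ne', one_div, inv_mul_le_iff₀ hpos] at hle
  generalize ‖s 0‖ = σ at *
  generalize ‖deriv s 0‖ = x at *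
  generalize ‖deriv f 0‖ = y at *
  have h1 : (1 - σ ^ 2) * y * (1 + σ ^ 2) ≤ (1 - σ ^ 2) * y * (2 * σ) := by
    nlinarith [mul_le_mul_of_nonneg_left hle (by positivity : 0 ≤ 2 * σ)]
  have h2 := le_of_mul_le_mul_left h1 (by positivity)
  nlinarith [sq_pos_of_pos (sub_pos.2 hs01)]

end

section

open Filter

theorem IsPreconnected.eqOn_log {X : Type*} [TopologicalSpace X] {K : Set X} (hK : IsPreconnected K)
    {g u v : X → ℂ} (hg : ∀ z ∈ K, g z ≠ 0)
    (hu : ContinuousOn u K) (hv : ContinuousOn v K) (hu' : ∀ z ∈ K, Complex.exp (u z) = g z)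
    (hv' : ∀ z ∈ K, Complex.exp (v z) = g z) {x : X} (hx : x ∈ K) (hxe : u x = v x) : EqOn u v K := by
  obtain ⟨c, -, hc⟩ := hK.exp_eq_one_const (hu.sub hv) fun z hz => by
    rw [Pi.sub_apply, Complex.exp_sub, hu' z hz, hv' z hz, div_self (hg z hz)]
  have h0 := hc x hx
  intro z hz
  have := hc z hz
  rw [← h0, Pi.sub_apply, Pi.sub_apply, hxe, sub_self] at this
  exact sub_eq_zero.1 this

theorem hasLogOn_of_compacts {V : Set ℂ} (hV : IsOpen V) (hVc : IsPreconnected V) {g : ℂ → ℂ}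
    (hg : ∀ z ∈ V, g z ≠ 0) (h : ∀ K ⊆ V, IsCompact K → IsConnected K → HasLogOn g K) :
    HasLogOn g V := by
  rcases V.eq_empty_or_nonempty with rfl | ⟨x, hx⟩
  · exact ⟨fun _ => 0, by simp, by simp⟩
  set c := Complex.log (g x)
  have hc : Complex.exp c = g x := Complex.exp_log (hg x hx)
  have hnorm : ∀ K ⊆ V, IsCompact K → IsConnected K → x ∈ K → ∃ u : ℂ → ℂ, ContinuousOn u K ∧
      (∀ z ∈ K, Complex.exp (u z) = g z) ∧ u x = c := fun K hKV hK hKc hxK => by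
    obtain ⟨u, hu, hu'⟩ := h K hKV hK hKc
    refine ⟨fun z => u z + (c - u x), hu.add continuousOn_const, fun z hz => ?_, by ring⟩
    rw [Complex.exp_add, Complex.exp_sub, hu' z hz, hu' x hxK, hc, div_self (hg x hx), mul_one]
  have hpath : ∀ z ∈ V, ∃ K ⊆ V, IsCompact K ∧ IsConnected K ∧ x ∈ K ∧ z ∈ K := fun z hz => by
    obtain ⟨γ, hγ⟩ := (hV.isConnected_iff_isPathConnected.1 ⟨⟨x, hx⟩, hVc⟩).joinedIn x hx z hz
    exact ⟨range γ, range_subset_iff.2 hγ, isCompact_range γ.continuous,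
      isConnected_range γ.continuous, ⟨0, γ.source⟩, ⟨1, γ.target⟩⟩
  choose! L hLV hLc hLcon hxL hzL using hpath
  choose! u hu hu' hux using hnorm
  have key : ∀ K ⊆ V, IsCompact K → IsConnected K → x ∈ K → ∀ z ∈ K, u (L z) z = u K z := by
    intro K hKV hK hKc hxK z hz
    have hzV := hKV hz
    have hUV : K ∪ L z ⊆ V := union_subset hKV (hLV z hzV)
    have hUc := hK.union (hLc z hzV)
    have hUcon : IsConnected (K ∪ L z) := hKc.union ⟨x, hxK, hxL z hzV⟩ (hLcon z hzV)
    have hxU : x ∈ K ∪ L z := Or.inl hxK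
    have e1 := hKc.isPreconnected.eqOn_log (fun y hy => hg y (hKV hy))
      ((hu _ hUV hUc hUcon hxU).mono subset_union_left) (hu _ hKV hK hKc hxK)
      (fun y hy => hu' _ hUV hUc hUcon hxU y (Or.inl hy)) (hu' _ hKV hK hKc hxK) hxK
      (by rw [hux _ hUV hUc hUcon hxU, hux _ hKV hK hKc hxK]) hz
    have e2 := (hLcon z hzV).isPreconnected.eqOn_log (fun y hy => hg y (hLV z hzV hy))
      ((hu _ hUV hUc hUcon hxU).mono subset_union_right)
      (hu _ (hLV z hzV) (hLc z hzV) (hLcon z hzV) (hxL z hzV))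
      (fun y hy => hu' _ hUV hUc hUcon hxU y (Or.inr hy))
      (hu' _ (hLV z hzV) (hLc z hzV) (hLcon z hzV) (hxL z hzV)) (hxL z hzV)
      (by rw [hux _ hUV hUc hUcon hxU,
        hux _ (hLV z hzV) (hLc z hzV) (hLcon z hzV) (hxL z hzV)]) (hzL z hzV)
    rw [← e1, ← e2]
  refine ⟨fun z => u (L z) z, fun z hz => ?_, fun z hz =>
    hu' _ (hLV z hz) (hLc z hz) (hLcon z hz) (hxL z hz) z (hzL z hz)⟩
  obtain ⟨ε, hε, hball⟩ := Metric.isOpen_iff.1 hV z hz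
  set B := Metric.closedBall z (ε / 2)
  have hBV : B ⊆ V := (Metric.closedBall_subset_ball (by linarith)).trans hball
  have hzB : z ∈ B := Metric.mem_closedBall_self (by linarith)
  have hUV : L z ∪ B ⊆ V := union_subset (hLV z hz) hBV
  have hUc : IsCompact (L z ∪ B) := (hLc z hz).union (isCompact_closedBall _ _)
  have hUcon : IsConnected (L z ∪ B) := (hLcon z hz).union ⟨z, hzL z hz, hzB⟩
    ⟨⟨z, hzB⟩, (convex_closedBall z _).isPreconnected⟩
  have hxU : x ∈ L z ∪ B := Or.inl (hxL z hz)
  have hBn : L z ∪ B ∈ 𝓝 z := mem_of_superset (Metric.closedBall_mem_nhds z (by linarith))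
    subset_union_right
  refine (((hu _ hUV hUc hUcon hxU).continuousAt hBn).congr ?_).continuousWithinAt
  filter_upwards [hBn] with y hy using (key _ hUV hUc hUcon hxU y hy).symm

theorem isPreconnected_thickening {X : Set ℂ} (hX : IsPreconnected X) (δ : ℝ) :
    IsPreconnected (Metric.thickening δ X) := by
  rw [Metric.thickening_eq_biUnion_ball]
  rcases le_or_gt δ 0 with h | h
  · simp [Metric.ball_eq_empty.2 h, isPreconnected_empty]
  have : ⋃ x ∈ X, Metric.ball x δ = ⋃ x ∈ X, (X ∪ Metric.ball x δ) := by
    ext y; simp only [mem_iUnion, exists_prop]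
    constructor
    · rintro ⟨x, hx, hy⟩; exact ⟨x, hx, Or.inr hy⟩
    · rintro ⟨x, hx, hy | hy⟩
      · exact ⟨y, hy, Metric.mem_ball_self h⟩
      · exact ⟨x, hx, hy⟩
  rw [this]
  rcases X.eq_empty_or_nonempty with rfl | ⟨a, ha⟩
  · simp [isPreconnected_empty]
  have h2 : ⋃ x ∈ X, (X ∪ Metric.ball x δ) = ⋃₀ ((fun x => X ∪ Metric.ball x δ) '' X) := by
    rw [sUnion_image]
  rw [h2]
  refine isPreconnected_sUnion a _ ?_ ?_
  · rintro _ ⟨x, hx, rfl⟩; exact Or.inl ha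
  · rintro _ ⟨x, hx, rfl⟩
    exact hX.union x hx (Metric.mem_ball_self h) (convex_ball x δ).isPreconnected

/-- The domain complementary to `X` in the coordinate `z` with `w = x₀ + 1/z`. -/
def invDomain (X : Set ℂ) (x₀ : ℂ) : Set ℂ := {z | z = 0 ∨ x₀ + z⁻¹ ∉ X}

theorem eq_inv_sub {x₀ z : ℂ} : (x₀ + z⁻¹ - x₀)⁻¹ = z := by simp

theorem exists_closedBall_subset_invDomain {X : Set ℂ} (hX : IsCompact X) (x₀ : ℂ) :
    ∃ r > 0, Metric.closedBall 0 r ⊆ invDomain X x₀ := by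
  obtain ⟨R, hR⟩ := hX.isBounded.subset_closedBall x₀
  refine ⟨(|R| + 1)⁻¹, by positivity, fun z hz => or_iff_not_imp_left.2 fun h0 hzX => ?_⟩
  have h1 := hR hzX
  rw [Metric.mem_closedBall, dist_eq_norm, add_sub_cancel_left, norm_inv] at h1
  have h2 : ‖z‖ ≤ (|R| + 1)⁻¹ := by simpa using hz
  have h3 := inv_anti₀ (norm_pos_iff.2 h0) h2
  rw [inv_inv] at h3
  linarith [le_abs_self R]

theorem isOpen_invDomain {X : Set ℂ} (hX : IsCompact X) (x₀ : ℂ) : IsOpen (invDomain X x₀) := by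
  rw [isOpen_iff_mem_nhds]
  intro z hz
  rcases eq_or_ne z 0 with rfl | h0
  · obtain ⟨r, hr, h⟩ := exists_closedBall_subset_invDomain hX x₀
    exact mem_of_superset (Metric.closedBall_mem_nhds _ hr) h
  · have hz' : x₀ + z⁻¹ ∈ Xᶜ := hz.resolve_left h0
    have hc : ContinuousAt (fun z : ℂ => x₀ + z⁻¹) z := continuousAt_const.add (continuousAt_inv₀ h0)
    filter_upwards [hc.preimage_mem_nhds (hX.isClosed.isOpen_compl.mem_nhds hz')] with y hy
      using Or.inr hy

theorem isPreconnected_invDomain {X : Set ℂ} (hX : IsCompact X) {x₀ : ℂ} (hx₀ : x₀ ∈ X)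
    (hc : IsPreconnected Xᶜ) : IsPreconnected (invDomain X x₀) := by
  have him : IsPreconnected ((fun w => (w - x₀)⁻¹) '' Xᶜ) := hc.image _ fun w hw =>
    ((continuousAt_id.sub continuousAt_const).inv₀
      (sub_ne_zero.2 fun h : w = x₀ => hw (h ▸ hx₀))).continuousWithinAt
  have heq : (fun w => (w - x₀)⁻¹) '' Xᶜ = invDomain X x₀ \ {0} := by
    ext z; constructor
    · rintro ⟨w, hw, rfl⟩
      have hne : w - x₀ ≠ 0 := sub_ne_zero.2 fun h : w = x₀ => hw (h ▸ hx₀)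
      exact ⟨Or.inr (by simpa using hw), by simpa using hne⟩
    · rintro ⟨hz, h0⟩
      exact ⟨x₀ + z⁻¹, hz.resolve_left h0, eq_inv_sub⟩
  rw [heq] at him
  refine him.subset_closure sdiff_subset fun z hz => ?_
  rcases eq_or_ne z 0 with rfl | h0
  · have := (isOpen_invDomain hX x₀).mem_nhds hz
    rw [mem_closure_iff_nhdsWithin_neBot, sdiff_eq, inter_comm]
    rw [nhdsWithin_inter_of_mem' (mem_nhdsWithin_of_mem_nhds this)]
    exact (inferInstance : (𝓝[≠] (0 : ℂ)).NeBot)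
  · exact subset_closure ⟨hz, h0⟩

theorem hasLogOn_sub_of_closedBall {A : Set ℂ} {R : ℝ} (hA : A ⊆ Metric.closedBall 0 R) {q : ℂ}
    (hq : R < ‖q‖) : HasLogOn (fun z => z - q) A := by
  refine ⟨fun z => Complex.log (-q) + Complex.log (1 - z / q), ?_, fun z hz => ?_⟩
  · refine continuousOn_const.add (ContinuousOn.clog (by fun_prop) fun z hz => Or.inl ?_)
    have hz := hA hz
    rw [mem_closedBall_zero_iff] at hz
    have hq0 : 0 < ‖q‖ := (norm_nonneg z).trans_lt (hz.trans_lt hq)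
    have h1 : ‖z / q‖ < 1 := by rw [norm_div, div_lt_one hq0]; exact hz.trans_lt hq
    have := (abs_le.1 (Complex.abs_re_le_norm (z / q))).2
    simp only [Complex.sub_re, Complex.one_re]
    linarith
  · have hz := hA hz
    rw [mem_closedBall_zero_iff] at hz
    have hq0 : q ≠ 0 := norm_pos_iff.1 ((norm_nonneg z).trans_lt (hz.trans_lt hq))
    have h1 : 1 - z / q ≠ 0 := fun h => by
      rw [sub_eq_zero, eq_comm, div_eq_one_iff_eq hq0] at h
      rw [h] at hz; linarith
    rw [Complex.exp_add, Complex.exp_log (neg_ne_zero.2 hq0), Complex.exp_log h1]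
    field_simp
    ring

theorem exists_mem_of_component {G : ℂ → ℂ} {V C N : Set ℂ} (hGV : IsOpen (G '' V))
    (hCV : C ⊆ V) (hGC : IsClosed (G '' C)) (hN : IsPreconnected N) (hne : (N ∩ G '' V).Nonempty)
    (hnot : ¬ N ⊆ G '' C) : ∃ m ∈ V \ C, G m ∈ N := by
  by_contra! h
  have hin : ∀ m ∈ V, G m ∈ N → m ∈ C := fun m hm hmN => by
    by_contra hc; exact h m ⟨hm, hc⟩ hmN
  rcases isPreconnected_iff_subset_of_disjoint.1 hN (G '' V) (G '' C)ᶜ hGV hGC.isOpen_compl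
    (fun y _ => by
      by_cases hy : y ∈ G '' C
      · exact Or.inl (image_mono hCV hy)
      · exact Or.inr hy)
    (by
      rw [eq_empty_iff_forall_notMem]
      rintro _ ⟨hy, ⟨m, hm, rfl⟩, hc⟩
      exact hc ⟨m, hin m hm hy, rfl⟩) with h1 | h1
  · refine hnot fun y hy => ?_
    obtain ⟨m, hm, rfl⟩ := h1 hy
    exact ⟨m, hin m hm hy, rfl⟩
  · obtain ⟨_, hy, m, hm, rfl⟩ := hne
    exact h1 hy ⟨m, hin m hm hy, rfl⟩

theorem component_inter_nonempty {A W : Set ℂ} (hA : IsClosed A) (hW : IsOpen W) (hAW : A ⊆ W)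
    (hne : A.Nonempty) {p : ℂ} (hp : p ∈ Aᶜ) : (connectedComponentIn Aᶜ p ∩ W).Nonempty := by
  have h1 : (connectedComponentIn Aᶜ p).Nonempty := ⟨p, mem_connectedComponentIn hp⟩
  have h2 : connectedComponentIn Aᶜ p ≠ univ := fun h => by
    obtain ⟨a, ha⟩ := hne
    exact connectedComponentIn_subset Aᶜ p (h ▸ mem_univ a : a ∈ connectedComponentIn Aᶜ p) ha
  have h3 : (frontier (connectedComponentIn Aᶜ p)).Nonempty := by
    rw [nonempty_iff_ne_empty]; intro h
    rcases isClopen_iff.1 (isClopen_iff_frontier_eq_empty.2 h) with h | h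
    · exact h1.ne_empty h
    · exact h2 h
  obtain ⟨y, hy⟩ := h3
  have hyA : y ∈ A := by simpa using frontier_component_subset hA.isOpen_compl p hy
  rw [inter_comm]
  exact mem_closure_iff.1 (frontier_subset_closure hy) W hW (hAW hyA)

theorem isCompact_invDomain {U : Set ℂ} (hU : IsOpen U) {x₀ : ℂ} (hx₀ : x₀ ∈ U) :
    IsCompact (invDomain U x₀) := by
  obtain ⟨δ, hδ, hball⟩ := Metric.isOpen_iff.1 hU x₀ hx₀
  refine Metric.isCompact_of_isClosed_isBounded ?_ ?_
  · rw [← isOpen_compl_iff, isOpen_iff_mem_nhds]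
    intro z hz
    simp only [invDomain, mem_compl_iff, mem_ofPred_eq, not_or, not_not] at hz
    have hc : ContinuousAt (fun z : ℂ => x₀ + z⁻¹) z :=
      continuousAt_const.add (continuousAt_inv₀ hz.1)
    filter_upwards [hc.preimage_mem_nhds (hU.mem_nhds hz.2), isOpen_ne.mem_nhds hz.1] with y hy hy0
    simp only [invDomain, mem_compl_iff, mem_ofPred_eq, not_or, not_not]
    exact ⟨hy0, hy⟩
  · refine (Metric.isBounded_closedBall (x := (0 : ℂ)) (r := δ⁻¹)).subset fun z hz => ?_
    rw [mem_closedBall_zero_iff]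
    rcases hz with rfl | hz
    · simpa using hδ.le
    · by_contra! h
      refine hz (hball ?_)
      rw [Metric.mem_ball, dist_eq_norm, add_sub_cancel_left, norm_inv]
      exact inv_lt_of_inv_lt₀ hδ h

theorem logDomain_invDomain {X : Set ℂ} (hX : IsCompact X) (hXp : IsPreconnected X) {x₀ : ℂ}
    (hx₀ : x₀ ∈ X) (hXc : ∀ p ∉ X, ∀ q ∉ X, q ∈ connectedComponentIn Xᶜ p)
    (hVc : IsPreconnected (invDomain X x₀)) : LogDomain (invDomain X x₀) := by
  set V := invDomain X x₀ with hVdef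
  have hV : IsOpen V := isOpen_invDomain hX x₀
  intro G hG hGi hG0
  refine hasLogOn_of_compacts hV hVc hG0 fun K hKV hK _ => ?_
  obtain ⟨r, hr, hrV⟩ := exists_closedBall_subset_invDomain hX x₀
  set L := K ∪ Metric.closedBall 0 r
  have hLV : L ⊆ V := union_subset hKV hrV
  have hL : IsCompact L := hK.union (isCompact_closedBall _ _)
  set A := G '' L
  have hA : IsCompact A := hL.image_of_continuousOn (hG.continuousOn.mono hLV)
  have hGV : IsOpen (G '' V) := isOpen_image_of_injOn hV hVc hG hGi subset_rfl hV
  have hAV : A ⊆ G '' V := image_mono hLV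
  have h0V : (0 : ℂ) ∉ G '' V := fun ⟨z, hz, h⟩ => hG0 z hz h
  have h0A : (0 : ℂ) ∈ Aᶜ := fun h => h0V (hAV h)
  have hAne : A.Nonempty := ⟨G 0, 0, Or.inr (Metric.mem_closedBall_self hr.le), rfl⟩
  obtain ⟨R, hR⟩ := hA.isBounded.subset_closedBall 0
  suffices hesc : Escapes A 0 by
    obtain ⟨q, hq, hqR⟩ := hesc R
    obtain ⟨u, hu, hu'⟩ := hasLogOn_div_of_mem_component hA.isClosed hq
    obtain ⟨v, hv, hv'⟩ := hasLogOn_sub_of_closedBall hR hqR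
    have hm : MapsTo G K A := fun z hz => ⟨z, Or.inl hz, rfl⟩
    have hGK := hG.continuousOn.mono hKV
    refine ⟨fun z => u (G z) + v (G z), (hu.comp hGK hm).add (hv.comp hGK hm), fun z hz => ?_⟩
    rw [Complex.exp_add, hu' _ (hm hz), hv' _ (hm hz)]
    simp only [sub_zero]
    rw [div_mul_cancel₀]
    refine sub_ne_zero.2 fun h => ?_
    have := hR (hm hz); rw [h] at this; simp at this; linarith
  by_contra hb
  simp only [Escapes, not_forall, not_exists, not_and, not_lt] at hb
  obtain ⟨R', hR'⟩ := hb
  obtain ⟨q, hq⟩ := exists_norm_gt (max R R')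
  have hqA : q ∈ Aᶜ := fun h => by
    have := hR h; simp at this; linarith [le_max_left R R']
  set K' := L \ Metric.ball 0 r
  have hK' : IsCompact K' := hL.diff Metric.isOpen_ball
  have hK'0 : ∀ z ∈ K', z ≠ 0 := fun z hz h => hz.2 (by rw [h]; exact Metric.mem_ball_self hr)
  set Kw := (fun z => x₀ + z⁻¹) '' K'
  have hKw : IsCompact Kw := hK'.image_of_continuousOn fun z hz =>
    (continuousAt_const.add (continuousAt_inv₀ (hK'0 z hz))).continuousWithinAt
  have hKwX : ∀ w ∈ Kw, w ∉ X := by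
    rintro _ ⟨z, hz, rfl⟩
    exact (hLV hz.1).resolve_left (hK'0 z hz)
  obtain ⟨δ, hδ, hδK⟩ := hX.exists_thickening_subset_open hKw.isClosed.isOpen_compl
    fun x hx hxK => hKwX x hxK hx
  set U := Metric.thickening δ X
  have hXU : X ⊆ U := Metric.self_subset_thickening hδ X
  have hC : IsCompact (invDomain U x₀) :=
    isCompact_invDomain Metric.isOpen_thickening (hXU hx₀)
  have hCV : invDomain U x₀ ⊆ V := fun z hz => hz.imp_right fun h h' => h (hXU h')
  have hGC := hC.image_of_continuousOn (hG.continuousOn.mono hCV)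
  obtain ⟨m, hm, hmN⟩ := exists_mem_of_component hGV hCV hGC.isClosed
    (isPreconnected_connectedComponentIn (F := Aᶜ) (x := 0))
    (component_inter_nonempty hA.isClosed hGV hAV hAne h0A)
    fun h => h0V (image_mono hCV (h (mem_connectedComponentIn h0A)))
  obtain ⟨m', hm', hmN'⟩ := exists_mem_of_component hGV hCV hGC.isClosed
    (isPreconnected_connectedComponentIn (F := Aᶜ) (x := q))
    (component_inter_nonempty hA.isClosed hGV hAV hAne hqA) fun h => by
      obtain ⟨S, hS⟩ := hGC.isBounded.subset_closedBall 0
      obtain ⟨y, hy⟩ := exists_norm_gt (max R S)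
      have := hS (h (mem_component_of_norm_gt hR ((le_max_left _ _).trans_lt hq)
        ((le_max_left _ _).trans_lt hy)))
      simp at this; linarith [le_max_right R S]
  have hout : ∀ z ∈ V \ invDomain U x₀, x₀ + z⁻¹ ∉ X ∧ x₀ + z⁻¹ ∈ U := fun z hz => by
    have h2 := hz.2
    simp only [invDomain, mem_ofPred_eq, not_or, not_not] at h2
    exact ⟨hz.1.resolve_left h2.1, h2.2⟩
  have hcomp := janiszewski hX hKw (by
      rw [show X ∩ Kw = ∅ from eq_empty_iff_forall_notMem.2 fun w hw => hKwX w hw.2 hw.1]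
      exact isPreconnected_empty)
    (hXc _ (hout m hm).1 _ (hout m' hm').1)
    ((isPreconnected_thickening hXp δ).subset_connectedComponentIn (hout m hm).2 hδK
      (hout m' hm').2)
  set S := connectedComponentIn (X ∪ Kw)ᶜ (x₀ + m⁻¹)
  have hSsub : S ⊆ (X ∪ Kw)ᶜ := connectedComponentIn_subset _ _
  have hmS : x₀ + m⁻¹ ∈ S := 
    mem_connectedComponentIn (connectedComponentIn_nonempty_iff.1 ⟨_, hcomp⟩)
  have hSne : ∀ w ∈ S, w - x₀ ≠ 0 := fun w hw h =>
    hSsub hw (Or.inl (by rw [sub_eq_zero.1 h]; exact hx₀))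
  set T := (fun w => (w - x₀)⁻¹) '' S
  have hT : IsPreconnected T := isPreconnected_connectedComponentIn.image _ fun w hw =>
    ((continuousAt_id.sub continuousAt_const).inv₀ (hSne w hw)).continuousWithinAt
  have hmT : m ∈ T := ⟨_, hmS, eq_inv_sub⟩
  have hmT' : m' ∈ T := ⟨_, hcomp, eq_inv_sub⟩
  have hTV : T ⊆ V := by
    rintro _ ⟨w, hw, rfl⟩
    exact Or.inr (by simpa using fun h => hSsub hw (Or.inl h))
  have hTK : ∀ z ∈ T, z ∉ K' := by
    rintro _ ⟨w, hw, rfl⟩ hz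
    exact hSsub hw (Or.inr ⟨_, hz, by simp⟩)
  have hmL : m ∉ L := fun h => connectedComponentIn_subset _ _ hmN ⟨m, h, rfl⟩
  have hTL : ∀ z ∈ T, z ∉ L := fun z hz hzL => by
    have hzr : ‖z‖ < r := by
      by_contra! h
      exact hTK z hz ⟨hzL, by simpa using h⟩
    have hmr : r < ‖m‖ := by
      by_contra! h
      exact hmL (Or.inr (by simpa using h))
    obtain ⟨y, hy, hyr⟩ := hT.intermediate_value hz hmT continuous_norm.continuousOn
      ⟨hzr.le, hmr.le⟩
    exact hTK y hy ⟨Or.inr (by simp [hyr]), by simp [hyr]⟩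
  have hGT : G '' T ⊆ Aᶜ := by
    rintro _ ⟨z, hz, rfl⟩ ⟨y, hy, hyz⟩
    exact hTL z hz (hGi (hLV hy) (hTV hz) hyz ▸ hy)
  have h1 := (hT.image G (hG.continuousOn.mono hTV)).subset_connectedComponentIn ⟨m, hmT, rfl⟩ hGT
    ⟨m', hmT', rfl⟩
  rw [← connectedComponentIn_eq hmN] at h1
  have h2 : q ∈ connectedComponentIn Aᶜ 0 := by
    rw [connectedComponentIn_eq h1, ← connectedComponentIn_eq hmN']
    exact mem_connectedComponentIn hqA
  linarith [hR' q h2, le_max_right R R']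

end

section

open Filter

theorem continuousOn_invFunOn {V : Set ℂ} (hV : IsOpen V) (hVc : IsPreconnected V) {f : ℂ → ℂ}
    (hf : DifferentiableOn ℂ f V) (hinj : InjOn f V) :
    ContinuousOn (Function.invFunOn f V) (f '' V) := by
  rintro _ ⟨y, hy, rfl⟩
  refine ContinuousAt.continuousWithinAt fun W hW => ?_
  rw [hinj.leftInvOn_invFunOn hy] at hW
  have h1 : IsOpen (f '' (interior W ∩ V)) :=
    isOpen_image_of_injOn hV hVc hf hinj inter_subset_right (isOpen_interior.inter hV)
  rw [mem_map]
  filter_upwards [h1.mem_nhds ⟨y, ⟨mem_interior_iff_mem_nhds.2 hW, hy⟩, rfl⟩] with z hz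
  obtain ⟨x, ⟨hxW, hxV⟩, rfl⟩ := hz
  rw [mem_preimage, hinj.leftInvOn_invFunOn hxV]
  exact interior_subset hxW

theorem eventually_deriv_ne_zero {V : Set ℂ} (hV : IsOpen V) {f : ℂ → ℂ}
    (hf : DifferentiableOn ℂ f V) (hinj : InjOn f V) {y : ℂ} (hy : y ∈ V) :
    ∀ᶠ z in 𝓝[≠] y, deriv f z ≠ 0 := by
  have ha : AnalyticAt ℂ (deriv f) y := ((hf.analyticOnNhd hV).deriv) y hy
  rcases ha.eventually_eq_zero_or_eventually_ne_zero with h | h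
  · exfalso
    obtain ⟨ε, hε, hball⟩ := Metric.mem_nhds_iff.1 (h.and (hV.mem_nhds hy))
    have hc := fun {p q} => (convex_ball y ε).is_const_of_fderivWithin_eq_zero (𝕜 := ℂ) (f := f) (x := p) (y := q)
      (hf.mono fun z hz => (hball hz).2) fun z hz => by
        rw [fderivWithin_of_isOpen Metric.isOpen_ball hz]
        ext
        simpa using (hball hz).1
    have h2 : y + (ε / 2 : ℝ) ∈ Metric.ball y ε := by simp [abs_of_pos hε, hε]
    have := hinj hy (hball h2).2 (hc (Metric.mem_ball_self hε) h2)
    simp at this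
    linarith
  · exact h

theorem differentiableOn_invFunOn {V : Set ℂ} (hV : IsOpen V) (hVc : IsPreconnected V) {f : ℂ → ℂ}
    (hf : DifferentiableOn ℂ f V) (hinj : InjOn f V) :
    DifferentiableOn ℂ (Function.invFunOn f V) (f '' V) := by
  have hB : IsOpen (f '' V) := isOpen_image_of_injOn hV hVc hf hinj subset_rfl hV
  have hc := continuousOn_invFunOn hV hVc hf hinj
  set F := Function.invFunOn f V
  have hFV : ∀ z ∈ f '' V, F z ∈ V := fun z hz => Function.invFunOn_mem hz
  have hfF : ∀ z ∈ f '' V, f (F z) = z := fun z hz => Function.invFunOn_eq hz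
  have key : ∀ z ∈ f '' V, deriv f (F z) ≠ 0 → DifferentiableAt ℂ F z := fun z hz hd =>
    (HasDerivAt.of_local_left_inverse (hc.continuousAt (hB.mem_nhds hz))
      (hf.differentiableAt (hV.mem_nhds (hFV z hz))).hasDerivAt hd
      (by filter_upwards [hB.mem_nhds hz] with y hy using hfF y hy)).differentiableAt
  intro z hz
  have hcz := hc.continuousAt (hB.mem_nhds hz)
  refine (Complex.analyticAt_of_differentiable_on_punctured_nhds_of_continuousAt ?_
    hcz).differentiableAt.differentiableWithinAt
  have ht : Tendsto F (𝓝[≠] z) (𝓝[≠] (F z)) := by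
    refine tendsto_nhdsWithin_iff.2 ⟨hcz.tendsto.mono_left nhdsWithin_le_nhds, ?_⟩
    filter_upwards [self_mem_nhdsWithin, mem_nhdsWithin_of_mem_nhds (hB.mem_nhds hz)] with y hy hyB h
    exact hy (by rw [mem_singleton_iff, ← hfF y hyB, h, hfF z hz])
  filter_upwards [ht.eventually (eventually_deriv_ne_zero hV hf hinj (hFV z hz)),
    mem_nhdsWithin_of_mem_nhds (hB.mem_nhds hz)] with y hy hyB using key y hyB hy

/-- A conformal map from the punctured disc onto the complement of `X`, with a pole at `0`. -/
structure IsExteriorMap (ψ : ℂ → ℂ) (X : Set ℂ) : Prop where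
  differentiableOn : DifferentiableOn ℂ ψ (Metric.ball 0 1 \ {0})
  injOn : InjOn ψ (Metric.ball 0 1 \ {0})
  image_eq : ψ '' (Metric.ball 0 1 \ {0}) = Xᶜ
  tendsto : Tendsto ψ (𝓝[≠] 0) (Bornology.cobounded ℂ)
  bounded : ∃ R : ℝ, ∀ z, 1 / 2 ≤ ‖z‖ → ‖z‖ < 1 → ‖ψ z‖ ≤ R

theorem exists_isExteriorMap {X : Set ℂ} (hX : IsCompact X) (hXp : IsPreconnected X) {x₀ x₁ : ℂ}
    (hx₀ : x₀ ∈ X) (hx₁ : x₁ ∈ X) (hne : x₀ ≠ x₁)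
    (hXc : ∀ p ∉ X, ∀ q ∉ X, q ∈ connectedComponentIn Xᶜ p) : ∃ ψ, IsExteriorMap ψ X := by
  set V := invDomain X x₀ with hVdef
  have hV : IsOpen V := isOpen_invDomain hX x₀
  have hXp' : IsPreconnected Xᶜ := by
    obtain ⟨R, hR⟩ := hX.isBounded.subset_closedBall 0
    obtain ⟨p, hp⟩ := exists_norm_gt R
    have hpX : p ∉ X := fun h => by have := hR h; simp at this; linarith
    have : Xᶜ = connectedComponentIn Xᶜ p :=
      Subset.antisymm (fun q hq => hXc p hpX q hq) (connectedComponentIn_subset _ _)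
    rw [this]; exact isPreconnected_connectedComponentIn
  have hVc : IsPreconnected V := isPreconnected_invDomain hX hx₀ hXp'
  have h0 : (0 : ℂ) ∈ V := Or.inl rfl
  have ha : (x₁ - x₀)⁻¹ ∉ V := by
    rintro (h | h)
    · exact hne (sub_eq_zero.1 (inv_eq_zero.1 h)).symm
    · exact h (by simpa using hx₁)
  obtain ⟨f, hf, hinj, him, hf0⟩ := exists_riemann_map hV hVc h0 ha
    (logDomain_invDomain hX hXp hx₀ hXc hVc)
  have hF := differentiableOn_invFunOn hV hVc hf hinj
  have hFV : ∀ z ∈ f '' V, Function.invFunOn f V z ∈ V := fun z hz => Function.invFunOn_mem hz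
  have hfF : ∀ z ∈ f '' V, f (Function.invFunOn f V z) = z := fun z hz => Function.invFunOn_eq hz
  have hFf : ∀ z ∈ V, Function.invFunOn f V (f z) = z := fun z hz => hinj.leftInvOn_invFunOn hz
  rw [him] at hF hFV hfF
  set F := Function.invFunOn f V
  have hF0 : F 0 = 0 := by
    have := hFf 0 h0
    rwa [hf0] at this
  have hFne : ∀ z ∈ Metric.ball (0 : ℂ) 1 \ {0}, F z ≠ 0 := fun z hz h => hz.2 (by
    rw [mem_singleton_iff, ← hfF z hz.1, h, hf0])
  have hFc : ContinuousAt F 0 := hF.continuousOn.continuousAt (Metric.ball_mem_nhds _ one_pos)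
  refine ⟨fun z => x₀ + (F z)⁻¹, ?_, ?_, ?_, ?_, ?_⟩
  · exact ((hF.mono sdiff_subset).inv hFne).const_add x₀
  · intro y hy z hz h
    have h1 : F y = F z := inv_injective (add_left_cancel h)
    rw [← hfF y hy.1, h1, hfF z hz.1]
  · ext w; constructor
    · rintro ⟨z, hz, rfl⟩
      exact (hFV z hz.1).resolve_left (hFne z hz)
    · intro hw
      have hwx : w - x₀ ≠ 0 := sub_ne_zero.2 fun h => hw (h ▸ hx₀)
      have hwV : (w - x₀)⁻¹ ∈ V := Or.inr (by simpa using hw)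
      refine ⟨f (w - x₀)⁻¹, ⟨him ▸ ⟨_, hwV, rfl⟩, fun h => ?_⟩, ?_⟩
      · rw [mem_singleton_iff, ← hf0] at h
        exact inv_ne_zero hwx (hinj hwV h0 h)
      · simp [hFf _ hwV]
  · have ht : Tendsto F (𝓝[≠] 0) (𝓝[≠] 0) := by
      refine tendsto_nhdsWithin_iff.2 ⟨?_, ?_⟩
      · have := hFc.tendsto; rw [hF0] at this; exact this.mono_left nhdsWithin_le_nhds
      · filter_upwards [self_mem_nhdsWithin,
          mem_nhdsWithin_of_mem_nhds (Metric.ball_mem_nhds (0 : ℂ) one_pos)] with y hy hyB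
        exact hFne y ⟨hyB, hy⟩
    exact tendsto_const_add_cobounded x₀ |>.comp (tendsto_inv₀_nhdsNE_zero.comp ht)
  · have hfc : ContinuousAt f 0 := hf.continuousOn.continuousAt (hV.mem_nhds h0)
    have := hfc.preimage_mem_nhds (by rw [hf0]; exact Metric.ball_mem_nhds 0 one_half_pos)
    obtain ⟨η, hη, hball⟩ := Metric.mem_nhds_iff.1 this
    refine ⟨‖x₀‖ + η⁻¹, fun z hz hz1 => (norm_add_le _ _).trans (add_le_add_right ?_ _)⟩
    rw [norm_inv]
    refine inv_anti₀ hη ?_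
    by_contra! h
    have h2 := hball (mem_ball_zero_iff.2 h)
    rw [mem_preimage, hfF z (mem_ball_zero_iff.2 hz1), mem_ball_zero_iff] at h2
    linarith

end

section

open Filter MeasureTheory

theorem abs_det_restrictScalars_toSpanSingleton (w : ℂ) :
    |((ContinuousLinearMap.toSpanSingleton ℂ w).restrictScalars ℝ).det| = ‖w‖ ^ 2 := by
  simp [ContinuousLinearMap.det, LinearMap.det_restrictScalars, Algebra.norm_complex_apply,
    Complex.normSq_eq_norm_sq]

theorem lintegral_norm_deriv_sq {S : Set ℂ} (hS : IsOpen S) {H : ℂ → ℂ}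
    (hH : DifferentiableOn ℂ H S) (hinj : InjOn H S) :
    ∫⁻ z in S, ENNReal.ofReal (‖deriv H z‖ ^ 2) = volume (H '' S) := by
  have := lintegral_image_eq_lintegral_abs_det_fderiv_mul volume hS.measurableSet
    (f' := fun z => (ContinuousLinearMap.toSpanSingleton ℂ (deriv H z)).restrictScalars ℝ)
    (fun z hz => ((hH.differentiableAt (hS.mem_nhds hz)).hasDerivAt.hasFDerivAt.restrictScalars
      ℝ).hasFDerivWithinAt) hinj (fun _ => 1)
  simp only [abs_det_restrictScalars_toSpanSingleton, mul_one, lintegral_const, one_mul,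
    Measure.restrict_apply_univ] at this
  exact this.symm

theorem exists_vertical_lintegral_le {S : Set ℂ} (hS : IsOpen S) {H : ℂ → ℂ}
    (hH : DifferentiableOn ℂ H S) (hinj : InjOn H S) {R : ℝ} (hR : ∀ z ∈ S, ‖H z‖ ≤ R)
    {a b c : ℝ}
    (hvol : volume (Metric.closedBall (0 : ℂ) R) < ENNReal.ofReal c * ENNReal.ofReal (b - a)) :
    ∃ s ∈ Ioo a b, ∫⁻ θ in {θ : ℝ | (⟨s, θ⟩ : ℂ) ∈ S},
      ENNReal.ofReal (‖deriv H ⟨s, θ⟩‖ ^ 2) ≤ ENNReal.ofReal c := by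
  by_contra! hcon
  have harea : ∫⁻ z in S, ENNReal.ofReal (‖deriv H z‖ ^ 2) ≤
      volume (Metric.closedBall (0 : ℂ) R) := by
    rw [lintegral_norm_deriv_sq hS hH hinj]
    refine measure_mono ?_
    rintro _ ⟨z, hz, rfl⟩
    simpa using hR z hz
  set g : ℂ → ENNReal := S.indicator fun z => ENNReal.ofReal (‖deriv H z‖ ^ 2)
  have hg : Measurable g :=
    (((measurable_deriv H).norm.pow_const 2).ennreal_ofReal).indicator hS.measurableSet
  rw [← lintegral_indicator hS.measurableSet] at harea
  have h1 : ∫⁻ z, g z = ∫⁻ p : ℝ × ℝ, g (Complex.measurableEquivRealProd.symm p) :=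
    (Complex.volume_preserving_equiv_real_prod.symm.lintegral_comp hg).symm
  rw [show (∫⁻ z, S.indicator (fun z => ENNReal.ofReal (‖deriv H z‖ ^ 2)) z) = ∫⁻ z, g z from rfl,
    h1, Measure.volume_eq_prod, lintegral_prod
      (fun p : ℝ × ℝ => g (Complex.measurableEquivRealProd.symm p))
      (hg.comp (MeasurableEquiv.measurable _)).aemeasurable] at harea
  have h2 : ∀ s ∈ Ioo a b, ENNReal.ofReal c ≤
      ∫⁻ θ, g (Complex.measurableEquivRealProd.symm (s, θ)) := fun s hs => by
    refine (hcon s hs).le.trans (le_of_eq ?_)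
    have hms : MeasurableSet {θ : ℝ | (⟨s, θ⟩ : ℂ) ∈ S} :=
      (hS.preimage (Complex.equivRealProdCLM.symm.continuous.comp
        (Continuous.prodMk_right s))).measurableSet
    rw [← lintegral_indicator hms]
    rfl
  have h3 : ENNReal.ofReal c * ENNReal.ofReal (b - a) ≤
      ∫⁻ s, ∫⁻ θ, g (Complex.measurableEquivRealProd.symm (s, θ)) := by
    calc ENNReal.ofReal c * ENNReal.ofReal (b - a) = ∫⁻ s in Ioo a b, ENNReal.ofReal c := by
          rw [lintegral_const, Measure.restrict_apply_univ, Real.volume_Ioo]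
      _ ≤ ∫⁻ s in Ioo a b, ∫⁻ θ, g (Complex.measurableEquivRealProd.symm (s, θ)) :=
          setLIntegral_mono' measurableSet_Ioo h2
      _ ≤ _ := setLIntegral_le_lintegral _ _
  exact absurd (h3.trans harea) (not_le.2 hvol)

theorem norm_sub_le_of_lintegral_le {S : Set ℂ} (hS : IsOpen S) {H : ℂ → ℂ}
    (hH : DifferentiableOn ℂ H S) {s c : ℝ} (hc : 0 < c)
    (hinter : ∫⁻ θ in {θ : ℝ | (⟨s, θ⟩ : ℂ) ∈ S},
      ENNReal.ofReal (‖deriv H ⟨s, θ⟩‖ ^ 2) ≤ ENNReal.ofReal c)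
    {x y : ℝ} (hxy : x ≤ y) (hseg : ∀ θ ∈ Icc x y, (⟨s, θ⟩ : ℂ) ∈ S) :
    ‖H ⟨s, y⟩ - H ⟨s, x⟩‖ ≤ √(c * (y - x)) := by
  rcases hxy.eq_or_lt with rfl | hlt
  · simp
  have hline : Continuous fun θ : ℝ => (⟨s, θ⟩ : ℂ) :=
    Complex.equivRealProdCLM.symm.continuous.comp (Continuous.prodMk_right s)
  have hd : ∀ θ ∈ Icc x y, HasDerivAt (fun θ : ℝ => H ⟨s, θ⟩) (deriv H ⟨s, θ⟩ * Complex.I) θ := by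
    intro θ hθ
    have h1 : HasDerivAt (fun θ : ℝ => (⟨s, θ⟩ : ℂ)) Complex.I θ := by
      have : HasDerivAt (fun θ : ℝ => (s : ℂ) + (θ : ℂ) * Complex.I) Complex.I θ := by
        simpa using ((Complex.ofRealCLM.hasDerivAt (x := θ)).mul_const Complex.I).const_add (s : ℂ)
      refine this.congr_of_eventuallyEq (Eventually.of_forall fun t => ?_)
      apply Complex.ext <;> simp
    exact (hH.differentiableAt (hS.mem_nhds (hseg θ hθ))).hasDerivAt.comp_of_eq θ h1 rfl
  have hdc : ContinuousOn (fun θ : ℝ => deriv H ⟨s, θ⟩) (Icc x y) :=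
    ((hH.deriv hS).continuousOn).comp hline.continuousOn hseg
  have hftc : ∫ θ in x..y, deriv H ⟨s, θ⟩ * Complex.I = H ⟨s, y⟩ - H ⟨s, x⟩ := by
    refine intervalIntegral.integral_eq_sub_of_hasDerivAt (fun θ hθ => hd θ ?_) ?_
    · rwa [uIcc_of_le hxy] at hθ
    · refine ContinuousOn.intervalIntegrable ?_
      rw [uIcc_of_le hxy]; exact hdc.mul continuousOn_const
  have hsq : ∫ θ in x..y, ‖deriv H ⟨s, θ⟩‖ ^ 2 ≤ c := by
    rw [intervalIntegral.integral_of_le hxy, ← ENNReal.ofReal_le_ofReal_iff hc.le,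
      ofReal_integral_eq_lintegral_ofReal]
    · refine le_trans (lintegral_mono_set fun θ hθ => ?_) hinter
      exact hseg θ (Ioc_subset_Icc_self hθ)
    · exact ((hdc.norm.pow 2).integrableOn_Icc).mono_set Ioc_subset_Icc_self
    · exact Eventually.of_forall fun θ => by positivity
  have hlen : 0 < y - x := sub_pos.2 hlt
  set l : ℝ := √((y - x) / c)
  have hl : 0 < l := Real.sqrt_pos.2 (by positivity)
  have hl2 : l ^ 2 = (y - x) / c := Real.sq_sqrt (by positivity)
  have hnc : ContinuousOn (fun θ : ℝ => ‖deriv H ⟨s, θ⟩‖) (uIcc x y) := by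
    rw [uIcc_of_le hxy]; exact hdc.norm
  rw [← hftc]
  calc ‖∫ θ in x..y, deriv H ⟨s, θ⟩ * Complex.I‖
      ≤ ∫ θ in x..y, ‖deriv H ⟨s, θ⟩ * Complex.I‖ := intervalIntegral.norm_integral_le_integral_norm hxy
    _ ≤ ∫ θ in x..y, (l / 2 * ‖deriv H ⟨s, θ⟩‖ ^ 2 + 1 / (2 * l)) := by
        refine intervalIntegral.integral_mono_on hxy ?_ ?_ fun θ _ => ?_
        · simpa using hnc.intervalIntegrable
        · exact ((continuousOn_const.mul (hnc.pow 2)).add continuousOn_const).intervalIntegrable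
        · simp only [norm_mul, Complex.norm_I, mul_one]
          have : 0 ≤ (l * ‖deriv H ⟨s, θ⟩‖ - 1) ^ 2 / (2 * l) := by positivity
          have h2 : (l * ‖deriv H ⟨s, θ⟩‖ - 1) ^ 2 / (2 * l) =
            l / 2 * ‖deriv H ⟨s, θ⟩‖ ^ 2 + 1 / (2 * l) - ‖deriv H ⟨s, θ⟩‖ := by
            field_simp; ring
          linarith
    _ = l / 2 * (∫ θ in x..y, ‖deriv H ⟨s, θ⟩‖ ^ 2) + (y - x) * (1 / (2 * l)) := by
        rw [intervalIntegral.integral_add, intervalIntegral.integral_const_mul,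
          intervalIntegral.integral_const, smul_eq_mul]
        · exact (continuousOn_const.mul (hnc.pow 2)).intervalIntegrable
        · exact continuousOn_const.intervalIntegrable
    _ ≤ l / 2 * c + (y - x) * (1 / (2 * l)) := by gcongr
    _ = √(c * (y - x)) := by
        have h3 : l * c = √(c * (y - x)) := by
          rw [eq_comm, Real.sqrt_eq_iff_mul_self_eq_of_pos (by positivity), ← pow_two, mul_pow, hl2]
          field_simp
        have h4 : y - x = l ^ 2 * c := by rw [hl2]; field_simp
        rw [← h3, h4]; field_simp; ring

theorem norm_one_sub_exp_lt {σ : ℂ} (h : Real.exp σ.re < 2 * Real.cos σ.im) :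
    ‖1 - Complex.exp σ‖ < 1 := by
  rw [← abs_of_nonneg (norm_nonneg (1 - Complex.exp σ)), ← sq_lt_one_iff_abs_lt_one,
    ← Complex.normSq_eq_norm_sq, Complex.normSq_apply, Complex.sub_re, Complex.sub_im,
    Complex.exp_re, Complex.exp_im]
  have h1 := Real.exp_pos σ.re
  simp only [Complex.one_re, Complex.one_im]
  have h2 := Real.sin_sq_add_cos_sq σ.im
  have h3 := mul_pos h1 (sub_pos.2 h)
  generalize Real.exp σ.re = e at *
  generalize Real.sin σ.im = s at *
  generalize Real.cos σ.im = c at *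
  have h4 : (1 - e * c) * (1 - e * c) + (0 - e * s) * (0 - e * s) =
    1 - 2 * e * c + e ^ 2 * (s ^ 2 + c ^ 2) := by ring
  rw [h4, h2]
  nlinarith

theorem exists_short_crosscut {ψ : ℂ → ℂ} {X : Set ℂ} (h : IsExteriorMap ψ X) {ζ : ℂ}
    (hζ : ‖ζ‖ = 1) {ρ ε : ℝ} (hρ : 0 < ρ) (hε : 0 < ε) :
    ∃ r ∈ Ioo 0 ρ, r < 1 / 2 ∧ ∀ x y : ℝ, x ≤ y →
      (∀ θ ∈ Icc x y, |θ| < Real.pi / 2 ∧ r < 2 * Real.cos θ) →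
      ‖ψ (ζ * (1 - r * Complex.exp (y * Complex.I))) -
        ψ (ζ * (1 - r * Complex.exp (x * Complex.I)))‖ ≤ ε * √(y - x) := by
  obtain ⟨R, hR⟩ := h.bounded
  set S : Set ℂ := {σ | σ.re < Real.log (1 / 2) ∧ |σ.im| < Real.pi / 2 ∧
    Real.exp σ.re < 2 * Real.cos σ.im}
  have hS : IsOpen S := by
    refine (isOpen_lt Complex.continuous_re continuous_const).inter
      ((isOpen_lt Complex.continuous_im.abs continuous_const).inter
        (isOpen_lt (Real.continuous_exp.comp Complex.continuous_re)
          (continuous_const.mul (Real.continuous_cos.comp Complex.continuous_im))))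
  have hexp : ∀ σ ∈ S, ‖Complex.exp σ‖ < 1 / 2 := fun σ hσ => by
    rw [Complex.norm_exp]
    exact (Real.lt_log_iff_exp_lt (by norm_num)).1 hσ.1
  have hhalf : ∀ σ ∈ S, 1 / 2 ≤ ‖ζ * (1 - Complex.exp σ)‖ := fun σ hσ => by
    rw [norm_mul, hζ, one_mul]
    have := norm_sub_norm_le (1 : ℂ) (Complex.exp σ)
    rw [norm_one] at this
    linarith [hexp σ hσ]
  have hlt : ∀ σ ∈ S, ‖ζ * (1 - Complex.exp σ)‖ < 1 := fun σ hσ => by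
    rw [norm_mul, hζ, one_mul]; exact norm_one_sub_exp_lt hσ.2.2
  have hmaps : MapsTo (fun σ => ζ * (1 - Complex.exp σ)) S (Metric.ball 0 1 \ {0}) := fun σ hσ =>
    ⟨by simpa using hlt σ hσ, fun h0 => by
      have := hhalf σ hσ
      rw [show ζ * (1 - Complex.exp σ) = 0 from h0, norm_zero] at this
      norm_num at this⟩
  have hζ0 : ζ ≠ 0 := norm_pos_iff.1 (by rw [hζ]; exact one_pos)
  set H : ℂ → ℂ := fun σ => ψ (ζ * (1 - Complex.exp σ))
  have hH : DifferentiableOn ℂ H S := h.differentiableOn.comp (by fun_prop) hmaps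
  have hinj : InjOn H S := fun σ hσ τ hτ hst => by
    have h1 := mul_left_cancel₀ hζ0 (h.injOn (hmaps hσ) (hmaps hτ) hst)
    have hπ := Real.pi_pos
    refine Complex.exp_inj_of_neg_pi_lt_of_le_pi ?_ ?_ ?_ ?_ (sub_right_injective h1)
    all_goals
      have a1 := abs_lt.1 hσ.2.1
      have a2 := abs_lt.1 hτ.2.1
      linarith [a1.1, a1.2, a2.1, a2.2]
  have hHR : ∀ σ ∈ S, ‖H σ‖ ≤ R := fun σ hσ => hR _ (hhalf σ hσ) (hlt σ hσ)
  set b := min (Real.log (1 / 2)) (Real.log ρ)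
  have hvol : volume (Metric.closedBall (0 : ℂ) R) ≠ ⊤ :=
    (isCompact_closedBall (0 : ℂ) R).measure_lt_top.ne
  set v := (volume (Metric.closedBall (0 : ℂ) R)).toReal
  obtain ⟨s, hs, hinter⟩ := exists_vertical_lintegral_le hS hH hinj hHR
    (a := b - (v + 1) / ε ^ 2) (b := b) (c := ε ^ 2) (by
      rw [← ENNReal.ofReal_mul (by positivity), ← ENNReal.ofReal_toReal hvol]
      have hv0 : 0 ≤ v := ENNReal.toReal_nonneg
      have : ε ^ 2 * (b - (b - (v + 1) / ε ^ 2)) = v + 1 := by field_simp; ring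
      rw [this]
      exact (ENNReal.ofReal_lt_ofReal_iff (by linarith)).2 (by linarith))
  have hs1 : Real.exp s < 1 / 2 := (Real.lt_log_iff_exp_lt (by norm_num)).1
    (hs.2.trans_le (min_le_left _ _))
  refine ⟨Real.exp s, ⟨Real.exp_pos s, (Real.lt_log_iff_exp_lt hρ).1
    (hs.2.trans_le (min_le_right _ _))⟩, hs1, fun x y hxy hθ => ?_⟩
  have := norm_sub_le_of_lintegral_le hS hH (by positivity) hinter hxy fun θ hθ' =>
    ⟨hs.2.trans_le (min_le_left _ _), (hθ θ hθ').1, (hθ θ hθ').2⟩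
  rw [Real.sqrt_mul (by positivity), Real.sqrt_sq hε.le] at this
  have he : ∀ θ : ℝ, Complex.exp ⟨s, θ⟩ = (Real.exp s : ℝ) * Complex.exp (θ * Complex.I) := by
    intro θ
    rw [show (⟨s, θ⟩ : ℂ) = (s : ℂ) + θ * Complex.I by apply Complex.ext <;> simp, Complex.exp_add,
      Complex.ofReal_exp]
  simpa only [H, he] using this

end

section

open Filter

theorem isPreconnected_punctured_ball : IsPreconnected (Metric.ball (0 : ℂ) 1 \ {0}) := by
  have : Metric.ball (0 : ℂ) 1 \ {0} = (fun x : ℝ × ℝ => (x.1 : ℂ) * Complex.exp (x.2 * Complex.I)) ''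
      (Ioo 0 1 ×ˢ univ) := by
    ext z; constructor
    · rintro ⟨hz, h0⟩
      exact ⟨(‖z‖, z.arg), ⟨⟨norm_pos_iff.2 h0, by simpa using hz⟩, trivial⟩,
        Complex.norm_mul_exp_arg_mul_I z⟩
    · rintro ⟨⟨r, θ⟩, ⟨hr, -⟩, rfl⟩
      simp only [mem_Ioo] at hr
      refine ⟨by simp [Complex.norm_exp_ofReal_mul_I, abs_of_pos hr.1, hr.2], ?_⟩
      simp [hr.1.ne', Complex.exp_ne_zero]
  rw [this]
  exact (isPreconnected_Ioo.prod isPreconnected_univ).image _ (by fun_prop)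

theorem isOpen_punctured_ball : IsOpen (Metric.ball (0 : ℂ) 1 \ {0}) :=
  Metric.isOpen_ball.sdiff isClosed_singleton

/-- The inverse of an exterior map. -/
noncomputable def extInv (ψ : ℂ → ℂ) : ℂ → ℂ := Function.invFunOn ψ (Metric.ball 0 1 \ {0})

namespace IsExteriorMap

variable {ψ : ℂ → ℂ} {X : Set ℂ} (h : IsExteriorMap ψ X)
include h

theorem continuousOn_extInv : ContinuousOn (extInv ψ) Xᶜ := by
  rw [← h.image_eq]
  exact continuousOn_invFunOn isOpen_punctured_ball isPreconnected_punctured_ball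
    h.differentiableOn h.injOn

theorem extInv_mem {w : ℂ} (hw : w ∉ X) : extInv ψ w ∈ Metric.ball 0 1 \ {0} :=
  Function.invFunOn_mem (h.image_eq.ge hw)

theorem apply_extInv {w : ℂ} (hw : w ∉ X) : ψ (extInv ψ w) = w :=
  Function.invFunOn_eq (h.image_eq.ge hw)

theorem extInv_apply {z : ℂ} (hz : z ∈ Metric.ball 0 1 \ {0}) : extInv ψ (ψ z) = z :=
  h.injOn.leftInvOn_invFunOn hz

theorem apply_notMem {z : ℂ} (hz : z ∈ Metric.ball 0 1 \ {0}) : ψ z ∉ X :=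
  h.image_eq.le ⟨z, hz, rfl⟩

end IsExteriorMap

theorem escapes_of_subset_closedBall {A : Set ℂ} {a p : ℂ} {R : ℝ}
    (hA : A ⊆ Metric.closedBall a R) (hp : p ∉ Metric.closedBall a R) : Escapes A p := by
  intro R'
  have hpre : IsPreconnected ((fun z => a + z) '' {z : ℂ | R < ‖z‖}) :=
    (isPreconnected_norm_gt R).image _ (by fun_prop)
  have hmem : ∀ z, z ∈ (fun z => a + z) '' {z : ℂ | R < ‖z‖} ↔ z ∉ Metric.closedBall a R := by
    intro z
    rw [Metric.mem_closedBall, not_le, dist_eq_norm]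
    constructor
    · rintro ⟨y, hy, rfl⟩; simpa using hy
    · intro hz; exact ⟨z - a, hz, by simp⟩
  obtain ⟨q, hq⟩ := exists_norm_gt (|R| + |R'| + ‖a‖)
  have hqn : q ∉ Metric.closedBall a R := by
    rw [Metric.mem_closedBall, not_le, dist_eq_norm]
    have := norm_sub_norm_le q a
    linarith [le_abs_self R, abs_nonneg R']
  refine ⟨q, hpre.subset_connectedComponentIn ((hmem p).2 hp) ?_ ((hmem q).2 hqn), ?_⟩
  · intro z hz hzA; exact (hmem z).1 hz (hA hzA)
  · linarith [le_abs_self R', abs_nonneg R, norm_nonneg a]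

theorem escapes_of_compl {X : Set ℂ} (hX : IsCompact X)
    (hXc : ∀ p ∉ X, ∀ q ∉ X, q ∈ connectedComponentIn Xᶜ p) {p : ℂ} (hp : p ∉ X) :
    Escapes X p := by
  intro R
  obtain ⟨R', hR'⟩ := hX.isBounded.subset_closedBall 0
  obtain ⟨q, hq⟩ := exists_norm_gt (max R R')
  refine ⟨q, hXc p hp q fun h => ?_, (le_max_left _ _).trans_lt hq⟩
  have := hR' h
  rw [mem_closedBall_zero_iff] at this
  linarith [le_max_right R R']

theorem exists_small_crosscut {ψ : ℂ → ℂ} {X : Set ℂ} (h : IsExteriorMap ψ X) {ζ : ℂ}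
    (hζ : ‖ζ‖ = 1) {ρ ε : ℝ} (hρ : 0 < ρ) (hε : 0 < ε) :
    ∃ r ∈ Ioo 0 ρ, r < 1 / 2 ∧ ∀ z ∈ Metric.ball (0 : ℂ) 1 ∩ Metric.sphere ζ r,
      ∀ z' ∈ Metric.ball (0 : ℂ) 1 ∩ Metric.sphere ζ r, dist (ψ z) (ψ z') ≤ ε := by
  have hπ := Real.pi_pos
  obtain ⟨r, hr, hr2, H⟩ := exists_short_crosscut h hζ hρ (div_pos hε (Real.sqrt_pos.2 hπ))
  have hζ0 : ζ ≠ 0 := norm_pos_iff.1 (by rw [hζ]; exact one_pos)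
  refine ⟨r, hr, hr2, ?_⟩
  have hpar : ∀ z ∈ Metric.ball (0 : ℂ) 1 ∩ Metric.sphere ζ r, ∃ θ : ℝ, |θ| < Real.pi / 2 ∧
      r < 2 * Real.cos θ ∧ z = ζ * (1 - r * Complex.exp (θ * Complex.I)) := by
    rintro z ⟨hz, hzr⟩
    set w := 1 - z / ζ with hw
    have hzw : z = ζ * (1 - w) := by rw [hw]; field_simp; ring
    have hwr : ‖w‖ = r := by
      have h1 : ‖ζ * w‖ = r := by
        rw [← mem_sphere_iff_norm.1 hzr, ← norm_neg]; congr 1; rw [hw]; field_simp; ring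
      rwa [norm_mul, hζ, one_mul] at h1
    have hw1 : ‖1 - w‖ < 1 := by
      have := mem_ball_zero_iff.1 hz
      rwa [hzw, norm_mul, hζ, one_mul] at this
    have hpol := Complex.norm_mul_exp_arg_mul_I w
    rw [hwr] at hpol
    have hre : w.re = r * Real.cos w.arg := by
      have := Complex.norm_mul_cos_arg w; rw [hwr] at this; exact this.symm
    have hcos : r < 2 * Real.cos w.arg := by
      have h1 : ‖1 - w‖ ^ 2 < 1 := by
        have := norm_nonneg (1 - w); nlinarith
      rw [← Complex.normSq_eq_norm_sq, Complex.normSq_apply] at h1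
      have h2 : w.re * w.re + w.im * w.im = r ^ 2 := by
        rw [← Complex.normSq_apply, Complex.normSq_eq_norm_sq, hwr]
      simp only [Complex.sub_re, Complex.sub_im, Complex.one_re, Complex.one_im] at h1
      have h3 : r * r < r * (2 * Real.cos w.arg) := by nlinarith
      exact lt_of_mul_lt_mul_left h3 hr.1.le
    refine ⟨w.arg, ?_, hcos, by rw [hpol, ← hzw]⟩
    rw [Complex.abs_arg_lt_pi_div_two_iff]
    left; rw [hre]; exact mul_pos hr.1 (by linarith [hr.1])
  have key : ∀ x y : ℝ, x ≤ y → |x| < Real.pi / 2 → |y| < Real.pi / 2 → r < 2 * Real.cos x →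
      r < 2 * Real.cos y → dist (ψ (ζ * (1 - r * Complex.exp (y * Complex.I))))
        (ψ (ζ * (1 - r * Complex.exp (x * Complex.I)))) ≤ ε := by
    intro x y hxy hx hy hcx hcy
    rw [abs_lt] at hx hy
    rw [dist_eq_norm]
    refine (H x y hxy fun θ hθ => ⟨abs_lt.2 ⟨by linarith [hθ.1], by linarith [hθ.2]⟩, ?_⟩).trans ?_
    · rcases le_total 0 θ with h0 | h0
      · have := Real.cos_le_cos_of_nonneg_of_le_pi h0 (by linarith) hθ.2
        linarith
      · have := Real.cos_le_cos_of_nonneg_of_le_pi (x := -θ) (y := -x) (by linarith) (by linarith)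
          (by linarith [hθ.1])
        rw [Real.cos_neg, Real.cos_neg] at this
        linarith
    · rw [div_mul_eq_mul_div, div_le_iff₀ (Real.sqrt_pos.2 hπ)]
      exact mul_le_mul_of_nonneg_left (Real.sqrt_le_sqrt (by linarith)) hε.le
  intro z hz z' hz'
  obtain ⟨x, hx, hcx, rfl⟩ := hpar z hz
  obtain ⟨y, hy, hcy, rfl⟩ := hpar z' hz'
  rcases le_total x y with hxy | hxy
  · rw [dist_comm]; exact key x y hxy hx hy hcx hcy
  · exact key y x hxy hy hx hcy hcx

theorem exists_small_connected_superset {X : Set ℂ} (hX : IsCompact X) [LocallyConnectedSpace X]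
    {ε : ℝ} (hε : 0 < ε) : ∃ δ > 0, ∀ E ⊆ X, (∀ a ∈ E, ∀ b ∈ E, dist a b < δ) →
      ∃ T ⊆ X, IsCompact T ∧ IsPreconnected T ∧ E ⊆ T ∧
        ∀ a ∈ E, T ⊆ Metric.closedBall a ε := by
  obtain ⟨δ, hδ, H⟩ := exists_small_continuum hX (half_pos hε)
  refine ⟨min δ (ε / 2), lt_min hδ (half_pos hε), fun E hEX hE => ?_⟩
  rcases E.eq_empty_or_nonempty with rfl | ⟨a, ha⟩
  · exact ⟨∅, by simp, isCompact_empty, isPreconnected_empty, by simp, by simp⟩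
  have : ∀ b : E, ∃ T ⊆ X, IsCompact T ∧ IsPreconnected T ∧ a ∈ T ∧ (b : ℂ) ∈ T ∧
      T ⊆ Metric.closedBall a (ε / 2) := fun b =>
    H a (hEX ha) b (hEX b.2) ((hE a ha b b.2).trans_le (min_le_left _ _))
  choose T hTX hTc hTp haT hbT hTb using this
  have hUX : closure (⋃ b, T b) ⊆ X := closure_minimal (iUnion_subset hTX) hX.isClosed
  refine ⟨closure (⋃ b, T b), hUX, hX.of_isClosed_subset isClosed_closure hUX,
    (isPreconnected_iUnion ⟨a, mem_iInter.2 haT⟩ hTp).closure,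
    fun b hb => subset_closure (mem_iUnion.2 ⟨⟨b, hb⟩, hbT _⟩), fun b hb => ?_⟩
  refine (closure_minimal (iUnion_subset hTb) Metric.isClosed_closedBall).trans ?_
  refine Metric.closedBall_subset_closedBall' ?_
  have := (hE a ha b hb).trans_le (min_le_right _ _)
  linarith

theorem IsExteriorMap.exists_small_image {ψ : ℂ → ℂ} {X : Set ℂ} (h : IsExteriorMap ψ X)
    (hX : IsCompact X) [LocallyConnectedSpace X]
    (hXc : ∀ p ∉ X, ∀ q ∉ X, q ∈ connectedComponentIn Xᶜ p) {ζ : ℂ} (hζ : ‖ζ‖ = 1) {ε : ℝ}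
    (hε : 0 < ε) : ∃ r > 0, ∃ c, ∀ z ∈ (Metric.ball (0 : ℂ) 1 \ {0}) ∩ Metric.ball ζ r,
      ψ z ∈ Metric.closedBall c ε := by
  obtain ⟨R, hR⟩ := h.bounded
  obtain ⟨δ, hδ, Hδ⟩ := exists_small_connected_superset hX (half_pos hε)
  obtain ⟨r, hr, hr2, H⟩ := exists_small_crosscut h hζ one_pos
    (lt_min (half_pos hδ) (half_pos hε))
  set K := ψ '' (Metric.ball (0 : ℂ) 1 ∩ Metric.sphere ζ r)
  have hz₀ : ζ * (1 - r : ℝ) ∈ Metric.ball (0 : ℂ) 1 ∩ Metric.sphere ζ r := by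
    constructor
    · rw [mem_ball_zero_iff, norm_mul, hζ, one_mul, Complex.norm_real, Real.norm_eq_abs, abs_lt]
      constructor <;> linarith [hr.1]
    · rw [mem_sphere_iff_norm, show ζ * ((1 - r : ℝ) : ℂ) - ζ = -(ζ * (r : ℝ)) by push_cast; ring,
        norm_neg, norm_mul, hζ, one_mul, Complex.norm_real, Real.norm_eq_abs, abs_of_pos hr.1]
  set a₀ := ψ (ζ * (1 - r : ℝ))
  set ε' := min (δ / 2) (ε / 2)
  have hK : ∀ a ∈ closure K, ∀ b ∈ closure K, dist a b ≤ ε' := by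
    have h1 : closure K ×ˢ closure K ⊆ {p : ℂ × ℂ | dist p.1 p.2 ≤ ε'} := by
      rw [← closure_prod_eq]
      refine closure_minimal ?_ (isClosed_le continuous_dist continuous_const)
      rintro ⟨_, _⟩ ⟨⟨z, hz, rfl⟩, ⟨z', hz', rfl⟩⟩
      exact H z hz z' hz'
    exact fun a ha b hb => h1 (show (a, b) ∈ closure K ×ˢ closure K from ⟨ha, hb⟩)
  have ha₀ : a₀ ∈ closure K := subset_closure ⟨_, hz₀, rfl⟩
  have hKb : closure K ⊆ Metric.closedBall a₀ ε' := fun b hb => hK b hb a₀ ha₀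
  have hKc : IsCompact (closure K) := Metric.isCompact_of_isClosed_isBounded isClosed_closure
    (Metric.isBounded_closedBall.subset hKb)
  have hT : ∃ T ⊆ X, IsCompact T ∧ IsPreconnected T ∧ closure K ∩ X ⊆ T ∧
      T ⊆ Metric.closedBall a₀ ε := by
    rcases (closure K ∩ X).eq_empty_or_nonempty with hE | ⟨a, ha⟩
    · exact ⟨∅, by simp, isCompact_empty, isPreconnected_empty, hE.le, by simp⟩
    obtain ⟨T, hTX, hTc, hTp, hET, hTb⟩ := Hδ (closure K ∩ X) inter_subset_right fun a ha b hb =>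
      (hK a ha.1 b hb.1).trans_lt ((min_le_left _ _).trans_lt (half_lt_self hδ))
    refine ⟨T, hTX, hTc, hTp, hET, (hTb a ha).trans (Metric.closedBall_subset_closedBall' ?_)⟩
    have := (hK a ha.1 a₀ ha₀).trans (min_le_right _ _)
    linarith
  obtain ⟨T, hTX, hTc, hTp, hET, hTb⟩ := hT
  refine ⟨r, hr.1, a₀, fun z hz => ?_⟩
  by_contra hcon
  have hCb : closure K ∪ T ⊆ Metric.closedBall a₀ ε := by
    refine union_subset (hKb.trans (Metric.closedBall_subset_closedBall ?_)) hTb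
    exact (min_le_right _ _).trans (half_le_self hε.le)
  have hinter : (closure K ∪ T) ∩ X = T := by
    rw [union_inter_distrib_right, inter_eq_left.2 hTX, union_eq_right]; exact hET
  obtain ⟨q, hq, hqR⟩ := janiszewski_escapes (hKc.union hTc) hX (by rw [hinter]; exact hTp)
    (escapes_of_subset_closedBall hCb hcon) (escapes_of_compl hX hXc (h.apply_notMem hz.1)) R
  set S := connectedComponentIn ((closure K ∪ T) ∪ X)ᶜ (ψ z)
  have hS : S ⊆ ((closure K ∪ T) ∪ X)ᶜ := connectedComponentIn_subset _ _
  have hSX : ∀ w ∈ S, w ∉ X := fun w hw hwX => hS hw (Or.inr hwX)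
  have hzS : ψ z ∈ S := mem_connectedComponentIn fun hm =>
    hm.elim (fun hm => hcon (hCb hm)) (h.apply_notMem hz.1)
  have hpre : IsPreconnected (extInv ψ '' S) := isPreconnected_connectedComponentIn.image _
    (h.continuousOn_extInv.mono hSX)
  have hqm := h.extInv_mem (hSX q hq)
  have hqn : ‖extInv ψ q‖ < 1 / 2 := by
    by_contra hc
    have := hR (extInv ψ q) (not_lt.1 hc) (mem_ball_zero_iff.1 hqm.1)
    rw [h.apply_extInv (hSX q hq)] at this
    linarith
  have hcz : dist z ζ < r := hz.2
  have hcq : r < dist (extInv ψ q) ζ := by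
    have := norm_sub_norm_le ζ (extInv ψ q)
    rw [dist_comm, dist_eq_norm]
    linarith
  obtain ⟨_, ⟨w, hw, rfl⟩, hwr⟩ := hpre.intermediate_value (f := fun y => dist y ζ)
    (a := z) (b := extInv ψ q) ⟨ψ z, hzS, h.extInv_apply hz.1⟩ ⟨q, hq, rfl⟩ (by fun_prop)
    ⟨hcz.le, hcq.le⟩
  exact hS hw (Or.inl (Or.inl (subset_closure
    ⟨extInv ψ w, ⟨(h.extInv_mem (hSX w hw)).1, hwr⟩, h.apply_extInv (hSX w hw)⟩)))

/-- The continuous extension of an exterior map to the boundary circle. -/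
noncomputable def extBdry (ψ : ℂ → ℂ) : ℂ → ℂ := extendFrom (Metric.ball 0 1 \ {0}) ψ

theorem closedBall_diff_subset_closure :
    Metric.closedBall (0 : ℂ) 1 \ {0} ⊆ closure (Metric.ball (0 : ℂ) 1 \ {0}) := by
  rintro z ⟨hz, h0⟩
  have h1 : Metric.ball (0 : ℂ) 1 \ {0} = Metric.ball 0 1 ∩ {0}ᶜ := rfl
  rw [h1]
  refine (isOpen_compl_singleton (x := (0 : ℂ))).closure_inter ?_
  exact ⟨by rwa [closure_ball _ one_ne_zero], h0⟩

namespace IsExteriorMap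

variable {ψ : ℂ → ℂ} {X : Set ℂ} (h : IsExteriorMap ψ X)
include h

theorem exists_tendsto_boundary (hX : IsCompact X) [LocallyConnectedSpace X]
    (hXc : ∀ p ∉ X, ∀ q ∉ X, q ∈ connectedComponentIn Xᶜ p) {z : ℂ}
    (hz : z ∈ Metric.closedBall (0 : ℂ) 1 \ {0}) :
    ∃ y, Tendsto ψ (𝓝[Metric.ball 0 1 \ {0}] z) (𝓝 y) := by
  by_cases hz1 : z ∈ Metric.ball (0 : ℂ) 1 \ {0}
  · exact ⟨_, h.differentiableOn.continuousOn z hz1⟩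
  have hzn : ‖z‖ = 1 := by
    refine le_antisymm (mem_closedBall_zero_iff.1 hz.1) (not_lt.1 fun hlt => hz1 ?_)
    exact ⟨mem_ball_zero_iff.2 hlt, hz.2⟩
  have : (𝓝[Metric.ball 0 1 \ {0}] z).NeBot :=
    mem_closure_iff_nhdsWithin_neBot.1 (closedBall_diff_subset_closure hz)
  apply cauchy_map_iff_exists_tendsto.1
  rw [Metric.cauchy_iff]
  refine ⟨inferInstance, fun ε hε => ?_⟩
  obtain ⟨r, hr, c, H⟩ := h.exists_small_image hX hXc hzn (ε := ε / 4) (by positivity)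
  refine ⟨ψ '' ((Metric.ball 0 1 \ {0}) ∩ Metric.ball z r), image_mem_map
    (inter_mem self_mem_nhdsWithin (mem_nhdsWithin_of_mem_nhds (Metric.ball_mem_nhds _ hr))), ?_⟩
  rintro _ ⟨x, hx, rfl⟩ _ ⟨y, hy, rfl⟩
  have h1 := H x hx
  have h2 := H y hy
  rw [Metric.mem_closedBall] at h1 h2
  have := dist_triangle_right (ψ x) (ψ y) c
  linarith

theorem continuousOn_extBdry (hX : IsCompact X) [LocallyConnectedSpace X]
    (hXc : ∀ p ∉ X, ∀ q ∉ X, q ∈ connectedComponentIn Xᶜ p) :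
    ContinuousOn (extBdry ψ) (Metric.closedBall 0 1 \ {0}) :=
  continuousOn_extendFrom closedBall_diff_subset_closure
    fun _ hz => h.exists_tendsto_boundary hX hXc hz

theorem extBdry_eq {z : ℂ} (hz : z ∈ Metric.ball (0 : ℂ) 1 \ {0}) : extBdry ψ z = ψ z :=
  extendFrom_eq (subset_closure hz) (h.differentiableOn.continuousOn z hz)

theorem extBdry_mem (hX : IsCompact X) [LocallyConnectedSpace X]
    (hXc : ∀ p ∉ X, ∀ q ∉ X, q ∈ connectedComponentIn Xᶜ p) {z : ℂ} (hz : ‖z‖ = 1) :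
    extBdry ψ z ∈ X := by
  by_contra hcon
  have hzm : z ∈ Metric.closedBall (0 : ℂ) 1 \ {0} :=
    ⟨mem_closedBall_zero_iff.2 hz.le, norm_pos_iff.1 (by rw [hz]; exact one_pos)⟩
  have hne : (𝓝[Metric.ball 0 1 \ {0}] z).NeBot :=
    mem_closure_iff_nhdsWithin_neBot.1 (closedBall_diff_subset_closure hzm)
  have h1 : Tendsto ψ (𝓝[Metric.ball 0 1 \ {0}] z) (𝓝 (extBdry ψ z)) :=
    tendsto_extendFrom (h.exists_tendsto_boundary hX hXc hzm)
  have h2 : Tendsto (extInv ψ) (𝓝 (extBdry ψ z)) (𝓝 (extInv ψ (extBdry ψ z))) :=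
    h.continuousOn_extInv.continuousAt (hX.isClosed.isOpen_compl.mem_nhds hcon)
  have h3 : Tendsto (fun x => x) (𝓝[Metric.ball 0 1 \ {0}] z) (𝓝 (extInv ψ (extBdry ψ z))) :=
    (h2.comp h1).congr' (eventually_nhdsWithin_of_forall fun x hx => h.extInv_apply hx)
  have h4 := tendsto_nhds_unique h3 (tendsto_id.mono_left nhdsWithin_le_nhds)
  have h5 := mem_ball_zero_iff.1 (h.extInv_mem hcon).1
  rw [h4] at h5
  exact h5.ne hz

end IsExteriorMap

end

section

open Filter

/-- A uniformization of the complement of `X` by the upper half-plane modulo `2π`, continuous up to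
the boundary. -/
structure IsUnif (Φ : ℂ → ℂ) (X : Set ℂ) : Prop where
  cont : ContinuousOn Φ {w | 0 ≤ w.im}
  diff : DifferentiableOn ℂ Φ {w | 0 < w.im}
  periodic : ∀ w, Φ (w + 2 * Real.pi) = Φ w
  inj : ∀ w w', 0 < w.im → 0 < w'.im → Φ w = Φ w' → ∃ n : ℤ, w = w' + n * (2 * Real.pi)
  notMem : ∀ w, 0 < w.im → Φ w ∉ X
  mem : ∀ w, w.im = 0 → Φ w ∈ X
  surj : ∀ p ∉ X, ∃ w, 0 < w.im ∧ Φ w = p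
  large : ∀ R : ℝ, ∃ M > 0, ∀ w, M < w.im → R < ‖Φ w‖

theorem norm_exp_I_mul (w : ℂ) : ‖Complex.exp (Complex.I * w)‖ = Real.exp (-w.im) := by
  rw [Complex.norm_exp]; simp

theorem exp_I_mul_mem_punctured {w : ℂ} (hw : 0 < w.im) :
    Complex.exp (Complex.I * w) ∈ Metric.ball (0 : ℂ) 1 \ {0} := by
  refine ⟨?_, Complex.exp_ne_zero _⟩
  rw [mem_ball_zero_iff, norm_exp_I_mul, Real.exp_lt_one_iff]; linarith

theorem exp_I_mul_eq_iff {w w' : ℂ} : Complex.exp (Complex.I * w) = Complex.exp (Complex.I * w') ↔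
    ∃ n : ℤ, w = w' + n * (2 * Real.pi) := by
  rw [Complex.exp_eq_exp_iff_exists_int]
  refine exists_congr fun n => ⟨fun h => ?_, fun h => ?_⟩
  · apply mul_left_cancel₀ Complex.I_ne_zero
    rw [h]; ring
  · rw [h]; ring

theorem IsExteriorMap.isUnif {ψ : ℂ → ℂ} {X : Set ℂ} (h : IsExteriorMap ψ X) (hX : IsCompact X)
    [LocallyConnectedSpace X] (hXc : ∀ p ∉ X, ∀ q ∉ X, q ∈ connectedComponentIn Xᶜ p) :
    IsUnif (fun w => extBdry ψ (Complex.exp (Complex.I * w))) X where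
  cont := by
    refine (h.continuousOn_extBdry hX hXc).comp (by fun_prop) fun w hw => ?_
    refine ⟨?_, Complex.exp_ne_zero _⟩
    rw [mem_closedBall_zero_iff, norm_exp_I_mul, Real.exp_le_one_iff]
    exact neg_nonpos.2 hw
  diff := by
    have h1 : DifferentiableOn ℂ (fun w => ψ (Complex.exp (Complex.I * w))) {w | 0 < w.im} :=
      h.differentiableOn.comp (by fun_prop) fun w hw => exp_I_mul_mem_punctured hw
    exact h1.congr fun w hw => h.extBdry_eq (exp_I_mul_mem_punctured hw)
  periodic := fun w => by
    have : Complex.exp (Complex.I * (w + 2 * Real.pi)) = Complex.exp (Complex.I * w) :=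
      exp_I_mul_eq_iff.2 ⟨1, by push_cast; ring⟩
    simp only [this]
  inj := fun w w' hw hw' hww => by
    have h1 := exp_I_mul_mem_punctured hw
    have h2 := exp_I_mul_mem_punctured hw'
    simp only [h.extBdry_eq h1, h.extBdry_eq h2] at hww
    exact exp_I_mul_eq_iff.1 (h.injOn h1 h2 hww)
  notMem := fun w hw => by
    simp only [h.extBdry_eq (exp_I_mul_mem_punctured hw)]
    exact h.apply_notMem (exp_I_mul_mem_punctured hw)
  mem := fun w hw => h.extBdry_mem hX hXc (by rw [norm_exp_I_mul, hw]; simp)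
  surj := fun p hp => by
    have hm := h.extInv_mem hp
    refine ⟨-Complex.I * Complex.log (extInv ψ p), ?_, ?_⟩
    · have : (-Complex.I * Complex.log (extInv ψ p)).im = -Real.log ‖extInv ψ p‖ := by
        simp [Complex.log_re]
      rw [this, neg_pos]
      exact Real.log_neg (norm_pos_iff.2 hm.2) (mem_ball_zero_iff.1 hm.1)
    · have : Complex.I * (-Complex.I * Complex.log (extInv ψ p)) = Complex.log (extInv ψ p) := by
        rw [← mul_assoc, mul_neg, Complex.I_mul_I, neg_neg, one_mul]
      simp only [this, Complex.exp_log hm.2]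
      rw [h.extBdry_eq hm, h.apply_extInv hp]
  large := fun R => by
    have h1 := h.tendsto.eventually (tendsto_norm_cobounded_atTop.eventually_gt_atTop R)
    rw [eventually_nhdsWithin_iff, Metric.eventually_nhds_iff] at h1
    obtain ⟨ε, hε, H⟩ := h1
    refine ⟨max 1 (-Real.log ε), lt_max_of_lt_left one_pos, fun w hw => ?_⟩
    have hw0 : 0 < w.im := one_pos.trans ((le_max_left _ _).trans_lt hw)
    simp only [h.extBdry_eq (exp_I_mul_mem_punctured hw0)]
    refine H ?_ (Complex.exp_ne_zero _)
    rw [dist_zero_right, norm_exp_I_mul, ← Real.lt_log_iff_exp_lt hε]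
    linarith [(le_max_right (1 : ℝ) (-Real.log ε)).trans_lt hw]

namespace IsUnif

variable {Φ : ℂ → ℂ} {X : Set ℂ} (h : IsUnif Φ X)
include h

theorem periodic_int (w : ℂ) (n : ℤ) : Φ (w + n * (2 * Real.pi)) = Φ w := by
  have h1 : Function.Periodic Φ (2 * Real.pi) := h.periodic
  exact h1.int_mul n w

theorem continuous_bdry : Continuous fun t : ℝ => Φ t := by
  rw [← continuousOn_univ]
  exact h.cont.comp Complex.continuous_ofReal.continuousOn fun t _ => by simp

theorem bdry_periodic (t : ℝ) : Φ ((t + 2 * Real.pi : ℝ) : ℂ) = Φ t := by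
  have := h.periodic t
  push_cast; exact this

theorem exists_bdry_of_mem_closure {a : ℂ} (ha : a ∈ X) (hac : a ∈ closure Xᶜ) :
    ∃ t : ℝ, Φ t = a := by
  obtain ⟨M, hM, H⟩ := h.large (‖a‖ + 1)
  have hK : IsCompact (Φ '' (Icc 0 (2 * Real.pi) ×ℂ Icc 0 M)) :=
    (isCompact_Icc.reProdIm isCompact_Icc).image_of_continuousOn
      (h.cont.mono fun w hw => hw.2.1)
  have hsub : Metric.ball a 1 ∩ Xᶜ ⊆ Φ '' (Icc 0 (2 * Real.pi) ×ℂ Icc 0 M) := by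
    rintro p ⟨hpa, hpX⟩
    obtain ⟨w, hw, rfl⟩ := h.surj p hpX
    obtain ⟨n, hn, -⟩ := existsUnique_add_zsmul_mem_Ico Real.two_pi_pos w.re 0
    have hre : (w + n * (2 * Real.pi)).re = w.re + n • (2 * Real.pi) := by simp
    have him : (w + n * (2 * Real.pi)).im = w.im := by simp
    refine ⟨w + n * (2 * Real.pi), ⟨?_, ?_⟩, h.periodic_int w n⟩
    · rw [mem_preimage, hre]
      rw [zero_add] at hn
      exact Ico_subset_Icc_self hn
    · rw [mem_preimage, him]
      refine ⟨hw.le, not_lt.1 fun hMw => ?_⟩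
      have h1 := H w hMw
      rw [Metric.mem_ball, dist_eq_norm] at hpa
      have := norm_sub_norm_le (Φ w) a
      linarith
  have h2 : a ∈ closure (Metric.ball a 1 ∩ Xᶜ) :=
    Metric.isOpen_ball.inter_closure ⟨Metric.mem_ball_self one_pos, hac⟩
  obtain ⟨w, hw, rfl⟩ := closure_minimal hsub hK.isClosed h2
  have him : w.im = 0 := by
    rcases hw.2.1.eq_or_lt with h0 | h0
    · exact h0.symm
    · exact absurd ha (h.notMem w h0)
  exact ⟨w.re, by congr 1; apply Complex.ext <;> simp [him]⟩

theorem not_const_on_Icc {a b : ℝ} (hab : a < b) {x : ℂ} : ∃ t ∈ Icc a b, Φ t ≠ x := by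
  by_contra! hc
  set l := (b - a) / 2 with hl
  have hl0 : 0 < l := by simp only [hl]; linarith
  set m : ℂ := ((a + b) / 2 : ℝ) + l * Complex.I
  have hmre : m.re = (a + b) / 2 := by simp [m]
  have hmim : m.im = l := by simp [m]
  set U : Set ℂ := Ioo (-l) l ×ℂ Ioo (-l) l
  set F : ℂ → ℂ := fun z => Φ (m + z) - x
  have hcl : closure U = Icc (-l) l ×ℂ Icc (-l) l := by
    rw [Complex.closure_reProdIm, closure_Ioo (by linarith)]
  have hFc : ContinuousOn F (closure U) := by
    rw [hcl]
    refine ContinuousOn.sub (h.cont.comp (by fun_prop) fun z hz => ?_) continuousOn_const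
    have := hz.2.1
    show 0 ≤ (m + z).im
    rw [Complex.add_im, hmim]; linarith
  have hFd : DifferentiableOn ℂ F U := by
    refine DifferentiableOn.sub (h.diff.comp (by fun_prop) fun z hz => ?_)
      (differentiableOn_const _)
    have := hz.2.1
    show 0 < (m + z).im
    rw [Complex.add_im, hmim]; linarith
  have hU : IsOpen U := isOpen_Ioo.reProdIm isOpen_Ioo
  have hF0 : ∀ z : ℂ, z.re ∈ Icc (-l) l → z.im = -l → F z = 0 := by
    intro z hz hzi
    have : m + z = ((a + b) / 2 + z.re : ℝ) := by
      apply Complex.ext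
      · simp [hmre]
      · simp [hmim, hzi]
    simp only [F, this, sub_eq_zero]
    refine hc _ ⟨?_, ?_⟩ <;> linarith [hz.1, hz.2]
  have hrot : ∀ z ∈ U, Complex.I * z ∈ U := by
    intro z hz
    refine ⟨?_, ?_⟩
    · have := hz.2
      simp only [mem_preimage, Complex.I_mul_re, mem_Ioo] at this ⊢
      constructor <;> linarith
    · have := hz.1
      simpa using this
  have hrotc : ∀ z ∈ closure U, Complex.I * z ∈ closure U := by
    intro z hz
    exact map_mem_closure (f := fun z => Complex.I * z) (by fun_prop) hz hrot
  have D0 : DiffContOnCl ℂ F U := ⟨hFd, hFc⟩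
  have step : ∀ G : ℂ → ℂ, DiffContOnCl ℂ G U → DiffContOnCl ℂ (fun z => G (Complex.I * z)) U := by
    intro G hG
    exact ⟨hG.1.comp (by fun_prop) hrot, hG.2.comp (by fun_prop) hrotc⟩
  have D1 := step _ D0
  have D2 := step _ D1
  have D3 := step _ D2
  have D : DiffContOnCl ℂ (fun z => F z * F (Complex.I * z) * F (Complex.I * (Complex.I * z)) *
      F (Complex.I * (Complex.I * (Complex.I * z)))) U :=
    ⟨((hFd.fun_mul D1.1).fun_mul D2.1).fun_mul D3.1,
      ((hFc.mul D1.2).mul D2.2).mul D3.2⟩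
  have hbd : Bornology.IsBounded U :=
    (Metric.isBounded_Ioo _ _).reProdIm (Metric.isBounded_Ioo _ _)
  have key := Complex.norm_le_of_forall_mem_frontier_norm_le hbd D (C := 0) (fun z hz => ?_)
    (z := 0) (subset_closure ⟨by simp [hl0], by simp [hl0]⟩)
  · simp only [mul_zero] at key
    have h0 : F 0 = 0 := by
      have := norm_le_zero_iff.1 key
      simpa using this
    have hxm : Φ m = x := by simpa [F, sub_eq_zero] using h0
    have h3 : Φ ((a : ℝ) : ℂ) = x := hc a ⟨le_rfl, hab.le⟩
    refine h.notMem m (by rw [hmim]; exact hl0) ?_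
    rw [hxm, ← h3]
    exact h.mem _ (by simp)
  · rw [Complex.frontier_reProdIm, closure_Ioo (by linarith), frontier_Ioo (by linarith)] at hz
    rw [norm_le_zero_iff]
    simp only [mul_eq_zero]
    rcases hz with ⟨hre, him⟩ | ⟨hre, him⟩
    · rcases him with him | him
      · left; left; left; exact hF0 z hre him
      · left; right
        refine hF0 _ ?_ ?_
        · have := hre
          simp only [mem_preimage, mem_Icc, Complex.I_mul_re, Complex.I_mul_im] at this ⊢
          constructor <;> linarith
        · simp only [Complex.I_mul_im, Complex.I_mul_re]; rw [show z.im = l from him]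
    · rcases hre with hre | hre
      · left; left; right
        refine hF0 _ ?_ ?_
        · have := him
          simp only [mem_preimage, mem_Icc, Complex.I_mul_re] at this ⊢
          constructor <;> linarith
        · simp only [Complex.I_mul_im]; exact hre
      · right
        refine hF0 _ ?_ ?_
        · have := him
          simp only [mem_preimage, mem_Icc, Complex.I_mul_re, Complex.I_mul_im] at this ⊢
          constructor <;> linarith
        · simp only [Complex.I_mul_im, Complex.I_mul_re]; rw [show z.re = l from hre]

end IsUnif

end

section

open Filter

namespace IsUnif

variable {Φ : ℂ → ℂ} {X : Set ℂ} (h : IsUnif Φ X)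
include h

theorem isOpen_image {V : Set ℂ} (hV : IsOpen V) (hV0 : V ⊆ {w | 0 < w.im}) :
    IsOpen (Φ '' V) := by
  rw [isOpen_iff_mem_nhds]
  rintro _ ⟨w, hw, rfl⟩
  obtain ⟨ε, hε, hεV⟩ := Metric.isOpen_iff.1 hV w hw
  set C := Metric.ball w (min ε 1)
  have hCV : C ⊆ V := (Metric.ball_subset_ball (min_le_left _ _)).trans hεV
  have hinj : InjOn Φ C := by
    intro z hz z' hz' hzz
    obtain ⟨n, hn⟩ := h.inj z z' (hV0 (hCV hz)) (hV0 (hCV hz')) hzz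
    have h1 : dist z z' < 2 := by
      have h1 := (Metric.mem_ball.1 hz).trans_le (min_le_right _ _)
      have h2 := (Metric.mem_ball.1 hz').trans_le (min_le_right _ _)
      linarith [dist_triangle_right z z' w]
    rw [hn, dist_eq_norm, add_sub_cancel_left, norm_mul] at h1
    have h2 : ‖(2 * Real.pi : ℂ)‖ = 2 * Real.pi := by
      rw [norm_mul, Complex.norm_real, Real.norm_eq_abs, abs_of_pos Real.pi_pos]; simp
    rw [h2, Complex.norm_intCast] at h1
    have hn0 : n = 0 := by
      by_contra hn0
      have : (1 : ℝ) ≤ |(n : ℝ)| := by exact_mod_cast Int.one_le_abs hn0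
      nlinarith [Real.pi_gt_three]
    rw [hn, hn0]; simp
  have := isOpen_image_of_injOn Metric.isOpen_ball (convex_ball w _).isPreconnected
    (h.diff.mono (hCV.trans hV0)) hinj subset_rfl Metric.isOpen_ball
  exact mem_of_superset (this.mem_nhds ⟨w, Metric.mem_ball_self (lt_min hε one_pos), rfl⟩)
    (image_mono hCV)

theorem bdry_no_crossing (hX : IsCompact X)
    (hXc : ∀ p ∉ X, ∀ q ∉ X, q ∈ connectedComponentIn Xᶜ p) {a b t t' : ℝ} {x : ℂ} {N : Set ℂ}
    (ha : Φ a = x) (hb : Φ b = x) (ht : t ∈ Ioo a b) (ht' : t' ∈ Ioo b (a + 2 * Real.pi))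
    (hN : IsPreconnected N) (hNX : N ⊆ X) (hxN : x ∉ N) (htN : Φ t ∈ N) (ht'N : Φ t' ∈ N) :
    False := by
  have hpos := Real.pi_pos
  set W₀ : Set ℂ := Ioo a b ×ℂ Ioo 0 1
  set R₀ : Set ℂ := Icc a b ×ℂ Icc 0 1
  set K : Set ℂ := ({a} ×ℂ Icc 0 1 ∪ Icc a b ×ℂ {1}) ∪ {b} ×ℂ Icc 0 1
  set C := Φ '' K
  have hab : a ≤ b := (ht.1.trans ht.2).le
  have hK0 : K ⊆ {w | 0 ≤ w.im} := by
    rintro w ((⟨-, hw⟩ | ⟨-, hw⟩) | ⟨-, hw⟩)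
    · exact hw.1
    · have : w.im = 1 := hw
      simp [this]
    · exact hw.1
  have hKc : IsCompact K := ((isCompact_singleton.reProdIm isCompact_Icc).union
    (isCompact_Icc.reProdIm isCompact_singleton)).union
      (isCompact_singleton.reProdIm isCompact_Icc)
  have hCc : IsCompact C := hKc.image_of_continuousOn (h.cont.mono hK0)
  have hcb : ∀ w ∈ K, w.re ∈ Icc a b := by
    rintro w ((⟨hw, -⟩ | ⟨hw, -⟩) | ⟨hw, -⟩)
    · rw [show w.re = a from hw]; exact ⟨le_rfl, hab⟩
    · exact hw
    · rw [show w.re = b from hw]; exact ⟨hab, le_rfl⟩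
  have hCX : C ∩ X = {x} := by
    apply Subset.antisymm
    · rintro _ ⟨⟨w, hw, rfl⟩, hwX⟩
      have him : w.im = 0 := by
        rcases (show 0 ≤ w.im from hK0 hw).eq_or_lt with h0 | h0
        · exact h0.symm
        · exact absurd hwX (h.notMem w h0)
      have hwr : w = (w.re : ℂ) := by apply Complex.ext <;> simp [him]
      rcases hw with (⟨hw, -⟩ | ⟨-, hw⟩) | ⟨hw, -⟩
      · rw [hwr, show w.re = a from hw]; exact ha
      · exact absurd (him.symm.trans hw) zero_ne_one
      · rw [hwr, show w.re = b from hw]; exact hb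
    · rintro _ rfl
      refine ⟨⟨a, Or.inl (Or.inl ⟨by simp, by simp⟩), ha⟩, ?_⟩
      rw [← ha]; exact h.mem _ (by simp)
  have hW₀o : IsOpen W₀ := isOpen_Ioo.reProdIm isOpen_Ioo
  have hWo : IsOpen (Φ '' W₀) := h.isOpen_image hW₀o fun w hw => hw.2.1
  have hRc : IsCompact (Φ '' R₀) :=
    (isCompact_Icc.reProdIm isCompact_Icc).image_of_continuousOn (h.cont.mono fun w hw => hw.2.1)
  have hRW : Φ '' R₀ ⊆ Φ '' W₀ ∪ (C ∪ X) := by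
    rintro _ ⟨w, ⟨hre, him⟩, rfl⟩
    rcases him.1.eq_or_lt with h0 | h0
    · exact Or.inr (Or.inr (h.mem w h0.symm))
    rcases hre.1.eq_or_lt with h1 | h1
    · exact Or.inr (Or.inl ⟨w, Or.inl (Or.inl ⟨h1.symm, him⟩), rfl⟩)
    rcases hre.2.eq_or_lt with h2 | h2
    · exact Or.inr (Or.inl ⟨w, Or.inr ⟨h2, him⟩, rfl⟩)
    rcases him.2.eq_or_lt with h3 | h3
    · exact Or.inr (Or.inl ⟨w, Or.inl (Or.inr ⟨hre, h3⟩), rfl⟩)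
    exact Or.inl ⟨w, ⟨⟨h1, h2⟩, ⟨h0, h3⟩⟩, rfl⟩
  have hWcl : closure (Φ '' W₀) ⊆ Φ '' W₀ ∪ (C ∪ X) := by
    refine (closure_minimal (image_mono ?_) hRc.isClosed).trans hRW
    intro w hw
    exact ⟨Ioo_subset_Icc_self hw.1, Ioo_subset_Icc_self hw.2⟩
  have trapped : ∀ p ∈ Φ '' W₀, p ∉ C → ¬ Escapes (C ∪ X) p := by
    rintro p hp hpC hesc
    have hpX : p ∉ X := by
      obtain ⟨w, hw, rfl⟩ := hp
      exact h.notMem w hw.2.1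
    have hsub : connectedComponentIn (C ∪ X)ᶜ p ⊆ Φ '' W₀ := by
      refine isPreconnected_connectedComponentIn.subset_of_closure_inter_subset hWo
        ⟨p, mem_connectedComponentIn fun hm => hm.elim hpC hpX, hp⟩ ?_
      rintro y ⟨hy, hyc⟩
      exact (hWcl hy).resolve_right (connectedComponentIn_subset _ _ hyc)
    obtain ⟨R, hR⟩ := hRc.isBounded.subset_closedBall 0
    obtain ⟨y, hy, hyR⟩ := hesc R
    obtain ⟨w, hw, rfl⟩ := hsub hy
    have := hR ⟨w, ⟨Ioo_subset_Icc_self hw.1, Ioo_subset_Icc_self hw.2⟩, rfl⟩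
    rw [mem_closedBall_zero_iff] at this
    linarith
  have outer : ∀ s : ℝ, 0 < s → Escapes C (Φ (t' + s * Complex.I)) := by
    intro s hs R
    obtain ⟨M, hM, H⟩ := h.large R
    set L : Set ℂ := (fun y : ℝ => Φ (t' + y * Complex.I)) '' Ici s
    have hL : IsPreconnected L := by
      refine isPreconnected_Ici.image _ (h.cont.comp (by fun_prop) fun y hy => ?_)
      have : s ≤ y := hy
      simp; linarith
    have hLC : L ⊆ Cᶜ := by
      rintro _ ⟨y, hy, rfl⟩ ⟨w, hw, hwe⟩
      have hy0 : 0 < y := hs.trans_le hy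
      simp only at hwe
      have hy1 : 0 < (t' + y * Complex.I : ℂ).im := by simpa using hy0
      have hw0 : 0 < w.im := by
        rcases (show 0 ≤ w.im from hK0 hw).eq_or_lt with h0 | h0
        · exact absurd (hwe ▸ h.mem w h0.symm) (h.notMem _ hy1)
        · exact h0
      obtain ⟨n, hn⟩ := h.inj _ _ hw0 hy1 hwe
      have hre : w.re = t' + n * (2 * Real.pi) := by rw [hn]; simp
      have := hcb w hw
      rw [hre] at this
      have h1 : (n : ℝ) < 0 := by
        by_contra hc
        nlinarith [not_lt.1 hc, this.2, ht'.1]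
      have h2 : (-1 : ℝ) < n := by
        by_contra hc
        nlinarith [not_lt.1 hc, this.1, ht'.2]
      have h3 : n < 0 := by exact_mod_cast h1
      have h4 : -1 < n := by exact_mod_cast h2
      omega
    refine ⟨Φ (t' + (max s (M + 1) : ℝ) * Complex.I), ?_, H _ ?_⟩
    · exact hL.subset_connectedComponentIn ⟨s, mem_Ici.2 le_rfl, rfl⟩ hLC
        ⟨_, mem_Ici.2 (le_max_left _ _), rfl⟩
    · have := le_max_right s (M + 1)
      simp only [Complex.add_im, Complex.ofReal_im, Complex.mul_im, Complex.ofReal_re,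
        Complex.I_im, Complex.I_re, mul_one, mul_zero, add_zero, zero_add]
      linarith
  have hNC : N ⊆ Cᶜ := fun y hy hyC => by
    have : y ∈ C ∩ X := ⟨hyC, hNX hy⟩
    rw [hCX] at this
    exact hxN (this ▸ hy)
  have near : ∀ r : ℝ, Φ r ∈ N → ∃ s : ℝ, 0 < s ∧ s < 1 ∧ Φ (r + s * Complex.I) ∉ C ∧
      connectedComponentIn Cᶜ (Φ (r + s * Complex.I)) = connectedComponentIn Cᶜ (Φ r) := by
    intro r hr
    obtain ⟨ε, hε, hεC⟩ := Metric.isOpen_iff.1 hCc.isClosed.isOpen_compl _ (hNC hr)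
    have hc : ContinuousWithinAt (fun s : ℝ => Φ (r + s * Complex.I)) (Ici 0) 0 :=
      (h.cont.comp (f := fun s : ℝ => (r + s * Complex.I : ℂ)) (s := Ici 0) (by fun_prop)
        (fun s hs => by simpa using hs)) 0 (mem_Ici.2 le_rfl)
    have h1 : ∀ᶠ s : ℝ in 𝓝[>] 0, Φ (r + s * Complex.I) ∈ Metric.ball (Φ r) ε := by
      have := hc.mono Ioi_subset_Ici_self
      rw [ContinuousWithinAt] at this
      simp only [Complex.ofReal_zero, zero_mul, add_zero] at this
      exact this (Metric.ball_mem_nhds _ hε)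
    have h2 : ∀ᶠ s : ℝ in 𝓝[>] 0, s ∈ Ioo (0 : ℝ) 1 := Ioo_mem_nhdsGT one_pos
    obtain ⟨s, hs, hs1⟩ := (h1.and h2).exists
    refine ⟨s, hs1.1, hs1.2, hεC hs, ?_⟩
    exact (connectedComponentIn_eq ((convex_ball _ _).isPreconnected.subset_connectedComponentIn
      hs hεC (Metric.mem_ball_self hε)))
  obtain ⟨s, hs, hs1, hsC, hse⟩ := near t htN
  obtain ⟨s', hs', -, -, hse'⟩ := near t' ht'N
  have hNe : connectedComponentIn Cᶜ (Φ t) = connectedComponentIn Cᶜ (Φ t') :=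
    connectedComponentIn_eq (hN.subset_connectedComponentIn htN hNC ht'N)
  have hCe : Escapes C (Φ (t + s * Complex.I)) := by
    intro R
    rw [hse, hNe, ← hse']
    exact outer s' hs' R
  have hpX : Φ (t + s * Complex.I) ∉ X := h.notMem _ (by simpa using hs)
  refine trapped _ ⟨_, ⟨?_, ?_⟩, rfl⟩ hsC (janiszewski_escapes hCc hX
    (by rw [hCX]; exact isPreconnected_singleton) hCe (escapes_of_compl hX hXc hpX))
  · simpa using ht
  · simpa using And.intro hs hs1

end IsUnif

end

section

open Filter

theorem continuousOn_invFunOn_of_isCompact {α Y : Type*} [TopologicalSpace α] [TopologicalSpace Y]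
    [Nonempty α] [T2Space Y] {f : α → Y} {K : Set α} (hK : IsCompact K)
    (hf : ContinuousOn f K) (hinj : InjOn f K) :
    ContinuousOn (Function.invFunOn f K) (f '' K) := by
  rw [continuousOn_iff_isClosed]
  intro t ht
  refine ⟨f '' (K ∩ t), ((hK.inter_right ht).image_of_continuousOn
    (hf.mono inter_subset_left)).isClosed, ?_⟩
  ext y; constructor
  · rintro ⟨hy, x, hx, rfl⟩
    rw [mem_preimage, hinj.leftInvOn_invFunOn hx] at hy
    exact ⟨⟨x, ⟨hx, hy⟩, rfl⟩, x, hx, rfl⟩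
  · rintro ⟨⟨x, ⟨hx, hxt⟩, rfl⟩, hy⟩
    refine ⟨?_, hy⟩
    rwa [mem_preimage, hinj.leftInvOn_invFunOn hx]

theorem StrictMonoOn.exists_inverse {w : ℝ → ℝ} {a b : ℝ} (hab : a ≤ b)
    (hw : StrictMonoOn w (Icc a b)) (hc : ContinuousOn w (Icc a b)) :
    ∃ v : ℝ → ℝ, StrictMonoOn v (Icc (w a) (w b)) ∧ ContinuousOn v (Icc (w a) (w b)) ∧
      (∀ x ∈ Icc (w a) (w b), v x ∈ Icc a b ∧ w (v x) = x) ∧ v (w a) = a ∧ v (w b) = b := by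
  have him : w '' Icc a b = Icc (w a) (w b) := by
    apply Subset.antisymm
    · rintro _ ⟨x, hx, rfl⟩
      exact ⟨hw.monotoneOn ⟨le_rfl, hab⟩ hx hx.1, hw.monotoneOn hx ⟨hab, le_rfl⟩ hx.2⟩
    · exact intermediate_value_Icc hab hc
  have hv : ∀ x ∈ Icc (w a) (w b), Function.invFunOn w (Icc a b) x ∈ Icc a b ∧
      w (Function.invFunOn w (Icc a b) x) = x := fun x hx =>
    ⟨Function.invFunOn_mem (him.ge hx), Function.invFunOn_eq (him.ge hx)⟩
  refine ⟨Function.invFunOn w (Icc a b), ?_, ?_, hv, ?_, ?_⟩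
  · intro x hx y hy hxy
    by_contra hcon
    have := hw.monotoneOn (hv y hy).1 (hv x hx).1 (not_lt.1 hcon)
    rw [(hv x hx).2, (hv y hy).2] at this
    exact absurd this (not_le.2 hxy)
  · rw [← him]; exact continuousOn_invFunOn_of_isCompact isCompact_Icc hc hw.injOn
  · exact hw.injOn.leftInvOn_invFunOn ⟨le_rfl, hab⟩
  · exact hw.injOn.leftInvOn_invFunOn ⟨hab, le_rfl⟩

/-- The tent function on the unit interval. -/
def tent (x : ℝ) : ℝ := 1 - |2 * x - 1|

theorem tent_mem {x : ℝ} (hx : x ∈ Icc (0 : ℝ) 1) : tent x ∈ Icc (0 : ℝ) 1 := by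
  have : |2 * x - 1| ≤ 1 := abs_le.2 ⟨by linarith [hx.1], by linarith [hx.2]⟩
  exact ⟨by unfold tent; linarith, by unfold tent; linarith [abs_nonneg (2 * x - 1)]⟩

/-- A closed curve traversing a star without crossing itself. -/
structure IsTrace {Y : Type*} [TopologicalSpace Y] (β : ℝ → Y) (g : Fin 4 → ℝ → Y) (q : Y)
    (T : ℝ) : Prop where
  pos : 0 < T
  star : IsStar g q
  cont : Continuous β
  per : ∀ t, β (t + T) = β t
  mem : ∀ t, β t ∈ starSet g
  surj : ∀ y ∈ starSet g, ∃ t, β t = y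
  nonconst : ∀ a b x, a < b → ∃ t ∈ Icc a b, β t ≠ x
  noncross : ∀ a b t t' x N, β a = x → β b = x → t ∈ Ioo a b → t' ∈ Ioo b (a + T) →
    IsPreconnected N → N ⊆ starSet g → x ∉ N → β t ∈ N → β t' ∈ N → False

namespace IsStar

variable {Y : Type*} [TopologicalSpace Y] {g : Fin 4 → ℝ → Y} {q : Y}

theorem isPreconnected_outer (h : IsStar g q) (i : Fin 4) {v : ℝ} (hv : 0 ≤ v) :
    IsPreconnected (g i '' Ioc v 1) :=
  isPreconnected_Ioc.image _ ((h.cont i).mono fun _ hx => ⟨hv.trans hx.1.le, hx.2⟩)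

theorem isPreconnected_inner (h : IsStar g q) (i : Fin 4) {v : ℝ} (hv : 0 < v) :
    IsPreconnected (starSet g \ g i '' Icc v 1) := by
  have : starSet g \ g i '' Icc v 1 = ⋃ j, g j '' {s | s ∈ Icc 0 1 ∧ (j = i → s < v)} := by
    ext y
    simp only [starSet, Set.mem_sdiff, mem_iUnion, mem_image, not_exists, not_and]
    constructor
    · rintro ⟨⟨j, s, hs, rfl⟩, hy⟩
      refine ⟨j, s, ⟨hs, ?_⟩, rfl⟩
      rintro rfl
      by_contra hc
      exact hy s ⟨not_lt.1 hc, hs.2⟩ rfl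
    · rintro ⟨j, s, ⟨hs, hsv⟩, rfl⟩
      refine ⟨⟨j, s, hs, rfl⟩, fun s' hs' he => ?_⟩
      obtain ⟨rfl, h2⟩ := h.inj i j s' s ⟨hv.le.trans hs'.1, hs'.2⟩ hs he
      rcases h2 with rfl | h2
      · exact (hsv rfl).not_ge hs'.1
      · linarith [hs'.1]
  rw [this]
  refine isPreconnected_iUnion ⟨q, mem_iInter.2 fun j => ⟨0, ⟨by simp, fun _ => hv⟩, h.zero j⟩⟩ ?_
  intro j
  refine IsPreconnected.image ?_ _ ((h.cont j).mono fun s hs => hs.1)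
  apply OrdConnected.isPreconnected
  refine ⟨fun x hx y hy z hz => ⟨⟨hx.1.1.trans hz.1, hz.2.trans hy.1.2⟩, fun hj => ?_⟩⟩
  exact hz.2.trans_lt (hy.2 hj)

theorem ne_center (h : IsStar g q) {i : Fin 4} {s : ℝ} (hs : s ∈ Ioc (0 : ℝ) 1) : g i s ≠ q := by
  intro he
  rw [← h.zero i] at he
  have := (h.inj i i s 0 ⟨hs.1.le, hs.2⟩ (by simp) he).1
  exact hs.1.ne' this

end IsStar

namespace IsTrace

variable {Y : Type*} [TopologicalSpace Y] {β : ℝ → Y} {g : Fin 4 → ℝ → Y} {q : Y}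
  {T : ℝ} (h : IsTrace β g q T)
include h

theorem nonconst_Ioo {a b : ℝ} (x : Y) (hab : a < b) : ∃ t ∈ Ioo a b, β t ≠ x := by
  obtain ⟨t, ht, hx⟩ := h.nonconst (a + (b - a) / 3) (b - (b - a) / 3) x (by linarith)
  exact ⟨t, ⟨by linarith [ht.1], by linarith [ht.2]⟩, hx⟩

theorem per_int (t : ℝ) (n : ℤ) : β (t + n * T) = β t :=
  (show Function.Periodic β T from h.per).int_mul n t

theorem tip_unique {i : Fin 4} {a b : ℝ} (ha : β a = g i 1) (hb : β b = g i 1) (hab : a < b)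
    (hbT : b < a + T) : False := by
  obtain ⟨t, ht, hx⟩ := h.nonconst_Ioo (g i 1) hab
  obtain ⟨t', ht', hx'⟩ := h.nonconst_Ioo (g i 1) hbT
  have := h.star.isPreconnected_inner i one_pos
  rw [Icc_self, image_singleton] at this
  exact h.noncross a b t t' _ _ ha hb ht ht' this sdiff_subset (by simp) ⟨h.mem t, hx⟩
    ⟨h.mem t', hx'⟩

theorem level_unique {i : Fin 4} {t₁ t₂ τ b v : ℝ} (hv : v ∈ Ioo (0 : ℝ) 1) (h1 : β t₁ = g i v)
    (h2 : β t₂ = g i v) (h12 : t₁ < t₂) (hτ : τ ∈ Ioo t₂ (t₁ + T)) (hb : b ∈ Ioo t₂ (t₁ + T))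
    (hβτ : β τ = g i 1) (hβb : β b = q) : False := by
  obtain ⟨t, ht, hx⟩ := h.nonconst_Ioo (g i v) h12
  have hv01 : v ∈ Icc (0 : ℝ) 1 := Ioo_subset_Icc_self hv
  by_cases hN : β t ∈ g i '' Ioc v 1
  · refine h.noncross t₁ t₂ t τ _ _ h1 h2 ht hτ (h.star.isPreconnected_outer i hv.1.le) ?_ ?_ hN
      ⟨1, ⟨hv.2, le_rfl⟩, hβτ.symm⟩
    · refine (image_mono fun s hs => ?_).trans (subset_iUnion (fun i => g i '' Icc 0 1) i)
      exact ⟨hv.1.le.trans hs.1.le, hs.2⟩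
    · rintro ⟨s, hs, he⟩
      exact hs.1.ne' (h.star.inj i i s v ⟨hv.1.le.trans hs.1.le, hs.2⟩ hv01 he).1
  · refine h.noncross t₁ t₂ t b _ _ h1 h2 ht hb (h.star.isPreconnected_inner i hv.1) sdiff_subset
      (fun hm => hm.2 ⟨v, ⟨le_rfl, hv.2.le⟩, rfl⟩) ⟨h.mem t, ?_⟩ ⟨h.mem b, ?_⟩
    · rintro ⟨s, hs, he⟩
      rcases hs.1.eq_or_lt with rfl | h0
      · exact hx he.symm
      · exact hN ⟨s, ⟨h0, hs.2⟩, he⟩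
    · rintro ⟨s, hs, he⟩
      exact h.star.ne_center ⟨hv.1.trans_le hs.1, hs.2⟩ (he.trans hβb)

/-- Each arm is traversed up and down along one interval. -/
theorem exists_excursion [T2Space Y] (i : Fin 4) {τ : ℝ} (hτ : β τ = g i 1) :
    ∃ a b : ℝ, a < τ ∧ τ < b ∧ b ≤ a + T ∧ β a = q ∧ β b = q ∧ (∀ t ∈ Ioo a b, β t ≠ q) ∧
    ∃ v : ℝ → ℝ, StrictMonoOn v (Icc 0 1) ∧ ContinuousOn v (Icc 0 1) ∧ v 0 = a ∧ v 1 = b ∧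
      ∀ x ∈ Icc (0 : ℝ) 1, β (v x) = g i (tent x) := by
  have hT := h.pos
  have hτq : β τ ≠ q := hτ ▸ h.star.ne_center ⟨one_pos, le_rfl⟩
  obtain ⟨t₀, ht₀⟩ := h.surj q (mem_iUnion.2 ⟨0, h.star.center_mem 0⟩)
  have hcl : IsClosed {t | β t = q} := isClosed_eq h.cont continuous_const
  have hne : ∀ s, (Icc s (s + T) ∩ {t | β t = q}).Nonempty := fun s => by
    obtain ⟨n, hn, -⟩ := existsUnique_add_zsmul_mem_Ico hT t₀ s
    rw [zsmul_eq_mul] at hn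
    exact ⟨_, Ico_subset_Icc_self hn, (h.per_int t₀ n).trans ht₀⟩
  have hne1 := hne (τ - T)
  rw [sub_add_cancel] at hne1
  obtain ⟨a, ⟨haI, haq⟩, hamax⟩ := (isCompact_Icc.inter_right hcl).exists_isGreatest hne1
  obtain ⟨b, ⟨hbI, hbq⟩, hbmin⟩ := (isCompact_Icc.inter_right hcl).exists_isLeast (hne τ)
  have haq' : β a = q := haq
  have hbq' : β b = q := hbq
  have haτ : a < τ := haI.2.lt_of_ne fun he => hτq (he ▸ haq')
  have hτb : τ < b := hbI.1.lt_of_ne fun he => hτq (he ▸ hbq')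
  have hbT : b ≤ a + T := hbmin ⟨⟨by linarith [haI.1], by linarith⟩, (h.per a).trans haq⟩
  have hab : a < b := haτ.trans hτb
  have hq : ∀ t ∈ Ioo a b, β t ≠ q := by
    intro t ht he
    rcases le_total t τ with htτ | htτ
    · exact ht.1.not_ge (hamax ⟨⟨by linarith [haI.1, ht.1], htτ⟩, he⟩)
    · exact ht.2.not_ge (hbmin ⟨⟨htτ, by linarith [hbI.2, ht.2]⟩, he⟩)
  have harm : ∀ t ∈ Ioo a b, β t ∈ g i '' Icc 0 1 := by
    have hS : IsPreconnected (β '' Ioo a b) := isPreconnected_Ioo.image _ h.cont.continuousOn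
    have hA : IsClosed (g i '' Icc 0 1) := (h.star.isCompact_arm i).isClosed
    have hB : IsClosed (⋃ j ∈ ({i}ᶜ : Set (Fin 4)), g j '' Icc 0 1) :=
      (toFinite _).isClosed_biUnion fun j _ => (h.star.isCompact_arm j).isClosed
    have hdis : ∀ y, y ∈ g i '' Icc 0 1 → y ∈ (⋃ j ∈ ({i}ᶜ : Set (Fin 4)), g j '' Icc 0 1) →
        y = q := by
      rintro _ ⟨s, hs, rfl⟩ hy
      simp only [mem_iUnion] at hy
      obtain ⟨j, hj, s', hs', he⟩ := hy
      obtain ⟨rfl, h1 | h1⟩ := h.star.inj j i s' s hs' hs he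
      · exact absurd h1 hj
      · rw [h1, h.star.zero]
    have := isPreconnected_iff_subset_of_disjoint_closed.1 hS _ _ hA hB ?_ ?_
    · rcases this with h1 | h1
      · exact fun t ht => h1 ⟨t, ht, rfl⟩
      · exact absurd (hdis (β τ) ⟨1, by simp, hτ.symm⟩ (h1 ⟨τ, ⟨haτ, hτb⟩, rfl⟩)) hτq
    · rintro _ ⟨t, ht, rfl⟩
      obtain ⟨j, hj⟩ := mem_iUnion.1 (h.mem t)
      by_cases hji : j = i
      · left; rwa [← hji]
      · right; exact mem_iUnion₂.2 ⟨j, hji, hj⟩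
    · rw [eq_empty_iff_forall_notMem]
      rintro _ ⟨⟨t, ht, rfl⟩, hy1, hy2⟩
      exact hq t ht (hdis _ hy1 hy2)
  have harm' : ∀ t ∈ Icc a b, β t ∈ g i '' Icc 0 1 := by
    intro t ht
    rcases ht.1.eq_or_lt with rfl | h1
    · exact ⟨0, by simp, (h.star.zero i).trans haq'.symm⟩
    rcases ht.2.eq_or_lt with rfl | h2
    · exact ⟨0, by simp, (h.star.zero i).trans hbq'.symm⟩
    exact harm t ⟨h1, h2⟩
  have hinj : InjOn (g i) (Icc 0 1) := h.star.injOn i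
  set u : ℝ → ℝ := fun t => Function.invFunOn (g i) (Icc 0 1) (β t) with hu
  have hu01 : ∀ t ∈ Icc a b, u t ∈ Icc (0 : ℝ) 1 := fun t ht => Function.invFunOn_mem (harm' t ht)
  have hgu : ∀ t ∈ Icc a b, g i (u t) = β t := fun t ht => Function.invFunOn_eq (harm' t ht)
  have huc : ContinuousOn u (Icc a b) :=
    (continuousOn_invFunOn_of_isCompact isCompact_Icc (h.star.cont i) hinj).comp
      h.cont.continuousOn harm'
  have huv : ∀ t ∈ Icc a b, ∀ s ∈ Icc (0 : ℝ) 1, β t = g i s → u t = s := fun t ht s hs he =>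
    hinj (hu01 t ht) hs ((hgu t ht).trans he)
  have hua : u a = 0 := huv a ⟨le_rfl, hab.le⟩ 0 (by simp) (haq'.trans (h.star.zero i).symm)
  have hub : u b = 0 := huv b ⟨hab.le, le_rfl⟩ 0 (by simp) (hbq'.trans (h.star.zero i).symm)
  have huτ : u τ = 1 := huv τ ⟨haτ.le, hτb.le⟩ 1 (by simp) hτ
  have hu0 : ∀ t ∈ Icc a b, u t = 0 → t = a ∨ t = b := by
    intro t ht h0
    have := hgu t ht
    rw [h0, h.star.zero] at this
    by_contra! hc
    exact hq t ⟨ht.1.lt_of_ne hc.1.symm, ht.2.lt_of_ne hc.2⟩ this.symm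
  have hu1 : ∀ t ∈ Icc a b, u t = 1 → t = τ := by
    intro t ht h1
    have h2 := hgu t ht
    rw [h1] at h2
    have : u t ≠ 0 := by rw [h1]; exact one_ne_zero
    have hta : a < t := ht.1.lt_of_ne fun he => this (he ▸ hua)
    have htb : t < b := ht.2.lt_of_ne fun he => this (he ▸ hub)
    rcases lt_trichotomy t τ with hlt | heq | hlt
    · exact (h.tip_unique h2.symm hτ hlt (by linarith)).elim
    · exact heq
    · exact (h.tip_unique hτ h2.symm hlt (by linarith)).elim
  have hL : StrictMonoOn u (Icc a τ) := by
    have hsub : Icc a τ ⊆ Icc a b := Icc_subset_Icc_right hτb.le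
    refine (huc.mono hsub).strictMonoOn_of_injOn_Icc haτ.le (by rw [hua, huτ]; exact zero_le_one) ?_
    have : ∀ t₁ ∈ Icc a τ, ∀ t₂ ∈ Icc a τ, u t₁ = u t₂ → t₁ < t₂ → False := by
      intro t₁ h1 t₂ h2 he hlt
      have hv0 : 0 < u t₁ := (hu01 _ (hsub h1)).1.lt_of_ne fun h0 => by
        rcases hu0 t₂ (hsub h2) (he ▸ h0.symm) with h3 | h3
        · linarith [h1.1]
        · linarith [h2.2]
      have hv1 : u t₁ < 1 := (hu01 _ (hsub h1)).2.lt_of_ne fun h0 => by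
        have := hu1 _ (hsub h1) h0
        linarith [h2.2]
      have hat : a < t₁ := h1.1.lt_of_ne fun h0 => by rw [← h0, hua] at hv0; exact hv0.false
      have htτ : t₂ < τ := h2.2.lt_of_ne fun h0 => by rw [he, h0, huτ] at hv1; exact hv1.false
      refine h.level_unique (i := i) (t₁ := t₁) (t₂ := t₂) (τ := τ) (b := b) ⟨hv0, hv1⟩
        (hgu _ (hsub h1)).symm ?_ hlt ⟨htτ, by linarith⟩ ⟨by linarith, by linarith⟩ hτ hbq'
      rw [he]; exact (hgu _ (hsub h2)).symm
    intro t₁ h1 t₂ h2 he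
    rcases lt_trichotomy t₁ t₂ with hlt | heq | hlt
    · exact (this _ h1 _ h2 he hlt).elim
    · exact heq
    · exact (this _ h2 _ h1 he.symm hlt).elim
  have hR : StrictAntiOn u (Icc τ b) := by
    have hsub : Icc τ b ⊆ Icc a b := Icc_subset_Icc_left haτ.le
    refine (huc.mono hsub).strictAntiOn_of_injOn_Icc hτb.le (by rw [hub, huτ]; exact zero_le_one) ?_
    have : ∀ t₁ ∈ Icc τ b, ∀ t₂ ∈ Icc τ b, u t₁ = u t₂ → t₁ < t₂ → False := by
      intro t₁ h1 t₂ h2 he hlt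
      have hv0 : 0 < u t₁ := (hu01 _ (hsub h1)).1.lt_of_ne fun h0 => by
        rcases hu0 t₁ (hsub h1) h0.symm with h3 | h3
        · linarith [h1.1]
        · linarith [h2.2]
      have hv1 : u t₁ < 1 := (hu01 _ (hsub h1)).2.lt_of_ne fun h0 => by
        have := hu1 _ (hsub h2) (he ▸ h0)
        linarith [h1.1]
      have htb : t₂ < b := h2.2.lt_of_ne fun h0 => by rw [he, h0, hub] at hv0; exact hv0.false
      have hτt : τ < t₁ := h1.1.lt_of_ne fun h0 => by rw [← h0, huτ] at hv1; exact hv1.false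
      refine h.level_unique (i := i) (t₁ := t₁) (t₂ := t₂) (τ := τ + T) (b := a + T) ⟨hv0, hv1⟩
        (hgu _ (hsub h1)).symm ?_ hlt ⟨by linarith, by linarith⟩ ⟨by linarith, by linarith⟩
        ((h.per τ).trans hτ) ((h.per a).trans haq')
      rw [he]; exact (hgu _ (hsub h2)).symm
    intro t₁ h1 t₂ h2 he
    rcases lt_trichotomy t₁ t₂ with hlt | heq | hlt
    · exact (this _ h1 _ h2 he hlt).elim
    · exact heq
    · exact (this _ h2 _ h1 he.symm hlt).elim
  set w : ℝ → ℝ := fun t => if t ≤ τ then u t / 2 else 1 - u t / 2 with hw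
  have hwL : EqOn w (fun t => u t / 2) (Icc a τ) := fun t ht => if_pos ht.2
  have hwR : EqOn w (fun t => 1 - u t / 2) (Icc τ b) := fun t ht => by
    rcases ht.1.eq_or_lt with rfl | h1
    · simp only [hw, le_refl, if_true, huτ]; norm_num
    · exact if_neg (not_le.2 h1)
  have hwm : StrictMonoOn w (Icc a b) := by
    rw [← Icc_union_Icc_eq_Icc haτ.le hτb.le]
    refine StrictMonoOn.union ?_ ?_ (isGreatest_Icc haτ.le) (isLeast_Icc hτb.le)
    · intro x hx y hy hxy
      rw [hwL hx, hwL hy]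
      have := hL hx hy hxy
      simp only; linarith
    · intro x hx y hy hxy
      rw [hwR hx, hwR hy]
      have := hR hx hy hxy
      simp only; linarith
  have hwc : ContinuousOn w (Icc a b) := by
    rw [← Icc_union_Icc_eq_Icc haτ.le hτb.le]
    refine ContinuousOn.union_of_isClosed ?_ ?_ isClosed_Icc isClosed_Icc
    · exact ContinuousOn.congr ((huc.mono (Icc_subset_Icc_right hτb.le)).div_const 2) hwL
    · exact ContinuousOn.congr (continuousOn_const.sub
        ((huc.mono (Icc_subset_Icc_left haτ.le)).div_const 2)) hwR
  have hwa : w a = 0 := by rw [hwL ⟨le_rfl, haτ.le⟩]; simp [hua]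
  have hwb : w b = 1 := by rw [hwR ⟨hτb.le, le_rfl⟩]; simp [hub]
  have htent : ∀ t ∈ Icc a b, tent (w t) = u t := by
    intro t ht
    have h01 := hu01 t ht
    rcases le_total t τ with htτ | htτ
    · rw [hwL ⟨ht.1, htτ⟩]
      simp only [tent]
      rw [abs_of_nonpos (by linarith [h01.2])]; ring
    · rw [hwR ⟨htτ, ht.2⟩]
      simp only [tent]
      rw [abs_of_nonneg (by linarith [h01.2])]; ring
  obtain ⟨v, hv1, hv2, hv3, hv4, hv5⟩ := hwm.exists_inverse hab.le hwc
  rw [hwa, hwb] at hv1 hv2 hv3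
  rw [hwa] at hv4
  rw [hwb] at hv5
  refine ⟨a, b, haτ, hτb, hbT, haq', hbq', hq, v, hv1, hv2, hv4, hv5, fun x hx => ?_⟩
  obtain ⟨h1, h2⟩ := hv3 x hx
  rw [← h2, htent _ h1, hgu _ h1, h2]

end IsTrace

end

section

open Filter

theorem exists_glue {v : Fin 4 → ℝ → ℝ} {A : Fin 4 → ℝ} {T : ℝ}
    (hm : ∀ k, StrictMonoOn (v k) (Icc 0 1)) (hc : ∀ k, ContinuousOn (v k) (Icc 0 1))
    (h0 : ∀ k, v k 0 = A k) (h01 : v 0 1 = A 1) (h12 : v 1 1 = A 2) (h23 : v 2 1 = A 3)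
    (h30 : v 3 1 = A 0 + T) :
    ∃ θ : ℝ → ℝ, StrictMonoOn θ (Icc 0 4) ∧ ContinuousOn θ (Icc 0 4) ∧ θ 4 = θ 0 + T ∧
      ∀ k : Fin 4, ∀ x ∈ Icc (0 : ℝ) 1, θ ((k : ℕ) + x) = v k x := by
  set p : ℝ → ℝ := fun x => max 0 (min 1 x)
  have hp : ∀ x, p x ∈ Icc (0 : ℝ) 1 := fun x =>
    ⟨le_max_left _ _, max_le zero_le_one (min_le_left _ _)⟩
  have hp0 : ∀ x, x ≤ 0 → p x = 0 := fun x hx => max_eq_left ((min_le_right _ _).trans hx)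
  have hp1 : ∀ x, 1 ≤ x → p x = 1 := fun x hx => by simp [p, hx]
  have hpx : ∀ x ∈ Icc (0 : ℝ) 1, p x = x := fun x hx => by simp [p, hx.1, hx.2]
  have hpm : Monotone p := fun x y hxy => max_le_max le_rfl (min_le_min le_rfl hxy)
  have hpc : Continuous p := by fun_prop
  set θ : ℝ → ℝ := fun s => A 0 + ∑ k : Fin 4, (v k (p (s - (k : ℕ))) - A k)
  have hexp : ∀ s, θ s = A 0 + ((v 0 (p s) - A 0) + (v 1 (p (s - 1)) - A 1) +
      (v 2 (p (s - 2)) - A 2) + (v 3 (p (s - 3)) - A 3)) := fun s => by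
    simp [θ, Fin.sum_univ_four]; ring
  have hθ : ∀ k : Fin 4, ∀ x ∈ Icc (0 : ℝ) 1, θ ((k : ℕ) + x) = v k x := by
    intro k x hx
    have hx0 := hx.1
    have hx1 := hx.2
    have := hpx x hx
    have e0 := h0 0
    have e1 := h0 1
    have e2 := h0 2
    have e3 := h0 3
    rw [hexp]
    fin_cases k
    · simp only [Fin.zero_eta, Nat.cast_zero, zero_add]
      rw [this, hp0 (x - 1) (by linarith), hp0 (x - 2) (by linarith), hp0 (x - 3) (by linarith)]
      linarith
    · simp only [Fin.mk_one, Nat.cast_one]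
      rw [hp1 (1 + x) (by linarith), show 1 + x - 1 = x by ring, this,
        hp0 (1 + x - 2) (by linarith), hp0 (1 + x - 3) (by linarith)]
      linarith
    · simp only [Fin.reduceFinMk, Nat.cast_ofNat]
      rw [hp1 (2 + x) (by linarith), hp1 (2 + x - 1) (by linarith), show 2 + x - 2 = x by ring,
        this, hp0 (2 + x - 3) (by linarith)]
      linarith
    · simp only [Fin.reduceFinMk, Nat.cast_ofNat]
      rw [hp1 (3 + x) (by linarith), hp1 (3 + x - 1) (by linarith), hp1 (3 + x - 2) (by linarith),
        show 3 + x - 3 = x by ring, this]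
      linarith
  refine ⟨θ, ?_, ?_, ?_, hθ⟩
  · intro s hs s' hs' hss
    refine add_lt_add_right (Finset.sum_lt_sum (fun k _ => ?_) ?_) _
    · exact sub_le_sub_right ((hm k).monotoneOn (hp _) (hp _) (hpm (by linarith))) _
    · have hs0 : ⌊s⌋ < 4 := Int.floor_lt.2 (by push_cast; exact hss.trans_le hs'.2)
      have hs1 : 0 ≤ ⌊s⌋ := Int.floor_nonneg.2 hs.1
      refine ⟨⟨⌊s⌋.toNat, by omega⟩, Finset.mem_univ _, sub_lt_sub_right (hm _ (hp _) (hp _) ?_) _⟩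
      have hcast : ((⌊s⌋.toNat : ℕ) : ℝ) = ⌊s⌋ := by
        exact_mod_cast Int.toNat_of_nonneg hs1
      simp only [hcast]
      have h1 := Int.floor_le s
      have h2 := Int.lt_floor_add_one s
      rw [hpx (s - ⌊s⌋) ⟨by linarith, by linarith⟩]
      exact lt_max_of_lt_right (lt_min (by linarith) (by linarith))
  · refine Continuous.continuousOn (continuous_const.add (continuous_finsetSum _ fun k _ => ?_))
    exact ((hc k).comp_continuous (by fun_prop) fun s => hp _).sub continuous_const
  · have h4 := hθ 3 1 (by simp)
    have h5 := hθ 0 0 (by simp)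
    have e4 : (((3 : Fin 4) : ℕ) : ℝ) + 1 = 4 := by norm_num
    have e5 : (((0 : Fin 4) : ℕ) : ℝ) + 0 = 0 := by norm_num
    rw [e4] at h4
    rw [e5] at h5
    rw [h4, h5, h30, h0]

theorem IsTrace.exists_param {Y : Type*} [TopologicalSpace Y] [T2Space Y] {β : ℝ → Y}
    {g : Fin 4 → ℝ → Y} {q : Y} {T : ℝ} (h : IsTrace β g q T) :
    ∃ (θ : ℝ → ℝ) (σ : Equiv.Perm (Fin 4)), StrictMonoOn θ (Icc 0 4) ∧
      ContinuousOn θ (Icc 0 4) ∧ θ 4 = θ 0 + T ∧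
      ∀ k : Fin 4, ∀ x ∈ Icc (0 : ℝ) 1, β (θ ((k : ℕ) + x)) = g (σ k) (tent x) := by
  have hT := h.pos
  obtain ⟨c, hcq⟩ := h.surj q (mem_iUnion.2 ⟨0, h.star.center_mem 0⟩)
  have hτ : ∀ i, ∃ τ ∈ Ico c (c + T), β τ = g i 1 := fun i => by
    obtain ⟨t, ht⟩ := h.surj (g i 1) (mem_iUnion.2 ⟨i, 1, by simp, rfl⟩)
    obtain ⟨n, hn, -⟩ := existsUnique_add_zsmul_mem_Ico hT t c
    rw [zsmul_eq_mul] at hn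
    exact ⟨_, hn, (h.per_int t n).trans ht⟩
  choose τ hτI hτ using hτ
  choose a b haτ hτb hbT haq hbq hnq v hvm hvc hv0 hv1 hvβ using
    fun i => h.exists_excursion i (hτ i)
  have harm : ∀ i, ∀ t ∈ Ioo (a i) (b i), ∃ s ∈ Icc (0 : ℝ) 1, β t = g i s := by
    intro i t ht
    have : t ∈ v i '' Icc 0 1 := by
      refine intermediate_value_Icc zero_le_one (hvc i) ?_
      rw [hv0, hv1]; exact Ioo_subset_Icc_self ht
    obtain ⟨x, hx, rfl⟩ := this
    exact ⟨tent x, tent_mem hx, hvβ i x hx⟩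
  have hca : ∀ i, c ≤ a i := fun i => by
    by_contra hc
    exact hnq i c ⟨not_le.1 hc, (hτI i).1.trans_lt (hτb i)⟩ hcq
  have hbc : ∀ i, b i ≤ c + T := fun i => by
    by_contra hc
    exact hnq i (c + T) ⟨(haτ i).trans (hτI i).2, not_le.1 hc⟩ ((h.per c).trans hcq)
  have hcover : ∀ t ∈ Icc c (c + T), β t ≠ q → ∃ i, t ∈ Ioo (a i) (b i) := by
    intro t ht htq
    obtain ⟨i, s, hs, he⟩ := mem_iUnion.1 (h.mem t)
    have hs0 : 0 < s := hs.1.lt_of_ne fun h0 => htq (by rw [← he, ← h0, h.star.zero])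
    refine ⟨i, ?_⟩
    by_contra hcon
    have key : ∀ t' ∈ Ioo (b i) (a i + T), β t' = g i s → False := fun t' ht' hβ =>
      h.noncross (a i) (b i) (τ i) t' q (g i '' Ioc 0 1) (haq i) (hbq i) ⟨haτ i, hτb i⟩ ht'
        (h.star.isPreconnected_outer i le_rfl)
        ((image_mono Ioc_subset_Icc_self).trans (subset_iUnion (fun i => g i '' Icc 0 1) i))
        (fun ⟨r, hr, her⟩ => h.star.ne_center hr her) ⟨1, by simp, (hτ i).symm⟩
        ⟨s, ⟨hs0, hs.2⟩, hβ.symm⟩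
    have hta : t ≠ a i := fun h0 => htq (h0 ▸ haq i)
    have htb : t ≠ b i := fun h0 => htq (h0 ▸ hbq i)
    rcases lt_or_gt_of_ne hta with hlt | hlt
    · refine key (t + T) ⟨lt_of_le_of_ne ?_ ?_, by linarith⟩ ((h.per t).trans he.symm)
      · linarith [hbc i, ht.1]
      · intro h0
        exact htq ((h.per t).symm.trans (h0 ▸ hbq i))
    · have hbt : b i < t := lt_of_le_of_ne (not_lt.1 fun h2 => hcon ⟨hlt, h2⟩) htb.symm
      refine key t ⟨hbt, lt_of_le_of_ne ?_ ?_⟩ he.symm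
      · linarith [hca i, ht.2]
      · intro h0
        rw [h0, h.per] at htq
        exact htq (haq i)
  have hdis : ∀ i j, i ≠ j → ∀ t, t ∈ Ioo (a i) (b i) → t ∈ Ioo (a j) (b j) → False := by
    intro i j hij t hi hj
    obtain ⟨s, hs, he⟩ := harm i t hi
    obtain ⟨s', hs', he'⟩ := harm j t hj
    obtain ⟨-, h1 | h1⟩ := h.star.inj i j s s' hs hs' (he.symm.trans he')
    · exact hij h1
    · exact hnq i t hi (by rw [he, h1, h.star.zero])
  have hτinj : Function.Injective τ := by
    intro i j hij
    have he : g i 1 = g j 1 := by rw [← hτ, ← hτ, hij]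
    exact (h.star.inj i j 1 1 (by simp) (by simp) he).2.resolve_right one_ne_zero
  set σ : Equiv.Perm (Fin 4) := Tuple.sort τ
  have hσ : StrictMono (τ ∘ σ) :=
    (Tuple.monotone_sort τ).strictMono_of_injective (hτinj.comp σ.injective)
  have hord : ∀ k l, k < l → b (σ k) ≤ a (σ l) := by
    intro k l hkl
    by_contra hc
    have h1 : τ (σ k) < τ (σ l) := hσ hkl
    have h2 := haτ (σ k)
    have h3 := hτb (σ l)
    obtain ⟨t, ht1, ht2⟩ := exists_between (show max (a (σ k)) (a (σ l)) <
        min (b (σ k)) (b (σ l)) from max_lt (lt_min (h2.trans (hτb _)) (by linarith))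
          (lt_min (not_le.1 hc) ((haτ _).trans h3)))
    exact hdis _ _ (fun he => hkl.ne (σ.injective he)) t
      ⟨(le_max_left _ _).trans_lt ht1, ht2.trans_le (min_le_left _ _)⟩
      ⟨(le_max_right _ _).trans_lt ht1, ht2.trans_le (min_le_right _ _)⟩
  have hab : ∀ i, a i < b i := fun i => (haτ i).trans (hτb i)
  have hgap : ∀ s s', c ≤ s → s' ≤ c + T → (∀ k, b (σ k) ≤ s ∨ s' ≤ a (σ k)) → s' ≤ s := by
    intro s s' hs hs' hk
    by_contra hc
    obtain ⟨t, ht, htq⟩ := h.nonconst_Ioo q (not_le.1 hc)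
    obtain ⟨i, hi⟩ := hcover t ⟨hs.trans ht.1.le, ht.2.le.trans hs'⟩ htq
    rcases hk (σ.symm i) with h1 | h1
    · rw [Equiv.apply_symm_apply] at h1; linarith [hi.2, ht.1]
    · rw [Equiv.apply_symm_apply] at h1; linarith [hi.1, ht.2]
  have hsucc : ∀ k l : Fin 4, (l : ℕ) = k + 1 → b (σ k) = a (σ l) := by
    intro k l hl
    have hkl : k < l := Fin.lt_def.2 (by omega)
    refine le_antisymm (hord k l hkl) (hgap _ _ ?_ ?_ fun j => ?_)
    · linarith [hca (σ k), hab (σ k)]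
    · linarith [hbc (σ l), hab (σ l)]
    · rcases le_or_gt j k with hj | hj
      · left
        rcases hj.eq_or_lt with rfl | hj
        · exact le_rfl
        · linarith [hord _ _ hj, hab (σ k)]
      · right
        have : l ≤ j := Fin.le_def.2 (by have := Fin.lt_def.1 hj; omega)
        rcases this.eq_or_lt with rfl | hj
        · exact le_rfl
        · linarith [hord _ _ hj, hab (σ l)]
  have hfirst : a (σ 0) = c := by
    refine le_antisymm (hgap _ _ le_rfl ?_ fun j => Or.inr ?_) (hca _)
    · linarith [hbc (σ 0), hab (σ 0)]
    · rcases (Fin.zero_le j).eq_or_lt with rfl | hj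
      · exact le_rfl
      · linarith [hord _ _ hj, hab (σ 0)]
  have hlast : b (σ 3) = c + T := by
    refine le_antisymm (hbc _) (hgap _ _ ?_ le_rfl fun j => Or.inl ?_)
    · linarith [hca (σ 3), hab (σ 3)]
    · rcases (show j ≤ 3 from Fin.le_def.2 (by have := j.2; simp; omega)).eq_or_lt with rfl | hj
      · exact le_rfl
      · linarith [hord _ _ hj, hab (σ 3)]
  obtain ⟨θ, h1, h2, h3, h4⟩ := exists_glue (v := fun k => v (σ k)) (A := fun k => a (σ k)) (T := T)
    (fun k => hvm _) (fun k => hvc _) (fun k => hv0 _) ((hv1 _).trans (hsucc 0 1 rfl))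
    ((hv1 _).trans (hsucc 1 2 rfl)) ((hv1 _).trans (hsucc 2 3 rfl))
    ((hv1 _).trans (hlast.trans (by rw [hfirst])))
  exact ⟨θ, σ, h1, h2, h3, fun k x hx => by rw [h4 k x hx]; exact hvβ _ x hx⟩

end

section

open Filter

theorem isPreconnected_punctured_ball_at (y : ℂ) {ε : ℝ} (hε : 0 < ε) :
    IsPreconnected (Metric.ball y ε \ {y}) := by
  have : Metric.ball y ε \ {y} = (fun z : ℂ => y + ε * z) '' (Metric.ball 0 1 \ {0}) := by
    ext z; constructor
    · rintro ⟨hz, hzy⟩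
      have hε' : (ε : ℂ) ≠ 0 := by exact_mod_cast hε.ne'
      refine ⟨(z - y) / ε, ⟨?_, ?_⟩, ?_⟩
      · rw [mem_ball_zero_iff, norm_div, Complex.norm_real, Real.norm_eq_abs, abs_of_pos hε,
          div_lt_one hε, ← dist_eq_norm]
        exact hz
      · exact div_ne_zero (sub_ne_zero.2 hzy) hε'
      · simp only; field_simp; ring
    · rintro ⟨w, ⟨hw, hw0⟩, rfl⟩
      refine ⟨?_, ?_⟩
      · rw [Metric.mem_ball, dist_eq_norm, add_sub_cancel_left, norm_mul, Complex.norm_real,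
          Real.norm_eq_abs, abs_of_pos hε]
        have := mem_ball_zero_iff.1 hw
        nlinarith
      · have hε' : (ε : ℂ) ≠ 0 := by exact_mod_cast hε.ne'
        simpa [hε'] using hw0
  rw [this]
  exact isPreconnected_punctured_ball.image _ (by fun_prop)

namespace IsStar

variable {g : Fin 4 → ℝ → ℂ} {q : ℂ} (h : IsStar g q)
include h

theorem mem_closure_compl_of_mem_Ioo (i : Fin 4) {s : ℝ} (hs : s ∈ Ioo (0 : ℝ) 1) :
    g i s ∈ closure (starSet g)ᶜ := by
  by_contra hcon
  have hs01 := Ioo_subset_Icc_self hs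
  set B := ⋃ j ∈ ({i}ᶜ : Set (Fin 4)), g j '' Icc 0 1
  have hB : IsClosed B := (toFinite _).isClosed_biUnion fun j _ => (h.isCompact_arm j).isClosed
  have hyB : g i s ∉ B := by
    intro hy
    simp only [B, mem_iUnion] at hy
    obtain ⟨j, hj, s', hs', he⟩ := hy
    obtain ⟨rfl, h1 | h1⟩ := h.inj j i s' s hs' hs01 he
    · exact hj h1
    · exact hs.1.ne' h1
  obtain ⟨ε, hε, H⟩ := Metric.isOpen_iff.1 (isClosed_closure.union hB).isOpen_compl (g i s)
    (fun hm => hm.elim hcon hyB)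
  have hsub : ∀ z ∈ Metric.ball (g i s) ε, z ∈ g i '' Icc 0 1 := by
    intro z hz
    have h1 : z ∈ starSet g := by
      by_contra hc
      exact H hz (Or.inl (subset_closure hc))
    obtain ⟨j, hj⟩ := mem_iUnion.1 h1
    by_cases hji : j = i
    · rwa [← hji]
    · exact absurd (Or.inr (mem_iUnion₂.2 ⟨j, hji, hj⟩)) (H hz)
  have hinj := h.injOn i
  set φ := Function.invFunOn (g i) (Icc 0 1)
  have hφ : ContinuousOn φ (g i '' Icc 0 1) :=
    continuousOn_invFunOn_of_isCompact isCompact_Icc (h.cont i) hinj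
  have hpre := (isPreconnected_punctured_ball_at (g i s) hε).image φ
    (hφ.mono fun z hz => hsub z hz.1)
  have hca : ContinuousAt (g i) s := (h.cont i).continuousAt (Icc_mem_nhds hs.1 hs.2)
  obtain ⟨δ, hδ, hδ'⟩ := Metric.eventually_nhds_iff.1
    ((hca.eventually (Metric.ball_mem_nhds _ hε)).and (Icc_mem_nhds hs.1 hs.2))
  have hmem : ∀ s', dist s' s < δ → s' ≠ s → s' ∈ φ '' (Metric.ball (g i s) ε \ {g i s}) := by
    intro s' hd hne
    obtain ⟨h1, h2⟩ := hδ' hd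
    exact ⟨g i s', ⟨h1, fun he => hne (hinj h2 hs01 he)⟩, hinj.leftInvOn_invFunOn h2⟩
  have h1 := hmem (s - δ / 2) (by rw [Real.dist_eq, abs_lt]; constructor <;> linarith)
    (by linarith)
  have h2 := hmem (s + δ / 2) (by rw [Real.dist_eq, abs_lt]; constructor <;> linarith)
    (by linarith)
  obtain ⟨z, hz, hzs⟩ := hpre.ordConnected.out h1 h2
    (show s ∈ Icc (s - δ / 2) (s + δ / 2) from ⟨by linarith, by linarith⟩)
  have : g i s = z := by rw [← hzs]; exact Function.invFunOn_eq (hsub z hz.1)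
  exact hz.2 this.symm

theorem mem_closure_compl {y : ℂ} (hy : y ∈ starSet g) : y ∈ closure (starSet g)ᶜ := by
  obtain ⟨i, s, hs, rfl⟩ := mem_iUnion.1 hy
  have h1 : s ∈ closure (Ioo (0 : ℝ) 1) := by rwa [closure_Ioo zero_ne_one]
  have := (((h.cont i) s hs).mono Ioo_subset_Icc_self).mem_closure h1
    fun r hr => h.mem_closure_compl_of_mem_Ioo i hr
  rwa [closure_closure] at this

/-- The complement of a star in the plane is uniformized, with a standard boundary trace. -/
theorem exists_unif : ∃ (Φ : ℂ → ℂ) (θ : ℝ → ℝ) (σ : Equiv.Perm (Fin 4)),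
    IsUnif Φ (starSet g) ∧ StrictMonoOn θ (Icc 0 4) ∧ ContinuousOn θ (Icc 0 4) ∧
    θ 4 = θ 0 + 2 * Real.pi ∧
    ∀ k : Fin 4, ∀ x ∈ Icc (0 : ℝ) 1, Φ (θ ((k : ℕ) + x)) = g (σ k) (tent x) := by
  have hXc : ∀ p ∉ starSet g, ∀ p' ∉ starSet g, p' ∈ connectedComponentIn (starSet g)ᶜ p :=
    fun p hp p' hp' => h.compl_mem_component hp hp'
  have := h.locallyConnectedSpace
  obtain ⟨ψ, hψ⟩ := exists_isExteriorMap h.isCompact h.isPreconnected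
    (x₀ := g 0 0) (x₁ := g 0 1) (mem_iUnion.2 ⟨0, 0, by simp, rfl⟩)
    (mem_iUnion.2 ⟨0, 1, by simp, rfl⟩)
    (fun he => zero_ne_one (h.inj 0 0 0 1 (by simp) (by simp) he).1) hXc
  have hU := hψ.isUnif h.isCompact hXc
  generalize (fun w => extBdry ψ (Complex.exp (Complex.I * w))) = Φ at hU
  have hT : IsTrace (fun t : ℝ => Φ t) g q (2 * Real.pi) :=
    { pos := Real.two_pi_pos
      star := h
      cont := hU.continuous_bdry
      per := hU.bdry_periodic
      mem := fun t => hU.mem _ (by simp)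
      surj := fun y hy => hU.exists_bdry_of_mem_closure hy (h.mem_closure_compl hy)
      nonconst := fun a b x hab => hU.not_const_on_Icc hab
      noncross := fun a b t t' x N ha hb ht ht' hN hNX hxN htN ht'N =>
        hU.bdry_no_crossing h.isCompact hXc ha hb ht ht' hN hNX hxN htN ht'N }
  obtain ⟨θ, σ, h1, h2, h3, h4⟩ := hT.exists_param
  exact ⟨Φ, θ, σ, hU, h1, h2, h3, h4⟩

end IsStar

theorem exists_homeomorph_of_kernel {D Y Z : Type*} [TopologicalSpace D] [CompactSpace D]
    [TopologicalSpace Y] [T2Space Y] [TopologicalSpace Z] [T2Space Z] {E : D → Y} {F : D → Z}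
    (hE : Continuous E) (hF : Continuous F) (hEs : Function.Surjective E)
    (hFs : Function.Surjective F) (hEF : ∀ a b, E a = E b ↔ F a = F b) :
    ∃ h : Y ≃ₜ Z, ∀ a, h (E a) = F a := by
  have hEq : IsQuotientMap E := hE.isClosedMap.isQuotientMap hE hEs
  have hFq : IsQuotientMap F := hF.isClosedMap.isQuotientMap hF hFs
  have e1 : ∀ a, F (Function.surjInv hEs (E a)) = F a := fun a =>
    (hEF _ _).1 (Function.surjInv_eq hEs _)
  have e2 : ∀ a, E (Function.surjInv hFs (F a)) = E a := fun a =>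
    (hEF _ _).2 (Function.surjInv_eq hFs _)
  refine ⟨{ toFun := fun y => F (Function.surjInv hEs y)
            invFun := fun z => E (Function.surjInv hFs z)
            left_inv := fun y => ?_
            right_inv := fun z => ?_
            continuous_toFun := ?_
            continuous_invFun := ?_ }, e1⟩
  · obtain ⟨a, rfl⟩ := hEs y
    simp only [e1, e2]
  · obtain ⟨a, rfl⟩ := hFs z
    simp only [e1, e2]
  · rw [hEq.continuous_iff]; exact hF.congr fun a => (e1 a).symm
  · rw [hFq.continuous_iff]; exact hE.congr fun a => (e2 a).symm

theorem IsStar.exists_plane_star {Y : Type*} [TopologicalSpace Y] {g : Fin 4 → ℝ → Y} {q : Y}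
    (h : IsStar g q) {e : ℂ → Y} (he : IsEmbedding e) (hr : starSet g ⊆ range e) :
    ∃ (f : Fin 4 → ℝ → ℂ) (p : ℂ), IsStar f p ∧ ∀ i, ∀ s ∈ Icc (0 : ℝ) 1, e (f i s) = g i s := by
  have hm : ∀ i, ∀ s ∈ Icc (0 : ℝ) 1, ∃ z, e z = g i s := fun i s hs =>
    hr (mem_iUnion.2 ⟨i, s, hs, rfl⟩)
  have key : ∀ i, ∀ s ∈ Icc (0 : ℝ) 1, e (Function.invFun e (g i s)) = g i s := fun i s hs =>
    Function.invFun_eq (hm i s hs)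
  refine ⟨fun i s => Function.invFun e (g i s), Function.invFun e q, ⟨fun i => ?_, fun i => ?_,
    fun i j s t hs ht hst => ?_⟩, key⟩
  · rw [he.isInducing.continuousOn_iff]
    exact (h.cont i).congr fun s hs => key i s hs
  · simp only [h.zero]
  · refine h.inj i j s t hs ht ?_
    rw [← key i s hs, ← key j t ht]
    exact congrArg e hst

end

section

open Filter

/-- Identifications along the boundary in the standard model of the complement of a star. -/
def BdryRel (s s' : ℝ) : Prop :=
  ∃ k k' : Fin 4, ∃ x ∈ Icc (0 : ℝ) 1, ∃ x' ∈ Icc (0 : ℝ) 1, s = (k : ℕ) + x ∧ s' = (k' : ℕ) + x' ∧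
    tent x = tent x' ∧ (k = k' ∨ tent x = 0)

/-- Identifications in the standard model of the sphere cut along a star. -/
def ModelRel (p p' : ℝ × ℝ) : Prop :=
  p.2 = p'.2 ∧ (p.2 = 0 ∨ (p.2 < 1 ∧ (p.1 = p'.1 ∨ (p.1 = 0 ∧ p'.1 = 4) ∨ (p.1 = 4 ∧ p'.1 = 0))) ∨
    (p.2 = 1 ∧ BdryRel p.1 p'.1))

theorem exists_fin_add {s : ℝ} (hs : s ∈ Icc (0 : ℝ) 4) :
    ∃ k : Fin 4, ∃ x ∈ Icc (0 : ℝ) 1, s = (k : ℕ) + x := by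
  rcases hs.2.eq_or_lt with rfl | h4
  · exact ⟨3, 1, by simp, by norm_num⟩
  have hs0 : ⌊s⌋ < 4 := Int.floor_lt.2 (by push_cast; exact h4)
  have hs1 : 0 ≤ ⌊s⌋ := Int.floor_nonneg.2 hs.1
  have hcast : ((⌊s⌋.toNat : ℕ) : ℝ) = ⌊s⌋ := by exact_mod_cast Int.toNat_of_nonneg hs1
  refine ⟨⟨⌊s⌋.toNat, by omega⟩, s - ⌊s⌋, ⟨?_, ?_⟩, ?_⟩
  · linarith [Int.floor_le s]
  · linarith [Int.lt_floor_add_one s]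
  · simp only [hcast]; ring

theorem fin_add_mem (k : Fin 4) {x : ℝ} (hx : x ∈ Icc (0 : ℝ) 1) :
    ((k : ℕ) : ℝ) + x ∈ Icc (0 : ℝ) 4 := by
  have h1 : ((k : ℕ) : ℝ) ≤ 3 := by exact_mod_cast Nat.lt_succ_iff.1 k.2
  have h2 : (0 : ℝ) ≤ ((k : ℕ) : ℝ) := Nat.cast_nonneg _
  exact ⟨by linarith [hx.1], by linarith [hx.2]⟩

theorem tent_half {s : ℝ} (hs : s ∈ Icc (0 : ℝ) 1) : tent (s / 2) = s := by
  unfold tent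
  rw [abs_of_nonpos (by linarith [hs.2])]; ring

/-- The sphere is a quotient of the standard model, compatibly with a star. -/
theorem IsStar.exists_model {Y : Type*} [TopologicalSpace Y] [T2Space Y] {g : Fin 4 → ℝ → Y}
    {q : Y} (h : IsStar g q) {e : ℂ → Y} {v : Y} (he : IsEmbedding e) (her : range e = {v}ᶜ)
    (hev : Tendsto e (Bornology.cobounded ℂ) (𝓝 v)) (hv : v ∉ starSet g) :
    ∃ (E : ↥(Icc (0 : ℝ) 4 ×ˢ Icc (0 : ℝ) 1) → Y) (σ : Equiv.Perm (Fin 4)), Continuous E ∧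
      Function.Surjective E ∧ (∀ a b, E a = E b ↔ ModelRel a b) ∧
      ∀ (a : ↥(Icc (0 : ℝ) 4 ×ˢ Icc (0 : ℝ) 1)) (k : Fin 4), ∀ x ∈ Icc (0 : ℝ) 1,
        a.1 = ((k : ℕ) + x, 1) → E a = g (σ k) (tent x) := by
  obtain ⟨f, p, hf, hfg⟩ := h.exists_plane_star he (by
    rw [her]; intro y hy hyv; exact hv (hyv ▸ hy))
  obtain ⟨Φ, θ, σ, hU, hθm, hθc, hθT, hβ⟩ := hf.exists_unif
  have hπ := Real.pi_pos
  set G : ℝ × ℝ → ℂ := fun a => Φ (θ a.1 + (1 / a.2 - 1 : ℝ) * Complex.I) with hG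
  set E : ↥(Icc (0 : ℝ) 4 ×ˢ Icc (0 : ℝ) 1) → Y := fun a => if a.1.2 = 0 then v else e (G a) with hE
  have hne : ∀ z, e z ≠ v := fun z hz => by
    have : e z ∈ ({v}ᶜ : Set Y) := her ▸ mem_range_self z
    exact this hz
  have him : ∀ a : ℝ × ℝ, (θ a.1 + (1 / a.2 - 1 : ℝ) * Complex.I : ℂ).im = 1 / a.2 - 1 := by
    intro a
    simp only [Complex.add_im, Complex.ofReal_im, Complex.mul_im, Complex.ofReal_re,
      Complex.I_im, Complex.I_re, mul_one, mul_zero, add_zero, zero_add]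
  have hG1 : ∀ s : ℝ, G (s, 1) = Φ (θ s) := fun s => by simp [hG]
  have hE1 : ∀ (a : ↥(Icc (0 : ℝ) 4 ×ˢ Icc (0 : ℝ) 1)) (k : Fin 4), ∀ x ∈ Icc (0 : ℝ) 1,
      a.1 = ((k : ℕ) + x, 1) → G a = f (σ k) (tent x) := by
    intro a k x hx ha
    rw [ha, hG1, hβ k x hx]
  have hpos : ∀ a : ↥(Icc (0 : ℝ) 4 ×ˢ Icc (0 : ℝ) 1), a.1.2 ≠ 0 → 0 < a.1.2 := fun a ha =>
    lt_of_le_of_ne a.2.2.1 (Ne.symm ha)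
  have hinv : ∀ a : ↥(Icc (0 : ℝ) 4 ×ˢ Icc (0 : ℝ) 1), a.1.2 ≠ 0 → 1 ≤ 1 / a.1.2 := fun a ha =>
    (one_le_div (hpos a ha)).2 a.2.2.2
  have hGX : ∀ a : ↥(Icc (0 : ℝ) 4 ×ˢ Icc (0 : ℝ) 1), a.1.2 ≠ 0 → (G a ∈ starSet f ↔ a.1.2 = 1) := by
    intro a ha
    constructor
    · intro hX
      by_contra h1
      refine hU.notMem _ ?_ hX
      rw [him]
      have := (one_lt_div (hpos a ha)).2 (lt_of_le_of_ne a.2.2.2 h1)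
      linarith
    · intro h1
      refine hU.mem _ ?_
      rw [him, h1]; norm_num
  have h0mem : (0 : ℝ) ∈ Icc (0 : ℝ) 4 := by simp
  have h4mem : (4 : ℝ) ∈ Icc (0 : ℝ) 4 := by simp
  refine ⟨E, σ, ?_, ?_, ?_, ?_⟩
  · rw [continuous_iff_continuousAt]
    intro a
    by_cases ha : a.1.2 = 0
    · have hEa : E a = v := if_pos ha
      rw [ContinuousAt, hEa]
      intro V hV
      obtain ⟨R, -, hR⟩ := (Metric.hasBasis_cobounded_compl_closedBall (0 : ℂ)).mem_iff.1 (hev hV)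
      obtain ⟨M, hM, H⟩ := hU.large R
      have h1 : ∀ᶠ b : ↥(Icc (0 : ℝ) 4 ×ˢ Icc (0 : ℝ) 1) in 𝓝 a, b.1.2 < 1 / (M + 1) := by
        refine ContinuousAt.eventually_lt (by fun_prop) continuousAt_const ?_
        rw [ha]; positivity
      rw [mem_map]
      filter_upwards [h1] with b hb
      by_cases hb0 : b.1.2 = 0
      · rw [mem_preimage, hE]; simp only [hb0, if_true]; exact mem_of_mem_nhds hV
      · rw [mem_preimage, hE]; simp only [hb0, if_false]
        refine hR ?_
        rw [mem_compl_iff, mem_closedBall_zero_iff, not_le]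
        refine H _ ?_
        rw [him]
        have := (lt_one_div (hpos b hb0) (by linarith)).1 hb
        linarith
    · have h1 : ∀ᶠ b : ↥(Icc (0 : ℝ) 4 ×ˢ Icc (0 : ℝ) 1) in 𝓝 a, b.1.2 ≠ 0 :=
        ContinuousAt.eventually_ne (by fun_prop) ha
      have h2 : ContinuousAt (fun b : ↥(Icc (0 : ℝ) 4 ×ˢ Icc (0 : ℝ) 1) => e (G b)) a := by
        refine he.continuous.continuousAt.comp ?_
        have hcont : ContinuousOn (fun b : ↥(Icc (0 : ℝ) 4 ×ˢ Icc (0 : ℝ) 1) => G b)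
            {b | b.1.2 ≠ 0} := by
          refine hU.cont.comp ?_ ?_
          · have c1 : Continuous fun b : ↥(Icc (0 : ℝ) 4 ×ˢ Icc (0 : ℝ) 1) => θ b.1.1 :=
              hθc.comp_continuous (by fun_prop) fun b => b.2.1
            have c2 : ContinuousOn (fun b : ↥(Icc (0 : ℝ) 4 ×ˢ Icc (0 : ℝ) 1) => 1 / b.1.2 - 1)
                {b | b.1.2 ≠ 0} :=
              (continuousOn_const.div (by fun_prop) fun b hb => hb).sub continuousOn_const
            exact (Complex.continuous_ofReal.comp c1).continuousOn.add
              ((Complex.continuous_ofReal.comp_continuousOn c2).mul continuousOn_const)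
          · intro b hb
            rw [mem_ofPred_eq, him]
            linarith [hinv b hb]
        exact hcont.continuousAt h1
      refine h2.congr ?_
      filter_upwards [h1] with b hb
      exact (if_neg hb).symm
  · intro y
    by_cases hy : y = v
    · exact ⟨⟨(0, 0), by simp⟩, by rw [hE, hy]; simp⟩
    obtain ⟨z, rfl⟩ : y ∈ range e := her ▸ hy
    by_cases hz : z ∈ starSet f
    · obtain ⟨i, s, hs, rfl⟩ := mem_iUnion.1 hz
      have hs2 : s / 2 ∈ Icc (0 : ℝ) 1 := ⟨by linarith [hs.1], by linarith [hs.2]⟩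
      refine ⟨⟨(((σ.symm i : Fin 4) : ℕ) + s / 2, 1), fin_add_mem _ hs2, by simp⟩, ?_⟩
      simp only [hE, one_ne_zero, if_false]
      rw [hG1, hβ _ _ hs2, tent_half hs, Equiv.apply_symm_apply]
    · obtain ⟨w, hw, rfl⟩ := hU.surj z hz
      obtain ⟨n, hn, -⟩ := existsUnique_add_zsmul_mem_Ico Real.two_pi_pos w.re (θ 0)
      rw [zsmul_eq_mul, ← hθT] at hn
      obtain ⟨s, hs, hsθ⟩ := intermediate_value_Icc (by norm_num) hθc (Ico_subset_Icc_self hn)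
      have hw1 : 0 < 1 + w.im := by linarith
      refine ⟨⟨(s, 1 / (1 + w.im)), hs, by positivity, (div_le_one hw1).2 (by linarith)⟩, ?_⟩
      have : (1 : ℝ) / (1 + w.im) ≠ 0 := by positivity
      simp only [hE, this, if_false, hG]
      rw [← hU.periodic_int w n]
      congr 2
      apply Complex.ext
      · simp [hsθ]
      · simp
  · intro a b
    have hae : a.1.2 = 0 → E a = v := fun ha => if_pos ha
    have hane : a.1.2 ≠ 0 → E a = e (G a) := fun ha => if_neg ha
    have hbe : b.1.2 = 0 → E b = v := fun ha => if_pos ha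
    have hbne : b.1.2 ≠ 0 → E b = e (G b) := fun ha => if_neg ha
    constructor
    · intro hab
      by_cases ha : a.1.2 = 0
      · have hb : b.1.2 = 0 := by
          by_contra hb
          rw [hae ha, hbne hb] at hab
          exact hne _ hab.symm
        exact ⟨ha.trans hb.symm, Or.inl ha⟩
      have hb : b.1.2 ≠ 0 := by
        intro hb
        rw [hane ha, hbe hb] at hab
        exact hne _ hab
      rw [hane ha, hbne hb] at hab
      have hGab := he.injective hab
      have h1 : a.1.2 = 1 ↔ b.1.2 = 1 := by rw [← hGX a ha, ← hGX b hb, hGab]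
      by_cases ha1 : a.1.2 = 1
      · have hb1 := h1.1 ha1
        refine ⟨ha1.trans hb1.symm, Or.inr (Or.inr ⟨ha1, ?_⟩)⟩
        obtain ⟨k, x, hx, hkx⟩ := exists_fin_add a.2.1
        obtain ⟨k', x', hx', hkx'⟩ := exists_fin_add b.2.1
        rw [hE1 a k x hx (Prod.ext hkx ha1), hE1 b k' x' hx' (Prod.ext hkx' hb1)] at hGab
        obtain ⟨h2, h3⟩ := hf.inj _ _ _ _ (tent_mem hx) (tent_mem hx') hGab
        exact ⟨k, k', x, hx, x', hx', hkx, hkx', h2, h3.imp_left fun h4 => σ.injective h4⟩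
      · have hb1 := fun hb1 => ha1 (h1.2 hb1)
        have hia : 0 < 1 / a.1.2 - 1 := by
          have := (one_lt_div (hpos a ha)).2 (lt_of_le_of_ne a.2.2.2 ha1)
          linarith
        have hib : 0 < 1 / b.1.2 - 1 := by
          have := (one_lt_div (hpos b hb)).2 (lt_of_le_of_ne b.2.2.2 hb1)
          linarith
        obtain ⟨n, hn⟩ := hU.inj _ _ (by rw [him]; exact hia) (by rw [him]; exact hib) hGab
        have hn2 := congrArg Complex.im hn
        have hn1 := congrArg Complex.re hn
        rw [him, Complex.add_im, him] at hn2
        simp only [Complex.add_re, Complex.ofReal_re, Complex.mul_re, Complex.I_re, mul_zero,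
          Complex.ofReal_im, Complex.I_im, mul_one, sub_zero, add_zero, Complex.intCast_re,
          Complex.intCast_im, zero_mul, Complex.re_ofNat, Complex.im_ofNat, Complex.mul_im] at hn1 hn2
        have hy : a.1.2 = b.1.2 := by
          have h3 : 1 / a.1.2 = 1 / b.1.2 := by linarith
          simpa [one_div] using h3
        refine ⟨hy, Or.inr (Or.inl ⟨lt_of_le_of_ne a.2.2.2 ha1, ?_⟩)⟩
        have ma := hθm.monotoneOn h0mem a.2.1 a.2.1.1
        have ma' := hθm.monotoneOn a.2.1 h4mem a.2.1.2
        have mb := hθm.monotoneOn h0mem b.2.1 b.2.1.1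
        have mb' := hθm.monotoneOn b.2.1 h4mem b.2.1.2
        have hn3 : n = 0 ∨ n = 1 ∨ n = -1 := by
          have h3 : (n : ℝ) < 2 := by nlinarith
          have h4 : (-2 : ℝ) < n := by nlinarith
          have h5 : n < 2 := by exact_mod_cast h3
          have h6 : -2 < n := by exact_mod_cast h4
          omega
        rcases hn3 with rfl | rfl | rfl
        · left
          push_cast at hn1
          exact hθm.injOn a.2.1 b.2.1 (by linarith)
        · right; right
          push_cast at hn1
          exact ⟨hθm.injOn a.2.1 h4mem (by linarith), hθm.injOn b.2.1 h0mem (by linarith)⟩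
        · right; left
          push_cast at hn1
          exact ⟨hθm.injOn a.2.1 h0mem (by linarith), hθm.injOn b.2.1 h4mem (by linarith)⟩
    · rintro ⟨h1, h2⟩
      by_cases ha : a.1.2 = 0
      · rw [hae ha, hbe (h1 ▸ ha)]
      have hb : b.1.2 ≠ 0 := h1 ▸ ha
      rw [hane ha, hbne hb]
      congr 1
      rcases h2 with h2 | ⟨-, h2⟩ | ⟨h2, k, k', x, hx, x', hx', hkx, hkx', ht, hk⟩
      · exact absurd h2 ha
      · simp only [hG, h1]
        rcases h2 with h2 | ⟨h2, h3⟩ | ⟨h2, h3⟩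
        · rw [h2]
        · rw [h2, h3, hθT, ← hU.periodic]
          congr 1; push_cast; ring
        · rw [h2, h3, hθT, ← hU.periodic (θ 0 + _)]
          congr 1; push_cast; ring
      · rw [hE1 a k x hx (Prod.ext hkx h2), hE1 b k' x' hx' (Prod.ext hkx' (h1 ▸ h2)), ← ht]
        rcases hk with rfl | hk
        · rfl
        · rw [hk, hf.zero, hf.zero]
  · intro a k x hx ha
    have h1 : a.1.2 ≠ 0 := by rw [ha]; exact one_ne_zero
    simp only [hE, h1, if_false]
    rw [hE1 a k x hx ha, hfg _ _ (tent_mem hx)]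

/-- Any two stars in the sphere are equivalent up to relabelling the arms. -/
theorem IsStar.exists_homeomorph {Y : Type*} [TopologicalSpace Y] [T2Space Y]
    {g g' : Fin 4 → ℝ → Y} {q q' : Y} (h : IsStar g q) (h' : IsStar g' q') {e e' : ℂ → Y} {v v' : Y}
    (he : IsEmbedding e) (her : range e = {v}ᶜ) (hev : Tendsto e (Bornology.cobounded ℂ) (𝓝 v))
    (hv : v ∉ starSet g) (he' : IsEmbedding e') (her' : range e' = {v'}ᶜ)
    (hev' : Tendsto e' (Bornology.cobounded ℂ) (𝓝 v')) (hv' : v' ∉ starSet g') :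
    ∃ (φ : Y ≃ₜ Y) (π : Equiv.Perm (Fin 4)), ∀ i, ∀ s ∈ Icc (0 : ℝ) 1,
      φ (g i s) = g' (π i) s := by
  obtain ⟨E, σ, hE, hEs, hEk, hEg⟩ := h.exists_model he her hev hv
  obtain ⟨E', σ', hE', hEs', hEk', hEg'⟩ := h'.exists_model he' her' hev' hv'
  have : CompactSpace ↥(Icc (0 : ℝ) 4 ×ˢ Icc (0 : ℝ) 1) :=
    isCompact_iff_compactSpace.1 (isCompact_Icc.prod isCompact_Icc)
  obtain ⟨φ, hφ⟩ := exists_homeomorph_of_kernel hE hE' hEs hEs'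
    fun a b => (hEk a b).trans (hEk' a b).symm
  refine ⟨φ, σ.symm.trans σ', fun i s hs => ?_⟩
  have hs2 : s / 2 ∈ Icc (0 : ℝ) 1 := ⟨by linarith [hs.1], by linarith [hs.2]⟩
  have h1 := hφ ⟨(((σ.symm i : Fin 4) : ℕ) + s / 2, 1), fin_add_mem _ hs2, by simp⟩
  rw [hEg _ _ _ hs2 rfl, hEg' _ _ _ hs2 rfl, tent_half hs, Equiv.apply_symm_apply] at h1
  exact h1

end

section

open Filter

/-- Two parameters on a `1`-periodic curve are congruent if they differ by an integer. -/
def IntEq (x y : ℝ) : Prop := ∃ n : ℤ, x = y + n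

theorem IntEq.refl (x : ℝ) : IntEq x x := ⟨0, by simp⟩

theorem IntEq.symm {x y : ℝ} (h : IntEq x y) : IntEq y x := by
  obtain ⟨n, rfl⟩ := h
  exact ⟨-n, by push_cast; ring⟩

theorem IntEq.trans {x y z : ℝ} (h : IntEq x y) (h' : IntEq y z) : IntEq x z := by
  obtain ⟨n, rfl⟩ := h
  obtain ⟨m, rfl⟩ := h'
  exact ⟨m + n, by push_cast; ring⟩

theorem IntEq.eq_of_abs_lt {x y : ℝ} (h : IntEq x y) (hd : |x - y| < 1) : x = y := by
  obtain ⟨n, rfl⟩ := h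
  rw [add_sub_cancel_left, ← Int.cast_abs] at hd
  have : |n| < 1 := by exact_mod_cast hd
  rw [Int.abs_lt_one_iff.1 this]; simp

theorem IntEq.eq_of_Ico {x y : ℝ} (h : IntEq x y) (hx : x ∈ Ico (0 : ℝ) 1)
    (hy : y ∈ Ico (0 : ℝ) 1) : x = y :=
  h.eq_of_abs_lt (by rw [abs_lt]; constructor <;> linarith [hx.1, hx.2, hy.1, hy.2])

theorem intEq_fract (x : ℝ) : IntEq (Int.fract x) x :=
  ⟨-⌊x⌋, by rw [Int.fract]; push_cast; ring⟩

theorem isClosed_setOf_intEq (y : ℝ) : IsClosed {x | IntEq x y} := by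
  have : {x | IntEq x y} = (fun x : ℝ => x - y) ⁻¹' range ((↑) : ℤ → ℝ) := by
    ext x
    constructor
    · rintro ⟨n, rfl⟩; exact ⟨n, by simp⟩
    · rintro ⟨n, hn⟩; exact ⟨n, by rw [hn]; ring⟩
  rw [this]
  exact Int.isClosedEmbedding_coe_real.isClosed_range.preimage (by fun_prop)

variable {Y : Type*}

/-- The double points of a periodic curve. -/
def doubles (f : ℝ → Y) : Set Y := {p | ∃ x y, ¬ IntEq x y ∧ f x = p ∧ f y = p}

/-- A closed curve with only finitely many multiple points, all of multiplicity two. -/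
structure IsCurve [TopologicalSpace Y] (f : ℝ → Y) : Prop where
  cont : Continuous f
  per : Function.Periodic f 1
  tri : ∀ x y z, f x = f y → f y = f z → IntEq x y ∨ IntEq y z ∨ IntEq x z
  fin : (doubles f).Finite

theorem Function.Periodic.map_intEq {f : ℝ → Y} (hf : Function.Periodic f 1) {x y : ℝ}
    (h : IntEq x y) : f x = f y := by
  obtain ⟨n, rfl⟩ := h
  simpa using hf.int_mul n y

theorem mem_doubles_iff {f : ℝ → Y} (hp : Function.Periodic f 1)
    (hfin : ∀ p, {t | t ∈ Ico (0 : ℝ) 1 ∧ f t = p}.Finite)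
    (h2 : ∀ p, {t | t ∈ Ico (0 : ℝ) 1 ∧ f t = p}.ncard ≤ 2) (p : Y) :
    p ∈ doubles f ↔ {t | t ∈ Ico (0 : ℝ) 1 ∧ f t = p}.ncard = 2 := by
  constructor
  · rintro ⟨x, y, hxy, hx, hy⟩
    refine le_antisymm (h2 p) ?_
    have hsub : ({Int.fract x, Int.fract y} : Set ℝ) ⊆ {t | t ∈ Ico (0 : ℝ) 1 ∧ f t = p} := by
      rintro _ (rfl | rfl)
      · exact ⟨⟨Int.fract_nonneg _, Int.fract_lt_one _⟩, (hp.map_intEq (intEq_fract x)).trans hx⟩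
      · exact ⟨⟨Int.fract_nonneg _, Int.fract_lt_one _⟩, (hp.map_intEq (intEq_fract y)).trans hy⟩
    have hne : Int.fract x ≠ Int.fract y := fun h =>
      hxy ((intEq_fract x).symm.trans (h ▸ intEq_fract y))
    rw [← ncard_pair hne]
    exact ncard_le_ncard hsub (hfin p)
  · intro h
    obtain ⟨x, y, hxy, he⟩ := ncard_eq_two.1 h
    have hx : x ∈ {t | t ∈ Ico (0 : ℝ) 1 ∧ f t = p} := by rw [he]; simp
    have hy : y ∈ {t | t ∈ Ico (0 : ℝ) 1 ∧ f t = p} := by rw [he]; simp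
    exact ⟨x, y, fun h => hxy (h.eq_of_Ico hx.1 hy.1), hx.2, hy.2⟩

namespace IsCurve

theorem finite_fiber [TopologicalSpace Y] {f : ℝ → Y} (hf : IsCurve f) (p : Y) :
    {t | t ∈ Ico (0 : ℝ) 1 ∧ f t = p}.Finite ∧ {t | t ∈ Ico (0 : ℝ) 1 ∧ f t = p}.ncard ≤ 2 := by
  rw [← encard_le_coe_iff_finite_ncard_le]
  by_contra! h
  have h3 : (3 : ℕ∞) ≤ {t | t ∈ Ico (0 : ℝ) 1 ∧ f t = p}.encard := by
    have := Order.add_one_le_of_lt h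
    norm_num at this; exact this
  obtain ⟨s, hs, hc⟩ := exists_subset_encard_eq h3
  obtain ⟨x, y, z, hxy, hxz, hyz, rfl⟩ := encard_eq_three.1 hc
  have hx := hs (show x ∈ _ by simp)
  have hy := hs (show y ∈ _ by simp)
  have hz := hs (show z ∈ _ by simp)
  rcases hf.tri x y z (hx.2.trans hy.2.symm) (hy.2.trans hz.2.symm) with g | g | g
  · exact hxy (g.eq_of_Ico hx.1 hy.1)
  · exact hyz (g.eq_of_Ico hy.1 hz.1)
  · exact hxz (g.eq_of_Ico hx.1 hz.1)

variable [TopologicalSpace Y] [T2Space Y] {f : ℝ → Y}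

theorem eventually_notMem_doubles (hf : IsCurve f) (t : ℝ) :
    ∀ᶠ τ in 𝓝[≠] t, f τ ∉ doubles f := by
  have key : ∀ p ∈ doubles f, ∀ᶠ τ in 𝓝[≠] t, f τ ≠ p := by
    intro p hp
    by_cases hpt : f t = p
    · obtain ⟨y, hy, hyp⟩ : ∃ y, ¬ IntEq t y ∧ f y = p := by
        obtain ⟨a, b, hab, ha, hb⟩ := hp
        by_cases h : IntEq t a
        · exact ⟨b, fun h' => hab (h.symm.trans h'), hb⟩
        · exact ⟨a, h, ha⟩
      have h1 : ∀ᶠ τ in 𝓝[≠] t, ¬ IntEq τ y :=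
        nhdsWithin_le_nhds ((isClosed_setOf_intEq y).isOpen_compl.mem_nhds hy)
      have h2 : ∀ᶠ τ in 𝓝[≠] t, |τ - t| < 1 := by
        refine nhdsWithin_le_nhds ?_
        have := Metric.ball_mem_nhds t one_pos
        filter_upwards [this] with τ hτ using by simpa [Real.dist_eq] using hτ
      filter_upwards [h1, h2, self_mem_nhdsWithin] with τ g1 g2 g3 hτ
      rcases hf.tri τ t y (hτ.trans hpt.symm) (hpt.trans hyp.symm) with h | h | h
      · exact g3 (h.eq_of_abs_lt g2)
      · exact hy h
      · exact g1 h
    · exact nhdsWithin_le_nhds (hf.cont.continuousAt.eventually_ne hpt)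
  filter_upwards [(eventually_all_finite hf.fin).2 key] with τ h h' using h _ h' rfl

theorem loc_inj (hf : IsCurve f) (t : ℝ) : ∃ ε > 0, InjOn f (Ioo (t - ε) (t + ε)) := by
  have h := hf.eventually_notMem_doubles t
  rw [eventually_nhdsWithin_iff, Metric.eventually_nhds_iff] at h
  obtain ⟨ε, hε, H⟩ := h
  refine ⟨min ε (1 / 2), by positivity, fun a ha b hb hab => ?_⟩
  have h1 := min_le_left ε (1 / 2)
  have h2 := min_le_right ε (1 / 2)
  by_contra hne
  have hI : ¬ IntEq a b := fun h => hne (h.eq_of_abs_lt (by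
    rw [abs_lt]; constructor <;> linarith [ha.1, ha.2, hb.1, hb.2]))
  have hat : a = t := by
    by_contra hat
    refine H (y := a) ?_ hat ⟨a, b, hI, rfl, hab.symm⟩
    rw [Real.dist_eq, abs_lt]; constructor <;> linarith [ha.1, ha.2]
  have hbt : b = t := by
    by_contra hat
    refine H (y := b) ?_ hat ⟨a, b, hI, hab, rfl⟩
    rw [Real.dist_eq, abs_lt]; constructor <;> linarith [hb.1, hb.2]
  exact hne (hat.trans hbt.symm)

end IsCurve

end

section

open Filter

theorem ncard_components_eq_four {Y : Type*} [TopologicalSpace Y] {S : Set Y} {A K : Fin 4 → Set Y}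
    (hS : S = ⋃ i, A i) (hA : ∀ i, IsPreconnected (A i)) (hne : ∀ i, (A i).Nonempty)
    (hK : ∀ i, IsClosed (K i)) (hAK : ∀ i, A i ⊆ K i) (hd : ∀ i j, i ≠ j → Disjoint (A i) (K j)) :
    {C : Set Y | ∃ x ∈ S, C = connectedComponentIn S x}.ncard = 4 := by
  have hAS : ∀ i, A i ⊆ S := fun i => hS ▸ subset_iUnion A i
  have hSK : ∀ i, S ∩ K i ⊆ A i := by
    rintro i x ⟨hx, hxi⟩
    rw [hS, mem_iUnion] at hx
    obtain ⟨j, hj⟩ := hx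
    by_cases h : j = i
    · exact h ▸ hj
    · exact absurd hxi (disjoint_left.1 (hd j i h) hj)
  have hcc : ∀ i, ∀ x ∈ A i, connectedComponentIn S x = A i := by
    intro i x hx
    refine Subset.antisymm ?_ ((hA i).subset_connectedComponentIn hx (hAS i))
    have hpc : IsPreconnected (connectedComponentIn S x) := isPreconnected_connectedComponentIn
    have hcS : connectedComponentIn S x ⊆ S := connectedComponentIn_subset S x
    have hcl : IsClosed (⋃ j : {j : Fin 4 // j ≠ i}, K j) := isClosed_iUnion_of_finite fun j => hK j
    have hxc : x ∈ connectedComponentIn S x := mem_connectedComponentIn (hAS i hx)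
    have hcov : connectedComponentIn S x ⊆ K i ∪ ⋃ j : {j : Fin 4 // j ≠ i}, K j := by
      intro z hz
      have hzS := hcS hz
      rw [hS, mem_iUnion] at hzS
      obtain ⟨j, hj⟩ := hzS
      by_cases h : j = i
      · exact Or.inl (hAK i (h ▸ hj))
      · exact Or.inr (mem_iUnion.2 ⟨⟨j, h⟩, hAK j hj⟩)
    have hdis : connectedComponentIn S x ∩ (K i ∩ ⋃ j : {j : Fin 4 // j ≠ i}, K j) = ∅ := by
      rw [eq_empty_iff_forall_notMem]
      rintro z ⟨hz, hzi, hzj⟩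
      obtain ⟨j, hj⟩ := mem_iUnion.1 hzj
      exact disjoint_left.1 (hd i j (Ne.symm j.2)) (hSK i ⟨hcS hz, hzi⟩) hj
    rcases isPreconnected_iff_subset_of_disjoint_closed.1 hpc _ _ (hK i) hcl hcov hdis with h | h
    · exact fun z hz => hSK i ⟨hcS hz, h hz⟩
    · obtain ⟨j, hj⟩ := mem_iUnion.1 (h hxc)
      exact absurd hj (disjoint_left.1 (hd i j (Ne.symm j.2)) hx)
  have hr : {C : Set Y | ∃ x ∈ S, C = connectedComponentIn S x} = range A := by
    ext C
    constructor
    · rintro ⟨x, hx, rfl⟩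
      rw [hS, mem_iUnion] at hx
      obtain ⟨i, hi⟩ := hx
      exact ⟨i, (hcc i x hi).symm⟩
    · rintro ⟨i, rfl⟩
      obtain ⟨x, hx⟩ := hne i
      exact ⟨x, hAS i hx, (hcc i x hx).symm⟩
  have hinj : Function.Injective A := by
    intro i j hij
    by_contra h
    obtain ⟨x, hx⟩ := hne i
    exact disjoint_left.1 (hd i j h) hx (hAK j (hij ▸ hx))
  rw [hr, ← Nat.card_coe_set_eq, Nat.card_range_of_injective hinj]
  simp

/-- The parameter at distance `u` from a crossing along its `i`-th arm. -/
def armParam (x y : ℝ) (i : Fin 4) (u : ℝ) : ℝ := ![x, x, y, y] i + ![1, -1, 1, -1] i * u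

theorem continuous_armParam (x y : ℝ) (i : Fin 4) : Continuous (armParam x y i) := by
  unfold armParam; fun_prop

theorem armParam_intEq {x y η : ℝ} (hη : 2 * η < 1) (hy : ∀ w, |w| ≤ 2 * η → ¬ IntEq (x + w) y)
    {i j : Fin 4} {u w : ℝ} (hu : u ∈ Icc 0 η) (hw : w ∈ Icc 0 η)
    (h : IntEq (armParam x y i u) (armParam x y j w)) : u = w ∧ (i = j ∨ u = 0) := by
  obtain ⟨hu0, hu1⟩ := hu
  obtain ⟨hw0, hw1⟩ := hw
  have same : ∀ z s t : ℝ, IntEq (z + s) (z + t) → |s| ≤ η → |t| ≤ η → s = t := by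
    intro z s t h hs ht
    rw [abs_le] at hs ht
    have := h.eq_of_abs_lt (by rw [abs_lt]; constructor <;> linarith [hs.1, hs.2, ht.1, ht.2])
    linarith
  have diff : ∀ s t : ℝ, IntEq (x + s) (y + t) → |s| ≤ η → |t| ≤ η → False := by
    rintro s t ⟨n, hn⟩ hs ht
    refine hy (s - t) ((abs_sub _ _).trans (by linarith)) ⟨n, by linarith⟩
  have diff' : ∀ s t : ℝ, IntEq (y + s) (x + t) → |s| ≤ η → |t| ≤ η → False :=
    fun s t h hs ht => diff t s h.symm ht hs
  have au : |u| ≤ η := by rwa [abs_of_nonneg hu0]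
  have aw : |w| ≤ η := by rwa [abs_of_nonneg hw0]
  have au' : |-u| ≤ η := by rwa [abs_neg]
  have aw' : |-w| ≤ η := by rwa [abs_neg]
  unfold armParam at h
  fin_cases i <;> fin_cases j <;> simp at h ⊢ <;>
    first
    | exact (diff _ _ h (by assumption) (by assumption)).elim
    | exact (diff' _ _ h (by assumption) (by assumption)).elim
    | (have := same _ _ _ h (by assumption) (by assumption); constructor <;> linarith)
    | (have := same _ _ _ h (by assumption) (by assumption); linarith)

namespace IsCurve

variable {Y : Type*} [TopologicalSpace Y] [T2Space Y] {f : ℝ → Y}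

theorem exists_arms (hf : IsCurve f) {x y : ℝ} (hxy : ¬ IntEq x y) (he : f x = f y) {V : Set Y}
    (hV : V ∈ 𝓝 (f x)) : ∃ η > 0, 4 * η < 1 ∧
      (∀ i, ∀ u ∈ Icc 0 η, f (armParam x y i u) ∈ V) ∧
      (∀ i, ∀ u ∈ Ioc 0 η, f (armParam x y i u) ∉ doubles f) ∧
      ∀ i j, ∀ u ∈ Icc 0 η, ∀ w ∈ Icc 0 η, f (armParam x y i u) = f (armParam x y j w) →
        u = w ∧ (i = j ∨ u = 0) := by
  have e1 : ∀ᶠ τ in 𝓝 x, (τ ≠ x → f τ ∉ doubles f) ∧ f τ ∈ V ∧ ¬ IntEq τ y :=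
    ((eventually_nhdsWithin_iff.1 (hf.eventually_notMem_doubles x)).and
      ((hf.cont.tendsto x).eventually hV)).and
      ((isClosed_setOf_intEq y).isOpen_compl.mem_nhds hxy) |>.mono fun τ h => ⟨h.1.1, h.1.2, h.2⟩
  have e2 : ∀ᶠ τ in 𝓝 y, (τ ≠ y → f τ ∉ doubles f) ∧ f τ ∈ V :=
    (eventually_nhdsWithin_iff.1 (hf.eventually_notMem_doubles y)).and
      ((hf.cont.tendsto y).eventually (he ▸ hV))
  rw [Metric.eventually_nhds_iff] at e1 e2
  obtain ⟨ε, hε, h1⟩ := e1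
  obtain ⟨ε', hε', h2⟩ := e2
  set η := min (min (ε / 3) (ε' / 3)) (1 / 5) with hη
  have b1 : η ≤ ε / 3 := (min_le_left _ _).trans (min_le_left _ _)
  have b2 : η ≤ ε' / 3 := (min_le_left _ _).trans (min_le_right _ _)
  have b3 : η ≤ 1 / 5 := min_le_right _ _
  have hη0 : 0 < η := by rw [hη]; positivity
  have hdx : ∀ w, |w| ≤ 2 * η → dist (x + w) x < ε := by
    intro w hw; rw [Real.dist_eq, add_sub_cancel_left]; linarith
  have hdy : ∀ w, |w| ≤ 2 * η → dist (y + w) y < ε' := by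
    intro w hw; rw [Real.dist_eq, add_sub_cancel_left]; linarith
  have hall : ∀ i, ∀ u ∈ Icc 0 η, f (armParam x y i u) ∈ V ∧
      (u ≠ 0 → f (armParam x y i u) ∉ doubles f) := by
    intro i u hu
    have a1 : |u| ≤ 2 * η := by rw [abs_of_nonneg hu.1]; linarith [hu.2]
    have a2 : |-u| ≤ 2 * η := by rwa [abs_neg]
    have := h1 (hdx u a1)
    have := h1 (hdx (-u) a2)
    have := h2 (hdy u a1)
    have := h2 (hdy (-u) a2)
    unfold armParam
    fin_cases i <;> simp_all
  refine ⟨η, hη0, by linarith, fun i u hu => (hall i u hu).1,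
    fun i u hu => (hall i u ⟨hu.1.le, hu.2⟩).2 hu.1.ne', ?_⟩
  intro i j u hu w hw h
  have hh : ∀ w, |w| ≤ 2 * η → ¬ IntEq (x + w) y := fun w hw => (h1 (hdx w hw)).2.2
  have key : IntEq (armParam x y i u) (armParam x y j w) → u = w ∧ (i = j ∨ u = 0) :=
    armParam_intEq (by linarith) hh hu hw
  by_cases hI : IntEq (armParam x y i u) (armParam x y j w)
  · exact key hI
  · have d1 : f (armParam x y i u) ∈ doubles f := ⟨_, _, hI, rfl, h.symm⟩
    have d2 : f (armParam x y j w) ∈ doubles f := ⟨_, _, hI, h, rfl⟩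
    have z1 : u = 0 := by by_contra h0; exact (hall i u hu).2 h0 d1
    have z2 : w = 0 := by by_contra h0; exact (hall j w hw).2 h0 d2
    exact ⟨z1.trans z2.symm, Or.inr z1⟩

theorem transverse (hf : IsCurve f) {x y : ℝ} (hxy : ¬ IntEq x y) (he : f x = f y) {V : Set Y}
    (hV : V ∈ 𝓝 (f x)) : ∃ U ∈ 𝓝 (f x), U ⊆ V ∧
      {C : Set Y | ∃ z ∈ (U ∩ range f) \ {f x},
        C = connectedComponentIn ((U ∩ range f) \ {f x}) z}.ncard = 4 := by
  obtain ⟨η, hη, hη4, hVa, hnd, hinj⟩ := hf.exists_arms hxy he hV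
  set R : Set ℝ := {τ | ∀ z, (IntEq z x ∨ IntEq z y) → η ≤ |τ - z|} with hR
  have hRc : IsClosed R := by
    have : R = ⋂ z, ⋂ (_ : IntEq z x ∨ IntEq z y), {τ | η ≤ |τ - z|} := by
      ext τ; simp [hR]
    rw [this]
    exact isClosed_iInter fun z => isClosed_iInter fun _ =>
      isClosed_le continuous_const (by fun_prop)
  have hfR : IsClosed (f '' (Icc 0 1 ∩ R)) :=
    ((isCompact_Icc.inter_right hRc).image hf.cont).isClosed
  have hpx : ∀ τ, f τ = f x → IntEq τ x ∨ IntEq τ y := by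
    intro τ hτ
    rcases hf.tri τ x y hτ he with h | h | h
    exacts [Or.inl h, absurd h hxy, Or.inr h]
  have hp : f x ∉ f '' (Icc 0 1 ∩ R) := by
    rintro ⟨τ, ⟨-, hτ⟩, hτx⟩
    have := hτ τ (hpx τ hτx)
    rw [sub_self, abs_zero] at this
    linarith
  have hbase : ∀ i, IntEq (![x, x, y, y] i) x ∨ IntEq (![x, x, y, y] i) y := by
    intro i; fin_cases i <;> simp [IntEq.refl]
  have h0 : ∀ i, f (armParam x y i 0) = f x := by
    intro i; unfold armParam; fin_cases i <;> simp [he]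
  refine ⟨V ∩ (f '' (Icc 0 1 ∩ R))ᶜ, inter_mem hV (hfR.isOpen_compl.mem_nhds hp),
    inter_subset_left, ?_⟩
  refine ncard_components_eq_four (A := fun i => (fun u => f (armParam x y i u)) '' Ioo 0 η)
    (K := fun i => (fun u => f (armParam x y i u)) '' Icc 0 η) ?_ ?_ ?_ ?_ ?_ ?_
  · ext q
    rw [mem_iUnion]
    constructor
    · rintro ⟨⟨⟨hqV, hqR⟩, τ, rfl⟩, hqx⟩
      have hfr : f (Int.fract τ) = f τ := hf.per.map_intEq (intEq_fract τ)
      have hnR : Int.fract τ ∉ R := fun h =>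
        hqR ⟨_, ⟨⟨Int.fract_nonneg _, (Int.fract_lt_one _).le⟩, h⟩, hfr⟩
      simp only [hR, mem_ofPred_eq, not_forall, not_le] at hnR
      obtain ⟨z, hz, hzη⟩ := hnR
      set u := Int.fract τ - z with hu
      have hu0 : u ≠ 0 := by
        intro h
        apply hqx
        rw [mem_singleton_iff, ← hfr, show Int.fract τ = z by linarith]
        rcases hz with hz | hz
        · exact hf.per.map_intEq hz
        · exact (hf.per.map_intEq hz).trans he.symm
      have hval : ∀ c, IntEq z c → f (c + u) = f τ := by
        rintro c ⟨n, hn⟩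
        rw [← hfr]
        exact hf.per.map_intEq ⟨-n, by push_cast; linarith⟩
      rw [abs_lt] at hzη
      rcases hz with hz | hz <;> rcases lt_or_gt_of_ne hu0 with hs | hs
      · exact ⟨1, -u, ⟨by linarith, by linarith⟩, by simpa [armParam] using hval _ hz⟩
      · exact ⟨0, u, ⟨by linarith, by linarith⟩, by simpa [armParam] using hval _ hz⟩
      · exact ⟨3, -u, ⟨by linarith, by linarith⟩, by simpa [armParam] using hval _ hz⟩
      · exact ⟨2, u, ⟨by linarith, by linarith⟩, by simpa [armParam] using hval _ hz⟩
    · rintro ⟨i, u, hu, rfl⟩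
      have hn := hnd i u ⟨hu.1, hu.2.le⟩
      refine ⟨⟨⟨hVa i u ⟨hu.1.le, hu.2.le⟩, ?_⟩, mem_range_self _⟩, ?_⟩
      · rintro ⟨τ, ⟨-, hτ⟩, hτu⟩
        have hI : IntEq τ (armParam x y i u) := by
          by_contra h
          exact hn ⟨_, _, h, hτu, rfl⟩
        obtain ⟨n, hn⟩ := hI
        have hz : IntEq (![x, x, y, y] i + n) (![x, x, y, y] i) := ⟨n, rfl⟩
        have h3 := hτ (![x, x, y, y] i + n) ((hbase i).imp hz.trans hz.trans)
        rw [hn, armParam, show ∀ a b c : ℝ, a + b + c - (a + c) = b by intros; ring, abs_mul] at h3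
        have h4 : |(![1, -1, 1, -1] i : ℝ)| = 1 := by fin_cases i <;> simp
        rw [h4, one_mul, abs_of_pos hu.1] at h3
        linarith [hu.2]
      · intro h
        exact hn ⟨x, y, hxy, h.symm, he.symm.trans h.symm⟩
  · intro i
    exact isPreconnected_Ioo.image _ (hf.cont.comp (continuous_armParam x y i)).continuousOn
  · intro i
    exact (nonempty_Ioo.2 hη).image _
  · intro i
    exact (isCompact_Icc.image (hf.cont.comp (continuous_armParam x y i))).isClosed
  · intro i
    exact image_mono Ioo_subset_Icc_self
  · intro i j hij
    rw [disjoint_left]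
    rintro _ ⟨u, hu, rfl⟩ ⟨w, hw, hwu⟩
    rcases (hinj i j u ⟨hu.1.le, hu.2.le⟩ w hw hwu.symm).2 with h | h
    · exact hij h
    · exact hu.1.ne' h

end IsCurve

/-- A closed curve on the sphere with finitely many double points is a knot projection. -/
def IsCurve.toKnotProjection {f : ℝ → SPt} (hf : IsCurve f) : KnotProjection where
  f := f
  periodic := hf.per
  continuous' := hf.cont
  loc_inj := hf.loc_inj
  fiber_finite p := (hf.finite_fiber p).1
  fiber_le_two p := (hf.finite_fiber p).2
  double_finite := by
    refine hf.fin.subset fun p hp => ?_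
    exact (mem_doubles_iff hf.per (fun p => (hf.finite_fiber p).1)
      (fun p => (hf.finite_fiber p).2) p).2 hp
  transverse p hp V hV := by
    obtain ⟨x, y, hxy, rfl, hy⟩ := (mem_doubles_iff hf.per (fun p => (hf.finite_fiber p).1)
      (fun p => (hf.finite_fiber p).2) p).2 hp
    exact hf.transverse hxy hy.symm hV

namespace KnotProjection

theorem crossings_eq_doubles (P : KnotProjection) : P.crossings = doubles P.f := by
  ext p
  exact (mem_doubles_iff P.periodic P.fiber_finite P.fiber_le_two p).symm

theorem isCurve (P : KnotProjection) : IsCurve P.f where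
  cont := P.continuous'
  per := P.periodic
  tri x y z hxy hyz := by
    by_contra! h
    have key : 3 ≤ {t | t ∈ Ico (0 : ℝ) 1 ∧ P.f t = P.f x}.ncard := by
      have hI : ∀ a b, ¬ IntEq a b → Int.fract a ≠ Int.fract b := fun a b hab h =>
        hab ((intEq_fract a).symm.trans (h ▸ intEq_fract b))
      have hm : ∀ a, P.f a = P.f x → Int.fract a ∈ {t | t ∈ Ico (0 : ℝ) 1 ∧ P.f t = P.f x} :=
        fun a ha => ⟨⟨Int.fract_nonneg _, Int.fract_lt_one _⟩,
          (P.periodic.map_intEq (intEq_fract a)).trans ha⟩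
      rw [← ncard_eq_three.2 ⟨_, _, _, hI x y h.1, hI x z h.2.2, hI y z h.2.1, rfl⟩]
      refine ncard_le_ncard ?_ (P.fiber_finite _)
      rintro _ (rfl | rfl | rfl)
      exacts [hm x rfl, hm y hxy.symm, hm z (hxy.trans hyz).symm]
    have := P.fiber_le_two (P.f x)
    omega
  fin := P.crossings_eq_doubles ▸ P.double_finite

end KnotProjection

end

section

open Filter

theorem exists_sphere_chart (v : SPt) : ∃ e : ℂ → SPt, IsOpenEmbedding e ∧ range e = {v}ᶜ ∧
    Tendsto e (Bornology.cobounded ℂ) (𝓝 v) := by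
  have hv : ‖(v : E3)‖ = 1 := mem_sphere_zero_iff_norm.1 v.2
  have : Fact (Module.finrank ℝ E3 = 2 + 1) := ⟨by simp⟩
  have hv0 : (v : E3) ≠ 0 := by
    intro h; rw [h, norm_zero] at hv; exact zero_ne_one hv
  have hrank : Module.finrank ℝ ℂ = Module.finrank ℝ ((Submodule.span ℝ {(v : E3)})ᗮ) := by
    rw [Submodule.finrank_orthogonal_span_singleton (n := 2) hv0, Complex.finrank_real_complex]
  let L : ℂ ≃L[ℝ] ((Submodule.span ℝ {(v : E3)})ᗮ) := ContinuousLinearEquiv.ofFinrankEq hrank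
  let e : ℂ → SPt := fun z => (stereographic hv).symm (L z)
  have he : IsOpenEmbedding e :=
    (isOpenEmbedding_stereographic_symm hv).comp L.toHomeomorph.isOpenEmbedding
  have hr : range e = {v}ᶜ := by
    have h1 : range e = range (stereographic hv).symm := by
      refine L.surjective.range_comp (stereographic hv).symm
    rw [h1]
    exact range_stereographic_symm hv v.2
  have : CompactSpace SPt := inferInstanceAs (CompactSpace (Metric.sphere (0 : E3) 1))
  refine ⟨e, he, hr, ?_⟩
  intro V hV
  obtain ⟨U, hUV, hU, hvU⟩ := mem_nhds_iff.1 hV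
  have hK : IsCompact (e ⁻¹' Uᶜ) := he.isInducing.isCompact_preimage'
    hU.isClosed_compl.isCompact (by
      rw [hr]; intro z hz h; rw [mem_singleton_iff] at h; exact hz (h ▸ hvU))
  rw [mem_map]
  have := hK.isBounded
  rw [← Bornology.isCobounded_compl_iff] at this
  filter_upwards [this] with z hz
  by_contra h
  exact hz fun h' => h (hUV h')

section reparam

variable {φ : ℝ → ℝ}

theorem map_add_intCast (h1 : ∀ t, φ (t + 1) = φ t + 1) (t : ℝ) (n : ℤ) :
    φ (t + n) = φ t + n := by
  have hp : Function.Periodic (fun t => φ t - t) 1 := fun t => by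
    simp only [h1]; ring
  have := hp.int_mul n t
  simp only [mul_one] at this
  linarith

theorem intEq_of_map (hφ : Function.Injective φ) (h1 : ∀ t, φ (t + 1) = φ t + 1) {x y : ℝ}
    (h : IntEq (φ x) (φ y)) : IntEq x y := by
  obtain ⟨n, hn⟩ := h
  rw [← map_add_intCast h1] at hn
  exact ⟨n, hφ hn⟩

theorem IntEq.map (h1 : ∀ t, φ (t + 1) = φ t + 1) {x y : ℝ} (h : IntEq x y) :
    IntEq (φ x) (φ y) := by
  obtain ⟨n, rfl⟩ := h
  exact ⟨n, map_add_intCast h1 _ _⟩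

theorem surjective_of_map_add_one (hc : Continuous φ) (h1 : ∀ t, φ (t + 1) = φ t + 1) :
    Function.Surjective φ := by
  intro y
  set n := ⌊y - φ 0⌋
  have e : ∀ m : ℤ, φ m = φ 0 + m := fun m => by
    have := map_add_intCast h1 0 m
    rwa [zero_add] at this
  have hy : y ∈ Icc (φ (n : ℝ)) (φ ((n + 1 : ℤ) : ℝ)) := by
    rw [e, e]
    push_cast
    constructor <;> linarith [Int.floor_le (y - φ 0), Int.lt_floor_add_one (y - φ 0)]
  obtain ⟨x, -, hx⟩ := intermediate_value_Icc (by push_cast; linarith) hc.continuousOn hy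
  exact ⟨x, hx⟩

/-- A reparametrization of the circle taking `0` and `1 / 2` to prescribed points. -/
theorem exists_reparam {s t : ℝ} (hst : s < t) (hts : t < s + 1) : ∃ φ : ℝ → ℝ,
    StrictMono φ ∧ Continuous φ ∧ (∀ x, φ (x + 1) = φ x + 1) ∧ φ 0 = s ∧ φ (1 / 2) = t := by
  set d : ℝ → ℝ := fun x => ‖(x : AddCircle (1 : ℝ))‖ with hd
  have hlip : ∀ x y, |d x - d y| ≤ |x - y| := by
    intro x y
    have h1 := abs_norm_sub_norm_le (x : AddCircle (1 : ℝ)) (y : AddCircle (1 : ℝ))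
    have h2 : ‖((x - y : ℝ) : AddCircle (1 : ℝ))‖ ≤ ‖x - y‖ :=
      QuotientAddGroup.norm_mk_le_norm
    rw [AddCircle.coe_sub, Real.norm_eq_abs] at h2
    exact h1.trans h2
  have hdc : Continuous d := by
    refine continuous_norm.comp (AddCircle.continuous_mk' _)
  have hd0 : d 0 = 0 := by simp [hd]
  have hd1 : d (1 / 2) = 1 / 2 := by
    simp only [hd]
    rw [AddCircle.norm_half_period_eq]; simp
  have hdp : ∀ x, d (x + 1) = d x := fun x => by
    simp only [hd]; rw [AddCircle.coe_add_period]
  set c := 2 * (t - s - 1 / 2) with hc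
  have hc1 : |c| < 1 := by rw [abs_lt]; constructor <;> linarith
  refine ⟨fun x => s + x + c * d x, ?_, by fun_prop, fun x => ?_, by simp [hd0], ?_⟩
  · intro x y hxy
    have h1 : |c * (d x - d y)| ≤ |c| * |x - y| := by
      rw [abs_mul]; exact mul_le_mul_of_nonneg_left (hlip x y) (abs_nonneg c)
    have h2 : |c| * |x - y| < y - x := by
      rw [abs_sub_comm, abs_of_pos (sub_pos.2 hxy)]
      nlinarith
    have h3 := (abs_le.1 (h1.trans h2.le))
    have h4 := (abs_lt.1 (h1.trans_lt h2))
    show s + x + c * d x < s + y + c * d y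
    nlinarith [h4.2]
  · simp only [hdp]; ring
  · simp only [hd1, hc]; ring

end reparam

theorem IsCurve.comp_reparam {Y : Type*} [TopologicalSpace Y] {f : ℝ → Y} (hf : IsCurve f)
    (h : Y ≃ₜ Y) {φ : ℝ → ℝ} (hm : StrictMono φ) (hc : Continuous φ)
    (h1 : ∀ t, φ (t + 1) = φ t + 1) : IsCurve fun t => h (f (φ t)) where
  cont := h.continuous.comp (hf.cont.comp hc)
  per t := by simp only [h1]; rw [hf.per]
  tri x y z hxy hyz := by
    rcases hf.tri _ _ _ (h.injective hxy) (h.injective hyz) with g | g | g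
    exacts [Or.inl (intEq_of_map hm.injective h1 g), Or.inr (Or.inl (intEq_of_map hm.injective h1 g)),
      Or.inr (Or.inr (intEq_of_map hm.injective h1 g))]
  fin := by
    refine (hf.fin.image h).subset ?_
    rintro p ⟨x, y, hxy, rfl, hy⟩
    exact ⟨f (φ x), ⟨φ x, φ y, fun g => hxy (intEq_of_map hm.injective h1 g), rfl,
      h.injective hy⟩, rfl⟩

theorem ProjEquiv.ncard_crossings {P Q : KnotProjection} (h : ProjEquiv P Q) :
    P.crossings.ncard = Q.crossings.ncard := by
  obtain ⟨h, φ, hm, hc, h1, he⟩ := h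
  rw [P.crossings_eq_doubles, Q.crossings_eq_doubles]
  have : doubles Q.f = h '' doubles P.f := by
    ext p
    constructor
    · rintro ⟨a, b, hab, ha, hb⟩
      obtain ⟨x, rfl⟩ := surjective_of_map_add_one hc h1 a
      obtain ⟨y, rfl⟩ := surjective_of_map_add_one hc h1 b
      refine ⟨P.f x, ⟨x, y, fun g => hab (g.map h1), rfl, h.injective ?_⟩, by rw [he, ha]⟩
      rw [he, he, ha, hb]
    · rintro ⟨_, ⟨x, y, hxy, rfl, hy⟩, rfl⟩
      exact ⟨φ x, φ y, fun g => hxy (intEq_of_map hm.injective h1 g), (he x).symm,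
        by rw [← he, hy]⟩
  rw [this, ncard_image_of_injective _ h.injective]

theorem ProjEquiv.refl (P : KnotProjection) : ProjEquiv P P :=
  ⟨Homeomorph.refl _, id, strictMono_id, continuous_id, fun _ => rfl, fun _ => rfl⟩

end

section

open Filter

/-- The four directions of the standard cross in the plane. -/
noncomputable def crossDir : Fin 4 → ℂ := ![1, Complex.I, -1, -Complex.I]

theorem norm_crossDir (i : Fin 4) : ‖crossDir i‖ = 1 := by
  fin_cases i <;> simp [crossDir]

theorem crossDir_injective : Function.Injective crossDir := by
  intro i j h
  have h1 := congrArg Complex.re h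
  have h2 := congrArg Complex.im h
  fin_cases i <;> fin_cases j <;> simp [crossDir] at h1 h2 ⊢ <;>
    first | (norm_num at h1; done) | norm_num at h2

theorem ofReal_mul_crossDir_inj {i j : Fin 4} {s t : ℝ} (hs : 0 ≤ s) (ht : 0 ≤ t)
    (h : (s : ℂ) * crossDir i = t * crossDir j) : s = t ∧ (i = j ∨ s = 0) := by
  have h1 : s = t := by
    have := congrArg norm h
    rwa [norm_mul, norm_mul, norm_crossDir, norm_crossDir, mul_one, mul_one, Complex.norm_real,
      Complex.norm_real, Real.norm_of_nonneg hs, Real.norm_of_nonneg ht] at this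
  refine ⟨h1, ?_⟩
  by_cases h0 : s = 0
  · exact Or.inr h0
  · left
    subst h1
    exact crossDir_injective (mul_left_cancel₀ (Complex.ofReal_ne_zero.2 h0) h)

theorem isStar_crossDir {Y : Type*} [TopologicalSpace Y] {e : ℂ → Y}
    (he : IsOpenEmbedding e) : IsStar (fun i s => e ((s : ℂ) * crossDir i)) (e 0) where
  cont i := (he.continuous.comp (by fun_prop)).continuousOn
  zero i := by simp
  inj i j s t hs ht h := ofReal_mul_crossDir_inj hs.1 ht.1 (he.injective h)

theorem KnotProjection.exists_straight (Q : KnotProjection) (hQ : Q.crossings.Nonempty) :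
    ∃ (Q' : KnotProjection) (e : ℂ → SPt) (π : Equiv.Perm (Fin 4)) (δ : ℝ),
      ProjEquiv Q' Q ∧ IsOpenEmbedding e ∧ 0 < δ ∧ 4 * δ < 1 ∧
      (∀ i, ∀ u ∈ Icc (0 : ℝ) 1, Q'.f (armParam 0 (1 / 2) i (δ * u)) = e (u * crossDir (π i))) ∧
      ∀ x, x ∈ Ioo δ (1 / 2 - δ) ∨ x ∈ Ioo (1 / 2 + δ) (1 - δ) →
        Q'.f x ∉ e '' Metric.closedBall 0 1 := by
  obtain ⟨q, hq⟩ := hQ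
  rw [Q.crossings_eq_doubles] at hq
  obtain ⟨s, t₀, hst, hs, ht₀⟩ := hq
  obtain ⟨t, hst1, hts1, ht⟩ : ∃ t, s < t ∧ t < s + 1 ∧ Q.f t = q := by
    refine ⟨s + Int.fract (t₀ - s), ?_, by linarith [Int.fract_lt_one (t₀ - s)], ?_⟩
    · have h0 : Int.fract (t₀ - s) ≠ 0 := by
        intro h
        obtain ⟨n, hn⟩ := intEq_fract (t₀ - s)
        exact hst ⟨n, by linarith⟩
      have := lt_of_le_of_ne (Int.fract_nonneg (t₀ - s)) h0.symm
      linarith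
    · rw [← ht₀]
      obtain ⟨n, hn⟩ := intEq_fract (t₀ - s)
      exact Q.periodic.map_intEq ⟨n, by linarith⟩
  obtain ⟨φ, hm, hc, h1, h0, h2⟩ := exists_reparam hst1 hts1
  have hG : IsCurve (fun x => Q.f (φ x)) :=
    Q.isCurve.comp_reparam (Homeomorph.refl SPt) hm hc h1
  set G : ℝ → SPt := fun x => Q.f (φ x) with hGd
  have hG0 : G 0 = q := by simp [hGd, h0, hs]
  have hG2 : G (1 / 2) = q := by simp only [hGd, h2, ht]
  have hI : ¬ IntEq (0 : ℝ) (1 / 2) := fun h => by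
    have := h.eq_of_abs_lt (by norm_num [abs_lt])
    norm_num at this
  obtain ⟨v, hv⟩ : ∃ v : SPt, v ≠ q := by
    refine ⟨⟨-(q : E3), ?_⟩, fun h => ?_⟩
    · exact mem_sphere_zero_iff_norm.2 ((norm_neg _).trans (mem_sphere_zero_iff_norm.1 q.2))
    · have h3 : -(q : E3) = q := congrArg Subtype.val h
      have h6 : (2 : ℝ) • (q : E3) = 0 := by
        rw [two_smul]; nth_rewrite 1 [← h3]; exact neg_add_cancel _
      have h4 : (q : E3) = 0 := (smul_eq_zero.1 h6).resolve_left two_ne_zero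
      have h5 := mem_sphere_zero_iff_norm.1 q.2
      rw [h4, norm_zero] at h5
      exact zero_ne_one h5
  obtain ⟨e, he, her, hev⟩ := exists_sphere_chart v
  obtain ⟨η, hη, hη4, hVa, -, hinj⟩ := hG.exists_arms hI (hG0.trans hG2.symm)
    (isOpen_compl_singleton.mem_nhds (show G 0 ∈ ({v}ᶜ : Set SPt) from fun h =>
      hv (by rw [← hG0]; exact (mem_singleton_iff.1 h).symm)))
  have hIcc : ∀ u ∈ Icc (0 : ℝ) 1, η * u ∈ Icc 0 η := fun u hu =>
    ⟨mul_nonneg hη.le hu.1, by nlinarith [hu.2]⟩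
  have hstar : IsStar (fun i u => G (armParam 0 (1 / 2) i (η * u))) q :=
    { cont := fun i => by
        have := hG.cont.comp ((continuous_armParam 0 (1 / 2) i).comp
          (show Continuous fun u : ℝ => η * u by fun_prop))
        exact this.continuousOn
      zero := fun i => by
        rw [← hG0]
        unfold armParam
        fin_cases i <;> simp [hG0, -one_div, hG2]
      inj := fun i j a b ha hb h => by
        obtain ⟨h3, h4⟩ := hinj i j _ (hIcc a ha) _ (hIcc b hb) h
        refine ⟨mul_left_cancel₀ hη.ne' h3, h4.imp_right fun h5 => ?_⟩
        exact (mul_eq_zero.1 h5).resolve_left hη.ne' }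
  have hT2 : T2Space SPt := inferInstance
  obtain ⟨h, π, hπ⟩ := hstar.exists_homeomorph (isStar_crossDir he) he.isEmbedding her hev
    (by
      intro hmem
      obtain ⟨i, u, hu, huv⟩ := mem_iUnion.1 hmem
      exact hVa i _ (hIcc u hu) huv) he.isEmbedding her hev
    (by
      intro hmem
      obtain ⟨i, u, hu, huv⟩ := mem_iUnion.1 hmem
      have : v ∈ range e := ⟨_, huv⟩
      rw [her] at this
      exact this rfl)
  have hF : IsCurve (fun x => h (Q.f (φ x))) := Q.isCurve.comp_reparam h hm hc h1
  have hπ' : ∀ i, ∀ u ∈ Icc (0 : ℝ) 1,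
      h (G (armParam 0 (1 / 2) i (η * u))) = e (u * crossDir (π i)) := hπ
  have hhq : h q = e 0 := by
    have := hπ' 0 0 (by simp)
    simpa [armParam, hG0] using this
  set K : Set ℝ := Icc η (1 / 2 - η) ∪ Icc (1 / 2 + η) (1 - η) with hK
  have hKc : IsClosed ((fun x => h (G x)) '' K) :=
    ((isCompact_Icc.union isCompact_Icc).image hF.cont).isClosed
  have h0K : e 0 ∉ (fun x => h (G x)) '' K := by
    rintro ⟨x, hx, hxe⟩
    have h3 : G x = q := h.injective (hxe.trans hhq.symm)
    have hne : ∀ n : ℤ, x = n → False := by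
      rintro n rfl
      have : (0 : ℝ) < n ∧ (n : ℝ) < 1 := by
        rcases hx with hx | hx <;> constructor <;> linarith [hx.1, hx.2]
      have h4 : (0 : ℤ) < n := by exact_mod_cast this.1
      have h5 : n < (1 : ℤ) := by exact_mod_cast this.2
      omega
    rcases hG.tri x 0 (1 / 2) (h3.trans hG0.symm) (hG0.trans hG2.symm) with ⟨n, hn⟩ | g | g
    · exact hne n (by linarith)
    · exact hI g
    · have := g.eq_of_abs_lt (by
        rw [abs_lt]
        rcases hx with hx | hx <;> constructor <;> linarith [hx.1, hx.2])
      rcases hx with hx | hx <;> linarith [hx.1, hx.2]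
  obtain ⟨r, hr, hrK⟩ := Metric.isOpen_iff.1 (hKc.isOpen_compl.preimage he.continuous) 0 h0K
  set ε := min (r / 2) (1 / 2) with hε
  have hε0 : 0 < ε := by rw [hε]; positivity
  have hεr : ε < r := (min_le_left _ _).trans_lt (by linarith)
  have hε1 : ε < 1 := (min_le_right _ _).trans_lt (by norm_num)
  have hεη : ε * η < η := by nlinarith
  have hball : ∀ z : ℂ, ‖z‖ ≤ ε → e z ∉ (fun x => h (G x)) '' K := fun z hz =>
    hrK (by rw [mem_ball_zero_iff]; linarith)
  have hscale : IsOpenEmbedding fun z : ℂ => e (ε * z) :=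
    he.comp (Homeomorph.mulLeft₀ (ε : ℂ) (Complex.ofReal_ne_zero.2 hε0.ne')).isOpenEmbedding
  have hmemball : ∀ y, y ∈ (fun z : ℂ => e (ε * z)) '' Metric.closedBall 0 1 →
      ∃ z : ℂ, ‖z‖ ≤ ε ∧ e z = y := by
    rintro _ ⟨z, hz, rfl⟩
    refine ⟨_, ?_, rfl⟩
    rw [mem_closedBall_zero_iff] at hz
    rw [norm_mul, Complex.norm_real, Real.norm_of_nonneg hε0.le]
    nlinarith
  refine ⟨hF.toKnotProjection, fun z => e (ε * z), π, ε * η, ?_, hscale, by positivity,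
    by linarith, ?_, ?_⟩
  · exact ⟨h.symm, φ, hm, hc, h1, fun x => h.symm_apply_apply _⟩
  · intro i u hu
    have h3 := hπ' i (ε * u) ⟨by nlinarith [hu.1], by nlinarith [hu.1, hu.2]⟩
    rw [show ε * η * u = η * (ε * u) by ring]
    refine h3.trans ?_
    push_cast
    rw [mul_assoc]
  · intro x hx hmem
    obtain ⟨z, hz, hze⟩ := hmemball _ hmem
    have harm : ∀ i u, ε * η < u → u < η → armParam 0 (1 / 2) i u = x → False := by
      intro i u hu hu' hux
      have hu0 : 0 < u := lt_trans (by positivity) hu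
      have h3 := hπ' i (u / η) ⟨by positivity, by rw [div_le_one hη]; exact hu'.le⟩
      rw [mul_div_cancel₀ _ hη.ne', hux] at h3
      have h4 := he.injective (hze.trans h3)
      rw [h4, norm_mul, norm_crossDir, mul_one, Complex.norm_real,
        Real.norm_of_nonneg (by positivity), div_le_iff₀ hη] at hz
      linarith
    have hnK : x ∉ K := fun hxK => hball z hz ⟨x, hxK, hze.symm⟩
    have hshift : ∀ u, ε * η < u → u < η → armParam 0 (1 / 2) 1 u = x - 1 → False := by
      intro u hu hu' hux
      have hu0 : 0 < u := lt_trans (by positivity) hu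
      have h3 := hπ' 1 (u / η) ⟨by positivity, by rw [div_le_one hη]; exact hu'.le⟩
      rw [mul_div_cancel₀ _ hη.ne', hux, hG.per.sub_eq] at h3
      have h4 := he.injective (hze.trans h3)
      rw [h4, norm_mul, norm_crossDir, mul_one, Complex.norm_real,
        Real.norm_of_nonneg (by positivity), div_le_iff₀ hη] at hz
      linarith
    rcases hx with hx | hx
    · rcases lt_or_ge x η with g | g
      · exact harm 0 x hx.1 g (by simp [armParam])
      · rcases lt_or_ge (1 / 2 - η) x with g' | g'
        · exact harm 3 (1 / 2 - x) (by linarith [hx.2]) (by linarith) (by simp [armParam])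
        · exact hnK (Or.inl ⟨g, g'⟩)
    · rcases lt_or_ge x (1 / 2 + η) with g | g
      · exact harm 2 (x - 1 / 2) (by linarith [hx.1]) (by linarith) (by simp [armParam])
      · rcases lt_or_ge (1 - η) x with g' | g'
        · exact hshift (1 - x) (by linarith [hx.2]) (by linarith) (by simp [armParam])
        · exact hnK (Or.inr ⟨g, g'⟩)

end

section

open Filter

theorem normSq_crossDir {i j : Fin 4} (h : j ≠ i) (h' : j ≠ i + 2) (a b : ℝ) :
    Complex.normSq (a * crossDir i + b * crossDir j) = a ^ 2 + b ^ 2 := by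
  fin_cases i <;> fin_cases j <;>
    first
    | exact absurd rfl h
    | exact absurd rfl h'
    | (simp [crossDir, Complex.normSq_apply]; ring)

theorem crossDir_add_two (i : Fin 4) : crossDir (i + 2) = -crossDir i := by
  fin_cases i <;> simp [crossDir]

/-- A parametrized chord between two tips of the cross. -/
noncomputable def chord (i j : Fin 4) (u : ℝ) : ℂ :=
  ((1 + u) / 2 : ℝ) * crossDir i + ((1 - u) / 2 : ℝ) * crossDir j

/-- Two arms of the cross, parametrized as a single arc. -/
noncomputable def bend (i j : Fin 4) (u : ℝ) : ℂ :=
  (max u 0 : ℝ) * crossDir i + (max (-u) 0 : ℝ) * crossDir j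

theorem continuous_chord (i j : Fin 4) : Continuous (chord i j) := by
  unfold chord; fun_prop

theorem continuous_bend (i j : Fin 4) : Continuous (bend i j) := by
  unfold bend; fun_prop

theorem chord_one (i j : Fin 4) : chord i j 1 = crossDir i := by
  simp [chord]

theorem chord_neg_one (i j : Fin 4) : chord i j (-1) = crossDir j := by
  unfold chord; norm_num

theorem normSq_chord {i j : Fin 4} (h : j ≠ i) (h' : j ≠ i + 2) (u : ℝ) :
    Complex.normSq (chord i j u) = (1 + u ^ 2) / 2 := by
  rw [chord, normSq_crossDir h h']; ring

theorem norm_chord_le {i j : Fin 4} (h : j ≠ i) (h' : j ≠ i + 2) {u : ℝ}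
    (hu : u ∈ Icc (-1 : ℝ) 1) : ‖chord i j u‖ ≤ 1 := by
  rw [← sq_le_one_iff₀ (norm_nonneg _), ← Complex.normSq_eq_norm_sq, normSq_chord h h']
  nlinarith [hu.1, hu.2]

theorem norm_chord_lt {i j : Fin 4} (h : j ≠ i) (h' : j ≠ i + 2) {u : ℝ}
    (hu : u ∈ Ioo (-1 : ℝ) 1) : ‖chord i j u‖ < 1 := by
  rw [← sq_lt_one_iff₀ (norm_nonneg _), ← Complex.normSq_eq_norm_sq, normSq_chord h h']
  nlinarith [hu.1, hu.2]

theorem chord_injective {i j : Fin 4} (h : j ≠ i) : Function.Injective (chord i j) := by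
  intro u w huw
  have h1 : ((u - w : ℝ) : ℂ) * (crossDir i - crossDir j) = 0 := by
    have h2 := sub_eq_zero.2 huw
    unfold chord at h2
    push_cast at h2 ⊢
    linear_combination 2 * h2
  rcases mul_eq_zero.1 h1 with h2 | h2
  · exact sub_eq_zero.1 (Complex.ofReal_eq_zero.1 h2)
  · exact absurd (crossDir_injective (sub_eq_zero.1 h2)).symm h

theorem perm_opposite (σ : Equiv.Perm (Fin 4)) (h : σ 1 ≠ σ 0 + 2) :
    σ 3 ≠ σ 2 + 2 ∧
      ((σ 2 = σ 0 + 2 ∧ σ 3 = σ 1 + 2) ∨ (σ 2 = σ 1 + 2 ∧ σ 3 = σ 0 + 2)) := by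
  have key : ∀ a b c d : Fin 4, a ≠ b → a ≠ c → a ≠ d → b ≠ c → b ≠ d → c ≠ d → b ≠ a + 2 →
      d ≠ c + 2 ∧ ((c = a + 2 ∧ d = b + 2) ∨ (c = b + 2 ∧ d = a + 2)) := by decide
  exact key _ _ _ _ (σ.injective.ne (by decide)) (σ.injective.ne (by decide))
    (σ.injective.ne (by decide)) (σ.injective.ne (by decide)) (σ.injective.ne (by decide))
    (σ.injective.ne (by decide)) h

theorem chord_ne_chord (σ : Equiv.Perm (Fin 4)) (h : σ 1 ≠ σ 0 + 2) (u w : ℝ) :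
    chord (σ 0) (σ 1) u ≠ chord (σ 2) (σ 3) w := by
  intro he
  have h01 : σ 1 ≠ σ 0 := σ.injective.ne (by decide)
  rcases (perm_opposite σ h).2 with ⟨h2, h3⟩ | ⟨h2, h3⟩
  · have h4 : (((1 + u) / 2 + (1 + w) / 2 : ℝ) : ℂ) * crossDir (σ 0) +
        (((1 - u) / 2 + (1 - w) / 2 : ℝ) : ℂ) * crossDir (σ 1) = 0 := by
      unfold chord at he
      rw [h2, h3, crossDir_add_two, crossDir_add_two] at he
      push_cast at he ⊢
      linear_combination he
    have h5 := normSq_crossDir h01 h ((1 + u) / 2 + (1 + w) / 2) ((1 - u) / 2 + (1 - w) / 2)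
    rw [h4, Complex.normSq_zero] at h5
    nlinarith [sq_nonneg ((1 + u) / 2 + (1 + w) / 2 - ((1 - u) / 2 + (1 - w) / 2))]
  · have h4 : (((1 + u) / 2 + (1 - w) / 2 : ℝ) : ℂ) * crossDir (σ 0) +
        (((1 - u) / 2 + (1 + w) / 2 : ℝ) : ℂ) * crossDir (σ 1) = 0 := by
      unfold chord at he
      rw [h2, h3, crossDir_add_two, crossDir_add_two] at he
      push_cast at he ⊢
      linear_combination he
    have h5 := normSq_crossDir h01 h ((1 + u) / 2 + (1 - w) / 2) ((1 - u) / 2 + (1 + w) / 2)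
    rw [h4, Complex.normSq_zero] at h5
    nlinarith [sq_nonneg ((1 + u) / 2 + (1 - w) / 2 - ((1 - u) / 2 + (1 + w) / 2))]

theorem image_chord_inter_sphere {i j : Fin 4} (h : j ≠ i) (h' : j ≠ i + 2) :
    chord i j '' Icc (-1) 1 ∩ Metric.sphere 0 1 = {crossDir i, crossDir j} := by
  ext z
  constructor
  · rintro ⟨⟨u, hu, rfl⟩, hz⟩
    rw [mem_sphere_zero_iff_norm] at hz
    by_cases h1 : u = 1
    · left; rw [h1, chord_one]
    · by_cases h2 : u = -1
      · right; rw [h2, chord_neg_one]; rfl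
      · exact absurd hz (norm_chord_lt h h' ⟨lt_of_le_of_ne hu.1 (Ne.symm h2),
          lt_of_le_of_ne hu.2 h1⟩).ne
  · rintro (rfl | rfl)
    · exact ⟨⟨1, by simp, chord_one i j⟩, by simp [norm_crossDir]⟩
    · exact ⟨⟨-1, by simp, chord_neg_one i j⟩, by simp [norm_crossDir]⟩

theorem bend_of_nonneg (i j : Fin 4) {u : ℝ} (hu : 0 ≤ u) : bend i j u = u * crossDir i := by
  simp [bend, hu]

theorem bend_of_nonpos (i j : Fin 4) {u : ℝ} (hu : u ≤ 0) :
    bend i j u = (-u : ℝ) * crossDir j := by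
  simp [bend, hu]

theorem image_bend (i j : Fin 4) : bend i j '' Icc (-1) 1 =
    (fun u : ℝ => (u : ℂ) * crossDir i) '' Icc 0 1 ∪
      (fun u : ℝ => (u : ℂ) * crossDir j) '' Icc 0 1 := by
  ext z
  constructor
  · rintro ⟨u, hu, rfl⟩
    rcases le_total 0 u with h | h
    · exact Or.inl ⟨u, ⟨h, hu.2⟩, (bend_of_nonneg i j h).symm⟩
    · exact Or.inr ⟨-u, ⟨by linarith, by linarith [hu.1]⟩, (bend_of_nonpos i j h).symm⟩
  · rintro (⟨u, hu, rfl⟩ | ⟨u, hu, rfl⟩)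
    · exact ⟨u, ⟨by linarith [hu.1], hu.2⟩, bend_of_nonneg i j hu.1⟩
    · exact ⟨-u, ⟨by linarith [hu.2], by linarith [hu.1]⟩, by
        rw [bend_of_nonpos i j (by linarith [hu.1]), neg_neg]⟩

theorem bend_injective {i j : Fin 4} (h : j ≠ i) : Function.Injective (bend i j) := by
  intro u w huw
  rcases le_total 0 u with hu | hu <;> rcases le_total 0 w with hw | hw
  · rw [bend_of_nonneg i j hu, bend_of_nonneg i j hw] at huw
    exact (ofReal_mul_crossDir_inj hu hw huw).1
  · rw [bend_of_nonneg i j hu, bend_of_nonpos i j hw] at huw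
    obtain ⟨h1, h2⟩ := ofReal_mul_crossDir_inj hu (by linarith) huw
    rcases h2 with h2 | h2
    · exact absurd h2.symm h
    · linarith
  · rw [bend_of_nonpos i j hu, bend_of_nonneg i j hw] at huw
    obtain ⟨h1, h2⟩ := ofReal_mul_crossDir_inj (by linarith) hw huw
    rcases h2 with h2 | h2
    · exact absurd h2 h
    · linarith
  · rw [bend_of_nonpos i j hu, bend_of_nonpos i j hw] at huw
    linarith [(ofReal_mul_crossDir_inj (by linarith) (by linarith) huw).1]

theorem image_bend_inter_sphere (i j : Fin 4) :
    bend i j '' Icc (-1) 1 ∩ Metric.sphere 0 1 = {crossDir i, crossDir j} := by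
  rw [image_bend]
  ext z
  constructor
  · rintro ⟨⟨u, hu, rfl⟩ | ⟨u, hu, rfl⟩, hz⟩ <;>
    · rw [mem_sphere_zero_iff_norm, norm_mul, norm_crossDir, mul_one, Complex.norm_real,
        Real.norm_of_nonneg hu.1] at hz
      simp [hz]
  · rintro (rfl | rfl)
    · exact ⟨Or.inl ⟨1, by simp, by simp⟩, by simp [norm_crossDir]⟩
    · exact ⟨Or.inr ⟨1, by simp, by simp⟩, by simp [norm_crossDir]⟩

theorem image_bend_inter_image_bend (σ : Equiv.Perm (Fin 4)) :
    bend (σ 0) (σ 2) '' Icc (-1) 1 ∩ bend (σ 1) (σ 3) '' Icc (-1) 1 = {0} := by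
  rw [image_bend, image_bend]
  refine Subset.antisymm ?_ ?_
  · have key : ∀ i j, i ≠ j → ∀ u ∈ Icc (0 : ℝ) 1, ∀ w ∈ Icc (0 : ℝ) 1,
        (w : ℂ) * crossDir (σ j) = u * crossDir (σ i) → (u : ℂ) * crossDir (σ i) = 0 := by
      intro i j hij u hu w hw h
      obtain ⟨h1, h2⟩ := ofReal_mul_crossDir_inj hw.1 hu.1 h
      rcases h2 with h2 | h2
      · exact absurd (σ.injective h2).symm hij
      · rw [← h1, h2]; simp
    rintro z ⟨⟨u, hu, rfl⟩ | ⟨u, hu, rfl⟩, ⟨w, hw, h⟩ | ⟨w, hw, h⟩⟩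
    · exact key 0 1 (by decide) u hu w hw h
    · exact key 0 3 (by decide) u hu w hw h
    · exact key 2 1 (by decide) u hu w hw h
    · exact key 2 3 (by decide) u hu w hw h
  · rintro _ rfl
    exact ⟨Or.inl ⟨0, by simp, by simp⟩, Or.inl ⟨0, by simp, by simp⟩⟩

theorem isArc_image {c : ℝ → SPt} (hc : Continuous c) (hi : Function.Injective c) :
    IsArc (c '' Icc (-1) 1) := by
  let f : Icc (-1 : ℝ) 1 → c '' Icc (-1) 1 := fun u => ⟨c u, mem_image_of_mem c u.2⟩
  have hf : Continuous f := by fun_prop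
  have hb : Function.Bijective f := by
    constructor
    · intro a b h; exact Subtype.ext (hi (congrArg Subtype.val h))
    · rintro ⟨_, u, hu, rfl⟩; exact ⟨⟨u, hu⟩, rfl⟩
  have H : Icc (-1 : ℝ) 1 ≃ₜ c '' Icc (-1) 1 :=
    Continuous.homeoOfEquivCompactToT2 (f := Equiv.ofBijective f hb) hf
  exact ⟨H.symm.trans (iccHomeoI (-1) 1 (by norm_num))⟩

theorem isClosedDisk_image {e : ℂ → SPt} (he : IsOpenEmbedding e) :
    IsClosedDisk (e '' Metric.closedBall 0 1) := by
  have hrank : Module.finrank ℝ ℂ = Module.finrank ℝ (EuclideanSpace ℝ (Fin 2)) := by simp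
  let L : ℂ ≃ₗᵢ[ℝ] EuclideanSpace ℝ (Fin 2) := Complex.orthonormalBasisOneI.repr
  have hL : L '' Metric.closedBall 0 1 = Metric.closedBall 0 1 := by simp
  have h1 := (he.isEmbedding.homeomorphImage (Metric.closedBall (0 : ℂ) 1))
  have h2 := L.toHomeomorph.isEmbedding.homeomorphImage (Metric.closedBall (0 : ℂ) 1)
  exact ⟨h1.symm.trans (h2.trans (Homeomorph.setCongr hL))⟩

theorem frontier_image_closedBall {e : ℂ → SPt} (he : IsOpenEmbedding e) :
    frontier (e '' Metric.closedBall 0 1) = e '' Metric.sphere 0 1 := by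
  have hcl : IsClosed (e '' Metric.closedBall 0 1) :=
    ((isCompact_closedBall (0 : ℂ) 1).image he.continuous).isClosed
  have hinter : interior (e '' Metric.closedBall 0 1) = e '' Metric.ball 0 1 := by
    refine Subset.antisymm ?_ (interior_maximal (image_mono Metric.ball_subset_closedBall)
      (he.isOpenMap _ Metric.isOpen_ball))
    intro y hy
    obtain ⟨z, -, rfl⟩ := interior_subset hy
    refine ⟨z, ?_, rfl⟩
    rw [← interior_closedBall (0 : ℂ) one_ne_zero]
    refine interior_maximal ?_ (isOpen_interior.preimage he.continuous)
      (show z ∈ e ⁻¹' interior (e '' Metric.closedBall 0 1) from hy)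
    intro w hw
    obtain ⟨w', hw', h⟩ := interior_subset hw
    exact he.injective h ▸ hw'
  rw [frontier, hcl.closure_eq, hinter, ← image_sdiff he.injective, Metric.closedBall_sdiff_ball]

end

section

open Filter

theorem halfTwistedSplice_of_chart {P Q : KnotProjection} {e : ℂ → SPt} (he : IsOpenEmbedding e)
    (σ : Equiv.Perm (Fin 4)) (hσ : σ 1 ≠ σ 0 + 2)
    (hout : P.image \ e '' Metric.ball 0 1 = Q.image \ e '' Metric.ball 0 1)
    (hP : P.crossings ∩ e '' Metric.closedBall 0 1 = ∅)
    (hQ : Q.crossings = insert (e 0) P.crossings)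
    (hPi : P.image ∩ e '' Metric.closedBall 0 1 =
      e '' (chord (σ 0) (σ 1) '' Icc (-1) 1) ∪ e '' (chord (σ 2) (σ 3) '' Icc (-1) 1))
    (hQi : Q.image ∩ e '' Metric.closedBall 0 1 =
      e '' (bend (σ 0) (σ 2) '' Icc (-1) 1) ∪ e '' (bend (σ 1) (σ 3) '' Icc (-1) 1)) :
    HalfTwistedSplice P Q := by
  have hfr := frontier_image_closedBall he
  have hne : ∀ i j : Fin 4, i ≠ j → σ i ≠ σ j := fun i j h => σ.injective.ne h
  have h23 := (perm_opposite σ hσ).1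
  have h01' : σ 1 ≠ σ 0 := hne 1 0 (by decide)
  have h23' : σ 3 ≠ σ 2 := hne 3 2 (by decide)
  have hd : ∀ i j : Fin 4, i ≠ j → crossDir (σ i) ≠ crossDir (σ j) := fun i j h =>
    crossDir_injective.ne (hne i j h)
  have harc : ∀ c : ℝ → ℂ, Continuous c → Function.Injective c →
      IsArc (e '' (c '' Icc (-1) 1)) := by
    intro c hc hi
    rw [← image_comp]
    exact isArc_image (he.continuous.comp hc) (he.injective.comp hi)
  have himg : ∀ X : Set ℂ, e '' X ∩ e '' Metric.sphere 0 1 = e '' (X ∩ Metric.sphere 0 1) :=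
    fun X => (image_inter he.injective).symm
  have hcard2 : ∀ (X : Set ℂ) (i j : Fin 4), i ≠ j →
      X ∩ Metric.sphere 0 1 = {crossDir (σ i), crossDir (σ j)} →
      (e '' X ∩ e '' Metric.sphere 0 1).ncard = 2 := by
    intro X i j hij h
    rw [himg, h, ncard_image_of_injective _ he.injective, ncard_pair (hd i j hij)]
  have hcard1 : ∀ (X Z : Set ℂ) (i j k l : Fin 4),
      X ∩ Metric.sphere 0 1 = {crossDir (σ i), crossDir (σ j)} →
      Z ∩ Metric.sphere 0 1 = {crossDir (σ k), crossDir (σ l)} → (∃ m : Fin 4,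
      ∀ n : Fin 4, ((n = i ∨ n = j) ∧ (n = k ∨ n = l)) ↔ n = m) →
      (e '' X ∩ e '' Metric.sphere 0 1 ∩ e '' Z).ncard = 1 := by
    rintro X Z i j k l hX hZ ⟨m, hm⟩
    rw [himg, ← image_inter he.injective, ncard_image_of_injective _ he.injective, ncard_eq_one]
    refine ⟨crossDir (σ m), ?_⟩
    have h1 : X ∩ Metric.sphere 0 1 ∩ Z =
        (X ∩ Metric.sphere 0 1) ∩ (Z ∩ Metric.sphere 0 1) := by
      ext z; simp only [mem_inter_iff]; tauto
    have hc : ∀ n k, crossDir (σ n) = crossDir (σ k) ↔ n = k := fun n k =>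
      ⟨fun h => σ.injective (crossDir_injective h), fun h => h ▸ rfl⟩
    rw [h1, hX, hZ]
    ext z
    simp only [mem_inter_iff, mem_insert_iff, mem_singleton_iff]
    constructor
    · rintro ⟨rfl | rfl, h⟩
      · rw [hc, hc] at h; rw [hc]; exact (hm i).1 ⟨Or.inl rfl, h⟩
      · rw [hc, hc] at h; rw [hc]; exact (hm j).1 ⟨Or.inr rfl, h⟩
    · rintro rfl
      simp only [hc]
      exact (hm m).2 rfl
  have ha₁ := image_chord_inter_sphere h01' hσ
  have ha₂ := image_chord_inter_sphere h23' h23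
  have hb₁ := image_bend_inter_sphere (σ 0) (σ 2)
  have hb₂ := image_bend_inter_sphere (σ 1) (σ 3)
  have h0D : e 0 ∈ e '' Metric.closedBall 0 1 := mem_image_of_mem e (by simp)
  have hbs : e '' Metric.ball 0 1 ⊆ e '' Metric.closedBall 0 1 :=
    image_mono Metric.ball_subset_closedBall
  have hsb : Disjoint (e '' Metric.sphere 0 1) (e '' Metric.ball 0 1) :=
    (disjoint_image_iff he.injective).2 Metric.sphere_disjoint_ball
  refine ⟨e '' Metric.closedBall 0 1, e 0, isClosedDisk_image he, ?_, ?_, hP, ⟨h0D, ?_⟩, ?_, hQ,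
    e '' (chord (σ 0) (σ 1) '' Icc (-1) 1), e '' (chord (σ 2) (σ 3) '' Icc (-1) 1),
    harc _ (continuous_chord _ _) (chord_injective h01'),
    harc _ (continuous_chord _ _) (chord_injective h23'), ?_, hPi, ?_, ?_,
    e '' (bend (σ 0) (σ 2) '' Icc (-1) 1), e '' (bend (σ 1) (σ 3) '' Icc (-1) 1),
    harc _ (continuous_bend _ _) (bend_injective (hne 2 0 (by decide))),
    harc _ (continuous_bend _ _) (bend_injective (hne 3 1 (by decide))), ?_, hQi, ?_, ?_,
    ?_, ?_, ?_, ?_⟩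
  · have h1 : ∀ X : Set SPt, X \ e '' Metric.closedBall 0 1 =
        (X \ e '' Metric.ball 0 1) \ e '' Metric.closedBall 0 1 := by
      intro X
      ext z
      constructor
      · exact fun h => ⟨⟨h.1, fun h' => h.2 (hbs h')⟩, h.2⟩
      · exact fun h => ⟨h.1.1, h.2⟩
    rw [h1, hout, ← h1]
  · have h1 : ∀ X : Set SPt, X ∩ e '' Metric.sphere 0 1 =
        (X \ e '' Metric.ball 0 1) ∩ e '' Metric.sphere 0 1 := by
      intro X
      ext z
      constructor
      · exact fun h => ⟨⟨h.1, disjoint_left.1 hsb h.2⟩, h.2⟩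
      · exact fun h => ⟨h.1.1, h.2⟩
    rw [hfr, h1, hout, ← h1]
  · rw [hfr]
    rintro ⟨z, hz, h⟩
    rw [he.injective h] at hz
    simp at hz
  · intro h
    have : e 0 ∈ P.crossings ∩ e '' Metric.closedBall 0 1 := ⟨h, h0D⟩
    rw [hP] at this
    exact this
  · rw [disjoint_image_iff he.injective, disjoint_left]
    rintro _ ⟨u, -, rfl⟩ ⟨w, -, h⟩
    exact chord_ne_chord σ hσ u w h.symm
  · rw [hfr]; exact hcard2 _ 0 1 (by decide) ha₁
  · rw [hfr]; exact hcard2 _ 2 3 (by decide) ha₂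
  · rw [← image_inter he.injective, image_bend_inter_image_bend, image_singleton]
  · rw [hfr]; exact hcard2 _ 0 2 (by decide) hb₁
  · rw [hfr]; exact hcard2 _ 1 3 (by decide) hb₂
  · rw [hfr]; exact hcard1 _ _ 0 2 0 1 hb₁ ha₁ ⟨0, by decide⟩
  · rw [hfr]; exact hcard1 _ _ 0 2 2 3 hb₁ ha₂ ⟨2, by decide⟩
  · rw [hfr]; exact hcard1 _ _ 1 3 0 1 hb₂ ha₁ ⟨1, by decide⟩
  · rw [hfr]; exact hcard1 _ _ 1 3 2 3 hb₂ ha₂ ⟨3, by decide⟩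

/-- A closed curve which crosses itself in a straight cross inside a round disk. -/
structure IsStraightCurve (F : ℝ → SPt) (e : ℂ → SPt) (σ : Equiv.Perm (Fin 4)) (δ : ℝ) :
    Prop where
  curve : IsCurve F
  emb : IsOpenEmbedding e
  pos : 0 < δ
  small : 4 * δ < 1
  arm : ∀ i, ∀ u ∈ Icc (0 : ℝ) 1, F (armParam 0 (1 / 2) i (δ * u)) = e (u * crossDir (σ i))
  out : ∀ x, x ∈ Ioo δ (1 / 2 - δ) ∨ x ∈ Ioo (1 / 2 + δ) (1 - δ) →
    F x ∉ e '' Metric.closedBall 0 1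

/-- Reflection of the second half of the parameter circle. -/
noncomputable def halfFlip (x : ℝ) : ℝ :=
  if Int.fract x ≤ 1 / 2 then Int.fract x else 3 / 2 - Int.fract x

theorem halfFlip_mem (x : ℝ) : halfFlip x ∈ Ico (0 : ℝ) 1 := by
  have h1 := Int.fract_nonneg x
  have h2 := Int.fract_lt_one x
  unfold halfFlip
  split_ifs with h
  · exact ⟨h1, h2⟩
  · constructor <;> linarith

theorem halfFlip_halfFlip (x : ℝ) : halfFlip (halfFlip x) = Int.fract x := by
  have h1 := Int.fract_lt_one x
  rw [halfFlip.eq_1 (halfFlip x), Int.fract_eq_self.2 (halfFlip_mem x)]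
  unfold halfFlip
  split_ifs with h h'
  · rfl
  · linarith
  · ring

theorem halfFlip_intEq {x y : ℝ} : IntEq (halfFlip x) (halfFlip y) ↔ IntEq x y := by
  constructor
  · intro h
    have h1 := h.eq_of_Ico (halfFlip_mem x) (halfFlip_mem y)
    have h2 : Int.fract x = Int.fract y := by
      rw [← halfFlip_halfFlip x, ← halfFlip_halfFlip y, h1]
    exact (intEq_fract x).symm.trans (h2 ▸ intEq_fract y)
  · rintro ⟨n, rfl⟩
    rw [halfFlip, halfFlip, Int.fract_add_intCast]
    exact IntEq.refl _

theorem IsCurve.exists_halfFlip {Y : Type*} [TopologicalSpace Y] {F : ℝ → Y} (hF : IsCurve F)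
    (h0 : F 0 = F (1 / 2)) : ∃ G : ℝ → Y, IsCurve G ∧ doubles G = doubles F ∧
      range G = range F ∧ (∀ x ∈ Icc (0 : ℝ) (1 / 2), G x = F x) ∧
      ∀ x ∈ Icc (1 / 2 : ℝ) 1, G x = F (3 / 2 - x) := by
  have hF1 : F 1 = F 0 := by simpa using hF.per 0
  set G₀ : ℝ → Y := fun x => if x ≤ 1 / 2 then F x else F (3 / 2 - x) with hG₀
  have hc : Continuous G₀ := by
    refine Continuous.if_le hF.cont (hF.cont.comp (by fun_prop)) continuous_id continuous_const ?_
    rintro x rfl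
    show F (1 / 2) = F (3 / 2 - 1 / 2)
    rw [← h0, ← hF1]; norm_num
  have hend : G₀ 0 = G₀ 1 := by
    simp only [hG₀]
    rw [if_pos (by norm_num), if_neg (by norm_num), h0]
    norm_num
  have hGG : ∀ x, G₀ (Int.fract x) = F (halfFlip x) := by
    intro x
    simp only [hG₀, halfFlip]
    split_ifs <;> rfl
  have hG2 : ∀ x, F (halfFlip (halfFlip x)) = F x := by
    intro x
    rw [halfFlip_halfFlip]
    exact hF.per.map_intEq (intEq_fract x)
  have hd : doubles (fun x => F (halfFlip x)) = doubles F := by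
    ext p
    constructor
    · rintro ⟨x, y, hxy, hx, hy⟩
      exact ⟨_, _, fun h => hxy (halfFlip_intEq.1 h), hx, hy⟩
    · rintro ⟨x, y, hxy, hx, hy⟩
      exact ⟨halfFlip x, halfFlip y, fun h => hxy (halfFlip_intEq.1 h), (hG2 x).trans hx,
        (hG2 y).trans hy⟩
  have hcont : Continuous fun x => F (halfFlip x) := by
    have := hc.continuousOn.comp_fract'' hend
    exact this.congr fun x => hGG x
  refine ⟨fun x => F (halfFlip x), ⟨hcont, fun x => ?_, fun x y z h1 h2 => ?_, hd ▸ hF.fin⟩, hd,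
    ?_, fun x hx => ?_, fun x hx => ?_⟩
  · simp only [halfFlip, Int.fract_add_one]
  · simpa only [halfFlip_intEq] using hF.tri _ _ _ h1 h2
  · refine Subset.antisymm ?_ ?_
    · rintro _ ⟨x, rfl⟩; exact ⟨_, rfl⟩
    · rintro _ ⟨x, rfl⟩; exact ⟨_, hG2 x⟩
  · show F (halfFlip x) = F x
    rw [halfFlip, Int.fract_eq_self.2 ⟨hx.1, by linarith [hx.2]⟩, if_pos hx.2]
  · show F (halfFlip x) = F (3 / 2 - x)
    rcases eq_or_lt_of_le hx.2 with rfl | h1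
    · rw [halfFlip, Int.fract_one, if_pos (by norm_num), h0]; norm_num
    · rw [halfFlip, Int.fract_eq_self.2 ⟨by linarith [hx.1], h1⟩]
      split_ifs with h2
      · have h3 : x = 1 / 2 := le_antisymm h2 hx.1
        rw [h3, ← h0, ← hF1]; norm_num
      · rfl

theorem IsStraightCurve.exists_flip {F : ℝ → SPt} {e : ℂ → SPt} {σ : Equiv.Perm (Fin 4)} {δ : ℝ}
    (h : IsStraightCurve F e σ δ) : ∃ G, IsStraightCurve G e (Equiv.swap 1 2 |>.trans σ) δ ∧
      doubles G = doubles F ∧ range G = range F := by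
  have hz : ∀ i, F (![0, 0, 1 / 2, 1 / 2] i) = e 0 := by
    intro i
    have := h.arm i 0 (by simp)
    simpa [armParam] using this
  have hF0 : F 0 = F (1 / 2) := (hz 0).trans (hz 2).symm
  obtain ⟨G, hG, hGd, hGr, h1, h2⟩ := h.curve.exists_halfFlip hF0
  have hδ := h.pos
  have hs := h.small
  refine ⟨G, ⟨hG, h.emb, hδ, hs, fun i u hu => ?_, fun x hx => ?_⟩, hGd, hGr⟩
  · have hu0 : 0 ≤ δ * u := mul_nonneg hδ.le hu.1
    have hu1 : δ * u ≤ δ := by nlinarith [hu.2]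
    have hp : ∀ x, F (x + 1) = F x := h.curve.per
    have hp' : ∀ x, G (x + 1) = G x := hG.per
    fin_cases i
    · have h3 := h.arm 0 u hu
      have h4 := h1 (δ * u) ⟨hu0, by linarith⟩
      simpa [armParam, Equiv.swap_apply_def, h4] using h3
    · have h3 := h.arm 2 u hu
      have h4 := h2 (-(δ * u) + 1) ⟨by linarith, by linarith⟩
      rw [hp', show 3 / 2 - (-(δ * u) + 1) = 1 / 2 + δ * u by ring] at h4
      simpa [armParam, Equiv.swap_apply_def, h4] using h3
    · have h3 := h.arm 1 u hu
      have h4 := h2 (1 / 2 + δ * u) ⟨by linarith, by linarith⟩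
      rw [show 3 / 2 - (1 / 2 + δ * u) = -(δ * u) + 1 by ring, hp] at h4
      simp only [one_div] at h4
      simpa [armParam, Equiv.swap_apply_def, h4] using h3
    · have h3 := h.arm 3 u hu
      have h4 := h1 (1 / 2 + -(δ * u)) ⟨by linarith, by linarith⟩
      simp only [one_div] at h4
      simpa [armParam, Equiv.swap_apply_def, h4] using h3
  · rcases hx with hx | hx
    · rw [h1 x ⟨by linarith [hx.1], by linarith [hx.2]⟩]
      exact h.out x (Or.inl hx)
    · rw [h2 x ⟨by linarith [hx.1], by linarith [hx.2]⟩]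
      exact h.out _ (Or.inr ⟨by linarith [hx.2], by linarith [hx.1]⟩)

end

section

open Filter

/-- The curve obtained from a straight cross by replacing its arms by two chords, on `[0, 1]`. -/
noncomputable def smoothing (F : ℝ → SPt) (e : ℂ → SPt) (σ : Equiv.Perm (Fin 4)) (δ x : ℝ) : SPt :=
  if x ≤ δ then e (chord (σ 0) (σ 1) (x / δ))
  else if x ≤ 1 / 2 - δ then F x
  else if x ≤ 1 / 2 + δ then e (chord (σ 2) (σ 3) ((x - 1 / 2) / δ))
  else if x ≤ 1 - δ then F x
  else e (chord (σ 0) (σ 1) ((x - 1) / δ))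

namespace IsStraightCurve

variable {F : ℝ → SPt} {e : ℂ → SPt} {σ : Equiv.Perm (Fin 4)} {δ : ℝ}

theorem map_zero (h : IsStraightCurve F e σ δ) : F 0 = e 0 := by
  simpa [armParam] using h.arm 0 0 (by simp)

theorem map_half (h : IsStraightCurve F e σ δ) : F (1 / 2) = e 0 := by
  simpa [armParam] using h.arm 2 0 (by simp)

theorem map_delta (h : IsStraightCurve F e σ δ) : F δ = e (crossDir (σ 0)) := by
  simpa [armParam] using h.arm 0 1 (by simp)

theorem map_one_sub (h : IsStraightCurve F e σ δ) : F (1 - δ) = e (crossDir (σ 1)) := by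
  have h1 : F (-δ) = e (crossDir (σ 1)) := by simpa [armParam] using h.arm 1 1 (by simp)
  rw [← h1, ← h.curve.per (-δ)]; ring_nf

theorem map_half_add (h : IsStraightCurve F e σ δ) : F (1 / 2 + δ) = e (crossDir (σ 2)) := by
  simpa [armParam] using h.arm 2 1 (by simp)

theorem map_half_sub (h : IsStraightCurve F e σ δ) : F (1 / 2 - δ) = e (crossDir (σ 3)) := by
  have h1 := h.arm 3 1 (by simp)
  simp only [armParam, mul_one, Complex.ofReal_one, one_mul] at h1
  rw [← h1]; simp [sub_eq_add_neg]

theorem smoothing_delta (h : IsStraightCurve F e σ δ) : e (chord (σ 0) (σ 1) (δ / δ)) = F δ := by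
  rw [div_self h.pos.ne', chord_one, h.map_delta]

theorem smoothing_half_sub (h : IsStraightCurve F e σ δ) :
    e (chord (σ 2) (σ 3) ((1 / 2 - δ - 1 / 2) / δ)) = F (1 / 2 - δ) := by
  rw [show (1 / 2 - δ - 1 / 2) / δ = -1 by field_simp [h.pos.ne']; ring, chord_neg_one,
    h.map_half_sub]

theorem smoothing_half_add (h : IsStraightCurve F e σ δ) :
    e (chord (σ 2) (σ 3) ((1 / 2 + δ - 1 / 2) / δ)) = F (1 / 2 + δ) := by
  rw [show (1 / 2 + δ - 1 / 2) / δ = 1 by field_simp [h.pos.ne']; ring, chord_one,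
    h.map_half_add]

theorem smoothing_one_sub (h : IsStraightCurve F e σ δ) :
    e (chord (σ 0) (σ 1) ((1 - δ - 1) / δ)) = F (1 - δ) := by
  rw [show (1 - δ - 1) / δ = -1 by field_simp [h.pos.ne']; ring, chord_neg_one, h.map_one_sub]

theorem continuous_smoothing (h : IsStraightCurve F e σ δ) :
    Continuous (smoothing F e σ δ) := by
  have hδ := h.pos
  have hs := h.small
  have hF := h.curve.cont
  have hch : ∀ i j, ∀ c : ℝ, Continuous fun x => e (chord i j ((x - c) / δ)) := fun i j c =>
    h.emb.continuous.comp ((continuous_chord i j).comp (by fun_prop))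
  unfold smoothing
  refine Continuous.if_le (by simpa using hch (σ 0) (σ 1) 0) ?_ continuous_id continuous_const ?_
  · refine Continuous.if_le hF ?_ continuous_id continuous_const ?_
    · refine Continuous.if_le (hch _ _ _) ?_ continuous_id continuous_const ?_
      · refine Continuous.if_le hF (hch _ _ _) continuous_id continuous_const ?_
        rintro x rfl
        exact h.smoothing_one_sub.symm
      · rintro x rfl
        rw [if_pos (by linarith)]
        exact h.smoothing_half_add
    · rintro x rfl
      rw [if_pos (by linarith)]
      exact h.smoothing_half_sub.symm
  · rintro x rfl
    rw [if_pos (by linarith)]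
    exact h.smoothing_delta

theorem exists_chord_or (h : IsStraightCurve F e σ δ) (x : ℝ) :
    (∃ u ∈ Icc (-1 : ℝ) 1, IntEq x (δ * u)) ∨ (∃ u ∈ Icc (-1 : ℝ) 1, IntEq x (1 / 2 + δ * u)) ∨
      ∃ y, IntEq x y ∧ (y ∈ Ioo δ (1 / 2 - δ) ∨ y ∈ Ioo (1 / 2 + δ) (1 - δ)) := by
  have hδ := h.pos
  have hx := (intEq_fract x).symm
  have h0 := Int.fract_nonneg x
  have h1 := Int.fract_lt_one x
  set y := Int.fract x
  have hdiv : ∀ c, |c| ≤ δ → c / δ ∈ Icc (-1 : ℝ) 1 := by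
    intro c hc
    rw [abs_le] at hc
    constructor
    · rw [le_div_iff₀ hδ]; linarith [hc.1]
    · rw [div_le_one hδ]; exact hc.2
  have hm : ∀ c, δ * (c / δ) = c := fun c => mul_div_cancel₀ c hδ.ne'
  rcases le_or_gt y δ with g1 | g1
  · exact Or.inl ⟨y / δ, hdiv _ (by rw [abs_le]; constructor <;> linarith), by rwa [hm]⟩
  rcases lt_or_ge y (1 / 2 - δ) with g2 | g2
  · exact Or.inr (Or.inr ⟨y, hx, Or.inl ⟨g1, g2⟩⟩)
  rcases le_or_gt y (1 / 2 + δ) with g3 | g3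
  · refine Or.inr (Or.inl ⟨(y - 1 / 2) / δ, hdiv _ (by rw [abs_le]; constructor <;> linarith), ?_⟩)
    rw [hm]; simpa using hx
  rcases lt_or_ge y (1 - δ) with g4 | g4
  · exact Or.inr (Or.inr ⟨y, hx, Or.inr ⟨g3, g4⟩⟩)
  · refine Or.inl ⟨(y - 1) / δ, hdiv _ (by rw [abs_le]; constructor <;> linarith), ?_⟩
    rw [hm]
    exact hx.trans ⟨1, by push_cast; ring⟩

theorem map_mul (h : IsStraightCurve F e σ δ) {u : ℝ} (hu : u ∈ Icc (-1 : ℝ) 1) :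
    F (δ * u) = e (bend (σ 0) (σ 1) u) := by
  rcases le_total 0 u with h0 | h0
  · rw [bend_of_nonneg _ _ h0, ← h.arm 0 u ⟨h0, hu.2⟩]
    simp [armParam]
  · rw [bend_of_nonpos _ _ h0, ← h.arm 1 (-u) ⟨by linarith, by linarith [hu.1]⟩]
    simp [armParam]

theorem map_half_add_mul (h : IsStraightCurve F e σ δ) {u : ℝ} (hu : u ∈ Icc (-1 : ℝ) 1) :
    F (1 / 2 + δ * u) = e (bend (σ 2) (σ 3) u) := by
  rcases le_total 0 u with h0 | h0
  · rw [bend_of_nonneg _ _ h0, ← h.arm 2 u ⟨h0, hu.2⟩]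
    simp [armParam]
  · rw [bend_of_nonpos _ _ h0, ← h.arm 3 (-u) ⟨by linarith, by linarith [hu.1]⟩]
    simp [armParam]

theorem smoothing_fract_mul (h : IsStraightCurve F e σ δ) {u : ℝ} (hu : u ∈ Icc (-1 : ℝ) 1) :
    smoothing F e σ δ (Int.fract (δ * u)) = e (chord (σ 0) (σ 1) u) := by
  have hδ := h.pos
  have hs := h.small
  have hl : -δ ≤ δ * u := by nlinarith [hu.1]
  have hr : δ * u ≤ δ := by nlinarith [hu.2]
  rcases le_or_gt 0 u with h0 | h0
  · rw [Int.fract_eq_self.2 ⟨mul_nonneg hδ.le h0, by linarith⟩, smoothing, if_pos hr,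
      mul_div_cancel_left₀ _ hδ.ne']
  · have h1 : δ * u < 0 := mul_neg_of_pos_of_neg hδ h0
    rw [← Int.fract_add_one, Int.fract_eq_self.2 ⟨by linarith, by linarith⟩, smoothing,
      if_neg (by linarith), if_neg (by linarith), if_neg (by linarith)]
    split_ifs with h2
    · have h3 : δ * u + 1 = 1 - δ := by linarith
      have h4 : u = -1 := by
        apply mul_left_cancel₀ hδ.ne'; linarith
      rw [h3, h4, h.map_one_sub, chord_neg_one]
    · rw [add_sub_cancel_right, mul_div_cancel_left₀ _ hδ.ne']

theorem smoothing_fract_half_add_mul (h : IsStraightCurve F e σ δ) {u : ℝ}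
    (hu : u ∈ Icc (-1 : ℝ) 1) :
    smoothing F e σ δ (Int.fract (1 / 2 + δ * u)) = e (chord (σ 2) (σ 3) u) := by
  have hδ := h.pos
  have hs := h.small
  have hl : -δ ≤ δ * u := by nlinarith [hu.1]
  have hr : δ * u ≤ δ := by nlinarith [hu.2]
  rw [Int.fract_eq_self.2 ⟨by linarith, by linarith⟩, smoothing, if_neg (by linarith)]
  split_ifs with h1 h2
  · have h3 : 1 / 2 + δ * u = 1 / 2 - δ := by linarith
    have h4 : u = -1 := by
      apply mul_left_cancel₀ hδ.ne'; linarith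
    rw [h3, h4, h.map_half_sub, chord_neg_one]
  · rw [add_sub_cancel_left, mul_div_cancel_left₀ _ hδ.ne']
  · exact absurd (by linarith) h2
  · exact absurd (by linarith) h2

theorem smoothing_of_mem (h : IsStraightCurve F e σ δ) {y : ℝ}
    (hy : y ∈ Ioo δ (1 / 2 - δ) ∨ y ∈ Ioo (1 / 2 + δ) (1 - δ)) :
    smoothing F e σ δ (Int.fract y) = F y := by
  have hδ := h.pos
  have hs := h.small
  rcases hy with hy | hy
  · rw [Int.fract_eq_self.2 ⟨by linarith [hy.1], by linarith [hy.2]⟩, smoothing,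
      if_neg (by linarith [hy.1]), if_pos hy.2.le]
  · rw [Int.fract_eq_self.2 ⟨by linarith [hy.1], by linarith [hy.2]⟩, smoothing,
      if_neg (by linarith [hy.1]), if_neg (by linarith [hy.1]), if_neg (by linarith [hy.1]),
      if_pos hy.2.le]

/-- A curve with a straight cross arises by a half-twisted splice from a curve with one double
point less, provided that the first two arms of the cross are adjacent. -/
theorem exists_halfTwistedSplice (h : IsStraightCurve F e σ δ) (hσ : σ 1 ≠ σ 0 + 2)
    {Q : KnotProjection} (hQr : Q.image = range F) (hQd : Q.crossings = doubles F) :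
    ∃ P : KnotProjection, HalfTwistedSplice P Q ∧ P.crossings.ncard + 1 = Q.crossings.ncard := by
  have hδ := h.pos
  have hs := h.small
  have hinj := h.emb.injective
  have h01 : σ 1 ≠ σ 0 := σ.injective.ne (by decide)
  have h23 : σ 3 ≠ σ 2 := σ.injective.ne (by decide)
  have hσ' := (perm_opposite σ hσ).1
  set D := e '' Metric.closedBall 0 1 with hD
  have hbD : e '' Metric.ball 0 1 ⊆ D := image_mono Metric.ball_subset_closedBall
  set p : ℝ → SPt := fun x => smoothing F e σ δ (Int.fract x) with hp
  have hcont : Continuous p := by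
    refine h.continuous_smoothing.continuousOn.comp_fract'' ?_
    rw [smoothing, smoothing, if_pos hδ.le, if_neg (by linarith), if_neg (by linarith),
      if_neg (by linarith), if_neg (by linarith)]
    simp
  have hper : Function.Periodic p 1 := fun x => by simp only [hp, Int.fract_add_one]
  have hpA : ∀ u ∈ Icc (-1 : ℝ) 1, p (δ * u) = e (chord (σ 0) (σ 1) u) := fun u hu =>
    h.smoothing_fract_mul hu
  have hpB : ∀ u ∈ Icc (-1 : ℝ) 1, p (1 / 2 + δ * u) = e (chord (σ 2) (σ 3) u) := fun u hu =>
    h.smoothing_fract_half_add_mul hu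
  have hchord : ∀ i j : Fin 4, j ≠ i → j ≠ i + 2 → ∀ u ∈ Icc (-1 : ℝ) 1,
      e (chord i j u) = e (bend i j u) ∨
      e (chord i j u) ∈ e '' Metric.ball 0 1 ∧ e (bend i j u) ∈ e '' Metric.ball 0 1 := by
    intro i j hij hij' u hu
    by_cases h1 : u = 1
    · left; rw [h1, chord_one, bend_of_nonneg _ _ zero_le_one]; simp
    by_cases h2 : u = -1
    · left; rw [h2, chord_neg_one, bend_of_nonpos _ _ (by norm_num)]; simp
    have hu' : u ∈ Ioo (-1 : ℝ) 1 := ⟨lt_of_le_of_ne hu.1 (Ne.symm h2), lt_of_le_of_ne hu.2 h1⟩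
    right
    refine ⟨mem_image_of_mem e ?_, mem_image_of_mem e ?_⟩
    · rw [mem_ball_zero_iff]; exact norm_chord_lt hij hij' hu'
    · rw [mem_ball_zero_iff]
      rcases le_total 0 u with h0 | h0
      · rw [bend_of_nonneg _ _ h0, norm_mul, norm_crossDir, mul_one, Complex.norm_real,
          Real.norm_of_nonneg h0]
        exact hu'.2
      · rw [bend_of_nonpos _ _ h0, norm_mul, norm_crossDir, mul_one, Complex.norm_real,
          Real.norm_of_nonneg (by linarith)]
        linarith [hu'.1]
  have hpF : ∀ x, p x = F x ∨ (p x ∈ e '' Metric.ball 0 1 ∧ F x ∈ e '' Metric.ball 0 1) := by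
    intro x
    rcases h.exists_chord_or x with ⟨u, hu, hx⟩ | ⟨u, hu, hx⟩ | ⟨y, hx, hy⟩
    · rw [hper.map_intEq hx, h.curve.per.map_intEq hx, hpA u hu, h.map_mul hu]
      exact hchord _ _ h01 hσ u hu
    · rw [hper.map_intEq hx, h.curve.per.map_intEq hx, hpB u hu, h.map_half_add_mul hu]
      exact hchord _ _ h23 hσ' u hu
    · left
      rw [hper.map_intEq hx, h.curve.per.map_intEq hx]
      exact h.smoothing_of_mem hy
  have hpD : ∀ x, p x ∈ D → (∃ u ∈ Icc (-1 : ℝ) 1, IntEq x (δ * u)) ∨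
      ∃ u ∈ Icc (-1 : ℝ) 1, IntEq x (1 / 2 + δ * u) := by
    intro x hxD
    rcases h.exists_chord_or x with hx | hx | ⟨y, hx, hy⟩
    · exact Or.inl hx
    · exact Or.inr hx
    · rw [hper.map_intEq hx, show p y = F y from h.smoothing_of_mem hy] at hxD
      exact absurd hxD (h.out y hy)
  have hpI : ∀ x y, p x = p y → p x ∈ D → IntEq x y := by
    intro x y hxy hxD
    have hyD : p y ∈ D := hxy ▸ hxD
    rcases hpD x hxD with ⟨u, hu, hx⟩ | ⟨u, hu, hx⟩ <;>
      rcases hpD y hyD with ⟨w, hw, hy⟩ | ⟨w, hw, hy⟩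
    · rw [hper.map_intEq hx, hper.map_intEq hy, hpA u hu, hpA w hw] at hxy
      rw [chord_injective h01 (hinj hxy)] at hx
      exact hx.trans hy.symm
    · rw [hper.map_intEq hx, hper.map_intEq hy, hpA u hu, hpB w hw] at hxy
      exact absurd (hinj hxy) (chord_ne_chord σ hσ u w)
    · rw [hper.map_intEq hx, hper.map_intEq hy, hpB u hu, hpA w hw] at hxy
      exact absurd (hinj hxy).symm (chord_ne_chord σ hσ w u)
    · rw [hper.map_intEq hx, hper.map_intEq hy, hpB u hu, hpB w hw] at hxy
      rw [chord_injective h23 (hinj hxy)] at hx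
      exact hx.trans hy.symm
  have hpF' : ∀ x, p x ∉ D → p x = F x := fun x hx =>
    (hpF x).resolve_right fun h' => hx (hbD h'.1)
  have hpF'' : ∀ x, F x ∉ D → p x = F x := fun x hx =>
    (hpF x).resolve_right fun h' => hx (hbD h'.2)
  have hFarm : ∀ x, F x ∈ D → ∃ i, ∃ u ∈ Icc (0 : ℝ) 1,
      IntEq x (armParam 0 (1 / 2) i (δ * u)) ∧ F x = e (u * crossDir (σ i)) := by
    intro x hxD
    have key : ∀ i, ∀ u ∈ Icc (0 : ℝ) 1, IntEq x (armParam 0 (1 / 2) i (δ * u)) →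
        ∃ i, ∃ u ∈ Icc (0 : ℝ) 1,
        IntEq x (armParam 0 (1 / 2) i (δ * u)) ∧ F x = e (u * crossDir (σ i)) :=
      fun i u hu hx => ⟨i, u, hu, hx, by rw [h.curve.per.map_intEq hx, h.arm i u hu]⟩
    rcases h.exists_chord_or x with ⟨u, hu, hx⟩ | ⟨u, hu, hx⟩ | ⟨y, hx, hy⟩
    · rcases le_total 0 u with h0 | h0
      · exact key 0 u ⟨h0, hu.2⟩ (by simpa [armParam] using hx)
      · exact key 1 (-u) ⟨by linarith, by linarith [hu.1]⟩ (by simpa [armParam] using hx)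
    · rcases le_total 0 u with h0 | h0
      · exact key 2 u ⟨h0, hu.2⟩ (by simpa [armParam] using hx)
      · exact key 3 (-u) ⟨by linarith, by linarith [hu.1]⟩ (by simpa [armParam] using hx)
    · rw [h.curve.per.map_intEq hx] at hxD
      exact absurd hxD (h.out y hy)
  have h0D : e 0 ∈ D := mem_image_of_mem e (by simp)
  have hdp : doubles p ∩ D = ∅ := by
    rw [eq_empty_iff_forall_notMem]
    rintro z ⟨⟨x, y, hxy, hx, hy⟩, hz⟩
    exact hxy (hpI x y (hx.trans hy.symm) (hx ▸ hz))
  have h0p : e 0 ∉ doubles p := fun h' => by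
    have : e 0 ∈ doubles p ∩ D := ⟨h', h0D⟩
    rw [hdp] at this
    exact this
  have hd : doubles F = insert (e 0) (doubles p) := by
    ext z
    constructor
    · rintro ⟨x, y, hxy, hx, hy⟩
      by_cases hz : z ∈ D
      · obtain ⟨i, u, hu, hxi, hxe⟩ := hFarm x (hx ▸ hz)
        obtain ⟨j, w, hw, hyj, hye⟩ := hFarm y (hy ▸ hz)
        have h1 : e (u * crossDir (σ i)) = e (w * crossDir (σ j)) := by
          rw [← hxe, ← hye, hx, hy]
        obtain ⟨rfl, h2⟩ := ofReal_mul_crossDir_inj hu.1 hw.1 (hinj h1)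
        rcases h2 with h2 | h2
        · rw [← σ.injective h2] at hyj
          exact absurd (hxi.trans hyj.symm) hxy
        · left; rw [← hx, hxe, h2]; simp
      · exact Or.inr ⟨x, y, hxy, (hpF'' x (hx ▸ hz)).trans hx, (hpF'' y (hy ▸ hz)).trans hy⟩
    · rintro (rfl | ⟨x, y, hxy, hx, hy⟩)
      · refine ⟨0, 1 / 2, fun hI => ?_, h.map_zero, h.map_half⟩
        have := hI.eq_of_abs_lt (by norm_num [abs_lt])
        norm_num at this
      · have hz : z ∉ D := fun hz => hxy (hpI x y (hx.trans hy.symm) (hx ▸ hz))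
        exact ⟨x, y, hxy, (hpF' x (hx ▸ hz)).symm.trans hx, (hpF' y (hy ▸ hz)).symm.trans hy⟩
  have hfin : (doubles p).Finite := h.curve.fin.subset (hd ▸ subset_insert _ _)
  have hcurve : IsCurve p := by
    refine ⟨hcont, hper, fun x y z hxy hyz => ?_, hfin⟩
    by_cases hxD : p x ∈ D
    · exact Or.inl (hpI x y hxy hxD)
    · have e1 := hpF' x hxD
      have e2 := hpF' y (hxy ▸ hxD)
      have e3 := hpF' z (hyz ▸ hxy ▸ hxD)
      exact h.curve.tri x y z (by rw [← e1, ← e2, hxy]) (by rw [← e2, ← e3, hyz])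
  have hPc : hcurve.toKnotProjection.crossings = doubles p :=
    hcurve.toKnotProjection.crossings_eq_doubles
  have hPr : hcurve.toKnotProjection.image = range p := rfl
  refine ⟨hcurve.toKnotProjection, halfTwistedSplice_of_chart h.emb σ hσ ?_ ?_ ?_ ?_ ?_, ?_⟩
  · rw [hPr, hQr]
    ext z
    constructor
    · rintro ⟨⟨x, rfl⟩, hx⟩
      exact ⟨⟨x, ((hpF x).resolve_right fun h' => hx h'.1).symm⟩, hx⟩
    · rintro ⟨⟨x, rfl⟩, hx⟩
      exact ⟨⟨x, ((hpF x).resolve_right fun h' => hx h'.2)⟩, hx⟩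
  · rw [hPc]; exact hdp
  · rw [hPc, hQd]; exact hd
  · rw [hPr]
    have hle : ∀ i j : Fin 4, j ≠ i → j ≠ i + 2 → ∀ u ∈ Icc (-1 : ℝ) 1, e (chord i j u) ∈ D :=
      fun i j hij hij' u hu => mem_image_of_mem e (by
        rw [mem_closedBall_zero_iff]; exact norm_chord_le hij hij' hu)
    ext z
    constructor
    · rintro ⟨⟨x, rfl⟩, hx⟩
      rcases hpD x hx with ⟨u, hu, hxu⟩ | ⟨u, hu, hxu⟩
      · rw [hper.map_intEq hxu, hpA u hu]
        exact Or.inl (mem_image_of_mem e (mem_image_of_mem _ hu))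
      · rw [hper.map_intEq hxu, hpB u hu]
        exact Or.inr (mem_image_of_mem e (mem_image_of_mem _ hu))
    · rintro (⟨_, ⟨u, hu, rfl⟩, rfl⟩ | ⟨_, ⟨u, hu, rfl⟩, rfl⟩)
      · exact ⟨⟨_, hpA u hu⟩, hle _ _ h01 hσ u hu⟩
      · exact ⟨⟨_, hpB u hu⟩, hle _ _ h23 hσ' u hu⟩
  · rw [hQr, image_bend, image_bend, image_union, image_union]
    ext z
    constructor
    · rintro ⟨⟨x, rfl⟩, hx⟩
      obtain ⟨i, u, hu, -, hxe⟩ := hFarm x hx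
      have h1 : F x ∈ e '' ((fun u : ℝ => (u : ℂ) * crossDir (σ i)) '' Icc 0 1) := by
        rw [hxe]; exact mem_image_of_mem e (mem_image_of_mem _ hu)
      fin_cases i
      exacts [Or.inl (Or.inl h1), Or.inr (Or.inl h1), Or.inl (Or.inr h1), Or.inr (Or.inr h1)]
    · have key : ∀ i, e '' ((fun u : ℝ => (u : ℂ) * crossDir (σ i)) '' Icc 0 1) ⊆ range F ∩ D := by
        rintro i _ ⟨_, ⟨u, hu, rfl⟩, rfl⟩
        refine ⟨⟨_, h.arm i u hu⟩, mem_image_of_mem e ?_⟩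
        rw [mem_closedBall_zero_iff, norm_mul, norm_crossDir, mul_one, Complex.norm_real,
          Real.norm_of_nonneg hu.1]
        exact hu.2
      rintro ((hz | hz) | (hz | hz))
      exacts [key 0 hz, key 2 hz, key 1 hz, key 3 hz]
  · rw [hPc, hQd, hd, ncard_insert_of_notMem h0p hfin]

end IsStraightCurve

theorem KnotProjection.exists_spliceStep (Q : KnotProjection) (hQ : Q.crossings.Nonempty) :
    ∃ P : KnotProjection, SpliceStep P Q ∧ P.crossings.ncard + 1 = Q.crossings.ncard := by
  obtain ⟨Q', e, σ, δ, hQQ, he, hδ, hδ4, harm, hout⟩ := Q.exists_straight hQ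
  have hs : IsStraightCurve Q'.f e σ δ := ⟨Q'.isCurve, he, hδ, hδ4, harm, hout⟩
  have hmain : ∃ P : KnotProjection, HalfTwistedSplice P Q' ∧
      P.crossings.ncard + 1 = Q'.crossings.ncard := by
    by_cases hσ : σ 1 = σ 0 + 2
    · obtain ⟨G, hG, hGd, hGr⟩ := hs.exists_flip
      refine hG.exists_halfTwistedSplice ?_ (by rw [hGr]; rfl)
        (by rw [hGd]; exact Q'.crossings_eq_doubles)
      have h1 : σ 2 ≠ σ 1 := σ.injective.ne (by decide)
      rw [hσ] at h1
      simpa [Equiv.swap_apply_def] using h1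
    · exact hs.exists_halfTwistedSplice hσ rfl Q'.crossings_eq_doubles
  obtain ⟨P, hP, hPn⟩ := hmain
  exact ⟨P, ⟨P, Q', ProjEquiv.refl P, hP, hQQ⟩, hPn.trans hQQ.ncard_crossings⟩

theorem KnotProjection.exists_splice_sequence (n : ℕ) : ∀ P : KnotProjection,
    P.crossings.ncard = n → ∃ g : ℕ → KnotProjection, IsTrivialProjection (g 0) ∧
      g n = P ∧ ∀ i < n, SpliceStep (g i) (g (i + 1)) := by
  induction n with
  | zero =>
    intro P hP
    refine ⟨fun _ => P, ?_, rfl, fun i hi => absurd hi (Nat.not_lt_zero i)⟩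
    have hfin : P.crossings.Finite := P.double_finite
    exact (ncard_eq_zero hfin).1 hP
  | succ n ih =>
    intro P hP
    obtain ⟨P₁, hstep, hcard⟩ := P.exists_spliceStep
      (nonempty_of_ncard_ne_zero (by rw [hP]; exact Nat.succ_ne_zero n))
    obtain ⟨g, h0, hn, hg⟩ := ih P₁ (by omega)
    refine ⟨fun i => if i ≤ n then g i else P, by simpa using h0, by simp, fun i hi => ?_⟩
    rcases Nat.lt_or_ge i n with h | h
    · have h1 : i + 1 ≤ n := h
      simpa [h.le, h1] using hg i h
    · have h1 : i = n := by omega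
      subst h1
      simpa [hn] using hstep

end

/-- Every knot projection on `S²` with `n` crossings is obtained from
the trivial projection by a sequence of exactly `n` half-twisted splices `A`. -/
theorem trivial_to_any_in_crossing_number_splices (P : KnotProjection) :
    ∃ g : ℕ → KnotProjection, IsTrivialProjection (g 0) ∧
      g P.crossings.ncard = P ∧
      ∀ i < P.crossings.ncard, SpliceStep (g i) (g (i + 1)) := by
  exact KnotProjection.exists_splice_sequence _ P rfl
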